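/- arXiv:1105.1349 — 2 statements merged into one kernel-verified Lean document; each statement's English description precedes it below -/
import Mathlib

section
/- Let H♯ = −I₁ + I₂ + η I₃² + Σ_{3l+2k≥5} a_{l,k} I₁^l I₃^k with η ≠ 0 and given coefficients a_{l,k} ∈ ℂ. The equation Dz = X_{H♯}(z) has a formal solution Ẑ ∈ τ⁻¹𝖳⁴[[τ⁻¹]] of the form Ẑ(φ,τ) = 𝓡_φ ξ(τ) with ξ ∈ τ⁻¹ℂ⁴[[τ⁻¹]], whose components satisfy ξ₁ = −(∂_τ r) cos θ, ξ₂ = −(∂_τ r) sin θ, ξ₃ = r cos θ, ξ₄ = r sin θ, where r, θ ∈ ℂ[[τ⁻¹]] are odd formal power series (only odd powers of τ⁻¹) with leading orders r = κτ⁻¹ + ⋯ and θ = −(a_{1,1}/η)τ⁻¹ + ⋯, κ² = −2/η. The solution Ẑ is unique up to the rotation 𝓡_π (Ẑ and 𝓡_π Ẑ are the only formal solutions with these properties), and any other nonzero formal solution Ŷ ∈ τ⁻¹𝖳⁴[[τ⁻¹]] satisfies Ŷ(φ,τ) = Ẑ(φ+φ₀, τ+τ₀) for some (φ₀, τ₀)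 ∈ ℂ². -/
noncomputable section
open Complex Filter Set MeasureTheory Matrix

abbrev C4 := Fin 4 → ℂ

def Jmat : Matrix (Fin 4) (Fin 4) ℂ :=
  !![0, 0, 1, 0;
     0, 0, 0, 1;
     -1, 0, 0, 0;
     0, -1, 0, 0]

def Om (x y : C4) : ℂ := dotProduct x (Jmat.mulVec y)

def gradC (H : C4 → ℂ) (x : C4) : C4 := fun i => fderiv ℂ H x (Pi.single i 1)

def XH (H : C4 → ℂ) (x : C4) : C4 := Jmat.mulVec (gradC H x)

def DXH (H : C4 → ℂ) (x : C4) : Matrix (Fin 4) (Fin 4) ℂ :=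
  Matrix.of fun i j => fderiv ℂ (fun y => XH H y i) x (Pi.single j 1)

def I1f (x : C4) : ℂ := x 1 * x 2 - x 0 * x 3
def I2f (x : C4) : ℂ := (x 0 ^ 2 + x 1 ^ 2) / 2
def I3f (x : C4) : ℂ := (x 2 ^ 2 + x 3 ^ 2) / 2

def wsize (x : C4) : ℝ :=
  max (max (‖x 0‖ ^ ((1:ℝ)/2)) (‖x 1‖ ^ ((1:ℝ)/2))) (max ‖x 2‖ ‖x 3‖)

structure HamData where
  η : ℂ
  hη : η ≠ 0
  dom : Set C4
  hopen : IsOpen dom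
  hzero : (0 : C4) ∈ dom
  F : C4 → ℂ
  hFan : AnalyticOnNhd ℂ F dom
  hFbd : ∃ M, ∀ x ∈ dom, ‖F x‖ ≤ M
  hFord : ∃ C, ∀ x ∈ dom, ‖F x‖ ≤ C * wsize x ^ (5:ℕ)

def Ham (d : HamData) : C4 → ℂ :=
  fun x => -(I1f x) + I2f x + d.η * (I3f x) ^ 2 + d.F x

def IsTrigPoly (f : ℂ → ℂ) : Prop :=
  ∃ (n : ℕ) (a b : ℕ → ℂ), ∀ φ : ℂ,
    f φ = a 0 + ∑ k ∈ Finset.Icc 1 n, (a k * Complex.cos (k * φ) + b k * Complex.sin (k * φ))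

def psOrd (N : ℕ) (i : Fin 4) : ℕ := if (i : ℕ) < 2 then N + 1 else N

def pSum (G : ℕ → ℂ → C4) (N : ℕ) (φ τ : ℂ) : C4 :=
  fun i => ∑ k ∈ Finset.range (psOrd N i + 1), G k φ i * τ ^ (-(k:ℤ))

def DopV (f : ℂ → ℂ → C4) (φ τ : ℂ) : C4 :=
  fun i => deriv (fun x => f x τ i) φ + deriv (fun x => f φ x i) τ

def IsFormalSol (Udom : Set C4) (H : C4 → ℂ) (G : ℕ → ℂ → C4) : Prop :=
  (∀ k i, IsTrigPoly (fun φ => G k φ i)) ∧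
  (∀ φ, G 0 φ = 0) ∧
  (∀ φ, G 1 φ 0 = 0 ∧ G 1 φ 1 = 0) ∧
  ∀ N : ℕ, ∃ C > (0:ℝ), ∃ T > (0:ℝ), ∀ φ t : ℝ, T ≤ t →
    pSum G N (φ:ℂ) (t:ℂ) ∈ Udom ∧
    ∀ i : Fin 4,
      ‖DopV (pSum G N) (φ:ℂ) (t:ℂ) i - XH H (pSum G N (φ:ℂ) (t:ℂ)) i‖
        ≤ C / t ^ (psOrd N i + 1)

def IsFormalSeparatrix (η : ℂ) (Udom : Set C4) (H : C4 → ℂ) (κ : ℂ)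
    (G : ℕ → ℂ → C4) : Prop :=
  κ ^ 2 = -2 / η ∧
  IsFormalSol Udom H G ∧
  (∀ φ : ℂ, G 2 φ 0 = κ * Complex.cos φ ∧ G 2 φ 1 = κ * Complex.sin φ ∧
            G 1 φ 2 = κ * Complex.cos φ ∧ G 1 φ 3 = κ * Complex.sin φ) ∧
  (∃ k φ, G k φ ≠ 0)

def shiftC (G : ℕ → ℂ → C4) (φ₀ τ₀ : ℂ) : ℕ → ℂ → C4 :=
  fun k φ => ∑ j ∈ Finset.range (k + 1),
    ((-1 : ℂ) ^ (k - j) * ((k-1).choose (k - j) : ℂ) * τ₀ ^ (k - j)) • G j (φ + φ₀)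

/-- plain partial sum of a formal series in `τ⁻¹` with trig-polynomial coefficients. -/
def pSumA (G : ℕ → ℂ → C4) (N : ℕ) (φ τ : ℂ) : C4 :=
  fun i => ∑ k ∈ Finset.range (N + 1), G k φ i * τ ^ (-(k:ℤ))

/-- truncation of the Sokol'skii normal form Hamiltonian. -/
def HNFtr (η : ℂ) (a : ℕ → ℕ → ℂ) (n : ℕ) (x : C4) : ℂ :=
  -(I1f x) + I2f x + η * (I3f x) ^ 2 +
    ∑ l ∈ Finset.range (n+1), ∑ k ∈ Finset.range (n+1),
      (if 5 ≤ 3*l + 2*k then a l k * (I1f x) ^ l * (I3f x) ^ k else 0)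

/-- formal solution of `Dz = X_{H♯}(z)` in `τ⁻¹𝖳⁴[[τ⁻¹]]`, encoded through the
asymptotics of the partial sums against the (stabilizing) truncations of `H♯`. -/
def IsFormalSolNF (η : ℂ) (a : ℕ → ℕ → ℂ) (G : ℕ → ℂ → C4) : Prop :=
  (∀ k i, IsTrigPoly (fun φ => G k φ i)) ∧
  (∀ φ, G 0 φ = 0) ∧
  ∀ N : ℕ, ∃ n₀ : ℕ, ∀ n, n₀ ≤ n → ∃ C > (0:ℝ), ∃ T > (0:ℝ), ∀ φ t : ℝ, T ≤ t →
    ∀ i : Fin 4,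
      ‖DopV (pSumA G N) (φ:ℂ) (t:ℂ) i - XH (HNFtr η a n) (pSumA G N (φ:ℂ) (t:ℂ)) i‖
        ≤ C / t ^ (N + 1)

def sSum (c : ℕ → ℂ) (N : ℕ) (τ : ℂ) : ℂ :=
  ∑ k ∈ Finset.range (N + 1), c k * τ ^ (-(k:ℤ))

/-- partial sum of the formal `τ`-derivative. -/
def dsSum (c : ℕ → ℂ) (N : ℕ) (τ : ℂ) : ℂ :=
  ∑ k ∈ Finset.range (N + 1), (-(k:ℂ)) * c k * τ ^ (-(k:ℤ) - 1)

/-- block rotation matrix `𝓡_φ = diag(R_φ, R_φ)`. -/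
def Rmat (φ : ℂ) : Matrix (Fin 4) (Fin 4) ℂ :=
  !![Complex.cos φ, -Complex.sin φ, 0, 0;
     Complex.sin φ, Complex.cos φ, 0, 0;
     0, 0, Complex.cos φ, -Complex.sin φ;
     0, 0, Complex.sin φ, Complex.cos φ]

def xiApprox (rs θs : ℕ → ℂ) (N : ℕ) (τ : ℂ) : C4 :=
  ![-(dsSum rs N τ) * Complex.cos (sSum θs N τ),
    -(dsSum rs N τ) * Complex.sin (sSum θs N τ),
    (sSum rs N τ) * Complex.cos (sSum θs N τ),
    (sSum rs N τ) * Complex.sin (sSum θs N τ)]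

/-- `Ẑ(φ,τ) = 𝓡_φ ξ(τ)` with `ξ` given in polar form by the formal series `r`, `θ`,
encoded by asymptotics of partial sums. -/
def PolarForm (G : ℕ → ℂ → C4) (rs θs : ℕ → ℂ) : Prop :=
  ∀ N : ℕ, ∃ C > (0:ℝ), ∃ T > (0:ℝ), ∀ φ t : ℝ, T ≤ t → ∀ i : Fin 4,
    ‖pSumA G N (φ:ℂ) (t:ℂ) i - (Rmat (φ:ℂ)).mulVec (xiApprox rs θs N (t:ℂ)) i‖
      ≤ C / t ^ (N + 1)

/-- the full package of properties of the formal solution `Ẑ` in Proposition 4.1. -/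
def NFSolBundle (η : ℂ) (a : ℕ → ℕ → ℂ) (G : ℕ → ℂ → C4) : Prop :=
  ∃ (κ : ℂ) (rs θs : ℕ → ℂ), κ ^ 2 = -2 / η ∧
    (∀ k, Even k → rs k = 0 ∧ θs k = 0) ∧ rs 1 = κ ∧ θs 1 = -(a 1 1) / η ∧
    IsFormalSolNF η a G ∧ (∃ k φ, G k φ ≠ 0) ∧ PolarForm G rs θs


section Alg

variable {R S : Type*} [CommRing R] [Algebra ℂ R] [CommRing S] [Algebra ℂ S]

/-- `∂K/∂I₁` of the truncated normal form. -/
def cA (a : ℕ → ℕ → ℂ) (n : ℕ) (s1 s3 : R) : R :=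
  ∑ l ∈ Finset.range (n+1), ∑ k ∈ Finset.range (n+1),
    (if 5 ≤ 3*l + 2*k then algebraMap ℂ R (a l k) * ((l : R) * s1 ^ (l-1)) * s3 ^ k else 0)

/-- the higher order part of `∂K/∂I₃`. -/
def cB' (a : ℕ → ℕ → ℂ) (n : ℕ) (s1 s3 : R) : R :=
  ∑ l ∈ Finset.range (n+1), ∑ k ∈ Finset.range (n+1),
    (if 5 ≤ 3*l + 2*k then algebraMap ℂ R (a l k) * s1 ^ l * ((k : R) * s3 ^ (k-1)) else 0)

def cB (η : ℂ) (a : ℕ → ℕ → ℂ) (n : ℕ) (s1 s3 : R) : R :=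
  algebraMap ℂ R (2 * η) * s3 + cB' a n s1 s3

def sg (b : Bool) : ℂ := if b then 1 else -1

def i1 (q p : Bool → R) : R :=
  algebraMap ℂ R (1 / (2 * I)) * (q true * p false - q false * p true)

def i3 (p : Bool → R) : R := algebraMap ℂ R (1 / 2) * (p true * p false)

def fq (η : ℂ) (a : ℕ → ℕ → ℂ) (n : ℕ) (q p : Bool → R) (b : Bool) : R :=
  cB η a n (i1 q p) (i3 p) * p b - algebraMap ℂ R (sg b * I) * cA a n (i1 q p) (i3 p) * q b

def fp (a : ℕ → ℕ → ℂ) (n : ℕ) (q p : Bool → R) (b : Bool) : R :=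
  - q b - algebraMap ℂ R (sg b * I) * cA a n (i1 q p) (i3 p) * p b

lemma map_cA (f : R →ₐ[ℂ] S) (a : ℕ → ℕ → ℂ) (n : ℕ) (s1 s3 : R) :
    f (cA a n s1 s3) = cA a n (f s1) (f s3) := by
  simp [cA, map_sum, apply_ite f]

lemma map_cB' (f : R →ₐ[ℂ] S) (a : ℕ → ℕ → ℂ) (n : ℕ) (s1 s3 : R) :
    f (cB' a n s1 s3) = cB' a n (f s1) (f s3) := by
  simp [cB', map_sum, apply_ite f]

lemma map_cB (f : R →ₐ[ℂ] S) (η : ℂ) (a : ℕ → ℕ → ℂ) (n : ℕ) (s1 s3 : R) :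
    f (cB η a n s1 s3) = cB η a n (f s1) (f s3) := by
  simp only [cB, map_add, map_mul, map_cB', AlgHom.commutes]

lemma map_i1 (f : R →ₐ[ℂ] S) (q p : Bool → R) :
    f (i1 q p) = i1 (fun b => f (q b)) (fun b => f (p b)) := by
  simp only [i1, map_sub, map_mul, AlgHom.commutes]

lemma map_i3 (f : R →ₐ[ℂ] S) (p : Bool → R) :
    f (i3 p) = i3 (fun b => f (p b)) := by
  simp only [i3, map_mul, AlgHom.commutes]

lemma map_fq (f : R →ₐ[ℂ] S) (η : ℂ) (a : ℕ → ℕ → ℂ) (n : ℕ) (q p : Bool → R) (b : Bool) :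
    f (fq η a n q p b) = fq η a n (fun b => f (q b)) (fun b => f (p b)) b := by
  simp only [fq, map_sub, map_mul, AlgHom.commutes, map_cB, map_cA, map_i1, map_i3]

lemma map_fp (f : R →ₐ[ℂ] S) (a : ℕ → ℕ → ℂ) (n : ℕ) (q p : Bool → R) (b : Bool) :
    f (fp a n q p b) = fp a n (fun b => f (q b)) (fun b => f (p b)) b := by
  simp only [fp, map_sub, map_neg, map_mul, AlgHom.commutes, map_cA, map_i1, map_i3]

lemma map_eq_of_dvd (d x y : R) (h : d ∣ x - y) :
    Ideal.Quotient.mkₐ ℂ (Ideal.span {d}) x = Ideal.Quotient.mkₐ ℂ (Ideal.span {d}) y := by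
  simp only [Ideal.Quotient.mkₐ_eq_mk]
  rw [Ideal.Quotient.eq, Ideal.mem_span_singleton]; exact h

lemma dvd_of_map_eq (d x y : R)
    (h : Ideal.Quotient.mkₐ ℂ (Ideal.span {d}) x = Ideal.Quotient.mkₐ ℂ (Ideal.span {d}) y) :
    d ∣ x - y := by
  simp only [Ideal.Quotient.mkₐ_eq_mk] at h
  rwa [Ideal.Quotient.eq, Ideal.mem_span_singleton] at h

lemma cA_congr (d : R) (a : ℕ → ℕ → ℂ) (n : ℕ) (s1 s3 t1 t3 : R) (h1 : d ∣ s1 - t1)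
    (h3 : d ∣ s3 - t3) : d ∣ cA a n s1 s3 - cA a n t1 t3 := by
  apply dvd_of_map_eq
  rw [map_cA, map_cA, map_eq_of_dvd _ _ _ h1, map_eq_of_dvd _ _ _ h3]

lemma cB_congr (d : R) (η : ℂ) (a : ℕ → ℕ → ℂ) (n : ℕ) (s1 s3 t1 t3 : R) (h1 : d ∣ s1 - t1)
    (h3 : d ∣ s3 - t3) : d ∣ cB η a n s1 s3 - cB η a n t1 t3 := by
  apply dvd_of_map_eq
  rw [map_cB, map_cB, map_eq_of_dvd _ _ _ h1, map_eq_of_dvd _ _ _ h3]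

lemma i1_congr (d : R) (q p q' p' : Bool → R) (hq : ∀ b, d ∣ q b - q' b)
    (hp : ∀ b, d ∣ p b - p' b) : d ∣ i1 q p - i1 q' p' := by
  apply dvd_of_map_eq
  rw [map_i1, map_i1]
  congr 1 <;> funext b <;> apply map_eq_of_dvd
  exacts [hq b, hp b]

lemma i3_congr (d : R) (p p' : Bool → R)
    (hp : ∀ b, d ∣ p b - p' b) : d ∣ i3 p - i3 p' := by
  apply dvd_of_map_eq
  rw [map_i3, map_i3]
  congr 1; funext b; apply map_eq_of_dvd; exact hp b

lemma fq_congr (d : R) (η : ℂ) (a : ℕ → ℕ → ℂ) (n : ℕ) (q p q' p' : Bool → R)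
    (hq : ∀ b, d ∣ q b - q' b)
    (hp : ∀ b, d ∣ p b - p' b) (b : Bool) : d ∣ fq η a n q p b - fq η a n q' p' b := by
  apply dvd_of_map_eq
  rw [map_fq, map_fq]
  congr 1 <;> funext b <;> apply map_eq_of_dvd
  exacts [hq b, hp b]

lemma fp_congr (d : R) (a : ℕ → ℕ → ℂ) (n : ℕ) (q p q' p' : Bool → R)
    (hq : ∀ b, d ∣ q b - q' b)
    (hp : ∀ b, d ∣ p b - p' b) (b : Bool) : d ∣ fp a n q p b - fp a n q' p' b := by
  apply dvd_of_map_eq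
  rw [map_fp, map_fp]
  congr 1 <;> funext b <;> apply map_eq_of_dvd
  exacts [hq b, hp b]

/-- if `d` divides both arguments then `d ∣ cA`. -/
lemma dvd_cA (d : R) (a : ℕ → ℕ → ℂ) (n : ℕ) (s1 s3 : R) (h1 : d ∣ s1) (h3 : d ∣ s3) :
    d ∣ cA a n s1 s3 := by
  unfold cA
  refine Finset.dvd_sum fun l _ => Finset.dvd_sum fun k _ => ?_
  split_ifs with h
  · rcases Nat.eq_zero_or_pos k with hk | hk
    · refine Dvd.dvd.mul_right (Dvd.dvd.mul_left (Dvd.dvd.mul_left ?_ _) _) _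
      exact dvd_pow h1 (by omega)
    · exact Dvd.dvd.mul_left (dvd_pow h3 (by omega)) _
  · exact dvd_zero _

lemma dvd_cB' (d : R) (a : ℕ → ℕ → ℂ) (n : ℕ) (s1 s3 : R) (h1 : d ∣ s1) (h3 : d ∣ s3 ^ 2) :
    d ∣ cB' a n s1 s3 := by
  unfold cB'
  refine Finset.dvd_sum fun l _ => Finset.dvd_sum fun k _ => ?_
  split_ifs with h
  · rcases Nat.eq_zero_or_pos l with hk | hk
    · refine Dvd.dvd.mul_left (Dvd.dvd.mul_left ?_ _) _
      exact h3.trans (pow_dvd_pow _ (by omega))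
    · exact Dvd.dvd.mul_right (Dvd.dvd.mul_left (dvd_pow h1 (by omega)) _) _
  · exact dvd_zero _

lemma dvd_cB (d : R) (η : ℂ) (a : ℕ → ℕ → ℂ) (n : ℕ) (s1 s3 : R) (h1 : d ∣ s1) (h3 : d ∣ s3) :
    d ∣ cB η a n s1 s3 := by
  unfold cB
  exact dvd_add (Dvd.dvd.mul_left h3 _) (dvd_cB' _ _ _ _ _ h1 (dvd_pow h3 (by norm_num)))

/-- refined congruence for the second coefficient: `d ∣ δ s1`, and `d ∣ e * x` where `e ∣ δ s3`, `x ∣` everything -/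
lemma cB'_congr (d e x : R) (hd : d ∣ e * x) (a : ℕ → ℕ → ℂ) (n : ℕ) (s1 s3 t1 t3 : R)
    (h1 : d ∣ s1 - t1) (h3 : e ∣ s3 - t3) (x1 : x ∣ t1) (x3 : x ∣ s3) (y3 : x ∣ t3) :
    d ∣ cB' a n s1 s3 - cB' a n t1 t3 := by
  unfold cB'
  rw [← Finset.sum_sub_distrib]
  refine Finset.dvd_sum fun l _ => ?_
  rw [← Finset.sum_sub_distrib]
  refine Finset.dvd_sum fun k _ => ?_
  split_ifs with h
  · have e1 : algebraMap ℂ R (a l k) * s1 ^ l * ((k : R) * s3 ^ (k-1))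
        - algebraMap ℂ R (a l k) * t1 ^ l * ((k : R) * t3 ^ (k-1))
        = algebraMap ℂ R (a l k) * k * ((s1 ^ l - t1 ^ l) * s3 ^ (k-1))
          + algebraMap ℂ R (a l k) * k * (t1 ^ l * (s3 ^ (k-1) - t3 ^ (k-1))) := by ring
    rw [e1]
    apply dvd_add
    · exact Dvd.dvd.mul_left (Dvd.dvd.mul_right (h1.trans (sub_dvd_pow_sub_pow _ _ _)) _) _
    · refine Dvd.dvd.mul_left ?_ _
      rcases Nat.eq_zero_or_pos l with hl | hl
      · obtain ⟨j, rfl⟩ : ∃ j, k = j + 3 := ⟨k - 3, by omega⟩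
        refine Dvd.dvd.mul_left (hd.trans ?_) _
        have : j + 3 - 1 = (j+1) + 1 := by omega
        rw [this]
        have e2 : s3 ^ (j+1+1) - t3 ^ (j+1+1) = (s3 - t3) * s3^(j+1) + (s3^(j+1) - t3^(j+1)) * t3 := by
          ring
        rw [e2]
        exact dvd_add (mul_dvd_mul h3 (dvd_pow x3 (by omega)))
          (mul_dvd_mul (h3.trans (sub_dvd_pow_sub_pow _ _ _)) y3)
      · rw [mul_comm]
        exact hd.trans (mul_dvd_mul (h3.trans (sub_dvd_pow_sub_pow _ _ _)) (dvd_pow x1 (by omega)))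
  · simp

/-- stabilization in `n` -/
lemma cA_stab (x : R) (a : ℕ → ℕ → ℂ) (N n m : ℕ) (hn : N ≤ n) (hm : N ≤ m) (s1 s3 : R)
    (h1 : x ∣ s1) (h3 : x ∣ s3) : x ^ N ∣ cA a n s1 s3 - cA a m s1 s3 := by
  have key : ∀ n, N ≤ n → x ^ N ∣ cA a n s1 s3 - cA a N s1 s3 := by
    intro n hn
    induction n, hn using Nat.le_induction with
    | base => simp
    | succ n hn ih =>
      have e : cA a (n+1) s1 s3 - cA a N s1 s3 =
        (cA a n s1 s3 - cA a N s1 s3) + (cA a (n+1) s1 s3 - cA a n s1 s3) := by ring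
      rw [e]
      refine dvd_add ih ?_
      have term : ∀ l k, (n+1 ≤ l ∨ n + 1 ≤ k) → x ^ N ∣ (if 5 ≤ 3*l + 2*k then
          algebraMap ℂ R (a l k) * ((l : R) * s1 ^ (l-1)) * s3 ^ k else 0) := by
        intro l k h
        split_ifs
        · rcases h with h | h
          · refine Dvd.dvd.mul_right (Dvd.dvd.mul_left (Dvd.dvd.mul_left ?_ _) _) _
            exact (pow_dvd_pow x (by omega)).trans (pow_dvd_pow_of_dvd h1 (l-1))
          · exact Dvd.dvd.mul_left ((pow_dvd_pow x (by omega)).trans (pow_dvd_pow_of_dvd h3 k)) _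
        · exact dvd_zero _
      unfold cA
      rw [Finset.sum_range_succ, add_sub_right_comm, ← Finset.sum_sub_distrib]
      refine dvd_add (Finset.dvd_sum fun l _ => ?_) (Finset.dvd_sum fun k _ => ?_)
      · rw [Finset.sum_range_succ, add_sub_cancel_left]
        exact term _ _ (Or.inr le_rfl)
      · exact term _ _ (Or.inl le_rfl)
  have := dvd_sub (key n hn) (key m hm)
  simpa using this

lemma cB_stab (x : R) (η : ℂ) (a : ℕ → ℕ → ℂ) (N n m : ℕ) (hn : N ≤ n) (hm : N ≤ m) (s1 s3 : R)
    (h1 : x ∣ s1) (h3 : x ∣ s3) : x ^ N ∣ cB η a n s1 s3 - cB η a m s1 s3 := by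
  have key : ∀ n, N ≤ n → x ^ N ∣ cB' a n s1 s3 - cB' a N s1 s3 := by
    intro n hn
    induction n, hn using Nat.le_induction with
    | base => simp
    | succ n hn ih =>
      have e : cB' a (n+1) s1 s3 - cB' a N s1 s3 =
        (cB' a n s1 s3 - cB' a N s1 s3) + (cB' a (n+1) s1 s3 - cB' a n s1 s3) := by ring
      rw [e]
      refine dvd_add ih ?_
      have term : ∀ l k, (n+1 ≤ l ∨ n + 1 ≤ k) → x ^ N ∣ (if 5 ≤ 3*l + 2*k then
          algebraMap ℂ R (a l k) * s1 ^ l * ((k : R) * s3 ^ (k-1)) else 0) := by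
        intro l k h
        split_ifs
        · rcases h with h | h
          · refine Dvd.dvd.mul_right (Dvd.dvd.mul_left ?_ _) _
            exact (pow_dvd_pow x (by omega)).trans (pow_dvd_pow_of_dvd h1 l)
          · exact Dvd.dvd.mul_left (Dvd.dvd.mul_left
              ((pow_dvd_pow x (by omega)).trans (pow_dvd_pow_of_dvd h3 (k-1))) _) _
        · exact dvd_zero _
      unfold cB'
      rw [Finset.sum_range_succ, add_sub_right_comm, ← Finset.sum_sub_distrib]
      refine dvd_add (Finset.dvd_sum fun l _ => ?_) (Finset.dvd_sum fun k _ => ?_)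
      · rw [Finset.sum_range_succ, add_sub_cancel_left]
        exact term _ _ (Or.inr le_rfl)
      · exact term _ _ (Or.inl le_rfl)
  have := dvd_sub (key n hn) (key m hm)
  simpa [cB] using this

end Alg


abbrev PS := PowerSeries ℂ
local notation "XX" => (PowerSeries.X : PowerSeries ℂ)

/-- the derivation `∂_τ` in terms of `x = τ⁻¹` -/
def Dx (f : PS) : PS := -(XX ^ 2 * PowerSeries.derivative ℂ f)

lemma Dx_add (f g : PS) : Dx (f + g) = Dx f + Dx g := by
  simp only [Dx, map_add]; ring
lemma Dx_sub (f g : PS) : Dx (f - g) = Dx f - Dx g := by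
  simp only [Dx, map_sub]; ring
lemma Dx_neg (f : PS) : Dx (-f) = - Dx f := by
  simp only [Dx, map_neg]; ring
lemma Dx_zero : Dx 0 = 0 := by simp [Dx]
lemma Dx_mul (f g : PS) : Dx (f * g) = Dx f * g + f * Dx g := by
  simp only [Dx, Derivation.leibniz, smul_eq_mul]; ring
lemma Dx_smul (c : ℂ) (f : PS) : Dx (algebraMap ℂ PS c * f) = algebraMap ℂ PS c * Dx f := by
  rw [← Algebra.smul_def, ← Algebra.smul_def]
  simp only [Dx]; rw [Derivation.map_smul, mul_smul_comm, smul_neg]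

lemma coeff_Dx_succ (f : PS) (m : ℕ) :
    PowerSeries.coeff (m+1) (Dx f) = - (m : ℂ) * PowerSeries.coeff m f := by
  rw [Dx, map_neg, pow_two, mul_assoc, PowerSeries.coeff_succ_X_mul]
  cases m with
  | zero => simp
  | succ m => rw [PowerSeries.coeff_succ_X_mul, PowerSeries.coeff_derivative]; push_cast; ring

lemma coeff_Dx_zero (f : PS) : PowerSeries.coeff 0 (Dx f) = 0 := by
  rw [Dx, map_neg, pow_two, mul_assoc, PowerSeries.coeff_zero_X_mul, neg_zero]

lemma dvd_Dx (f : PS) (N : ℕ) (h : XX ^ N ∣ f) : XX ^ (N+1) ∣ Dx f := by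
  rw [PowerSeries.X_pow_dvd_iff] at *
  intro m hm
  cases m with
  | zero => exact coeff_Dx_zero f
  | succ m => rw [coeff_Dx_succ, h m (by omega), mul_zero]

def FE (η : ℂ) (a : ℕ → ℕ → ℂ) (n N : ℕ) (q p : Bool → PS) : Prop :=
  ∀ b, XX ^ (N+1) ∣ Dx (q b) - fq η a n q p b ∧ XX ^ (N+1) ∣ Dx (p b) - fp a n q p b

def FEall (η : ℂ) (a : ℕ → ℕ → ℂ) (q p : Bool → PS) : Prop :=
  ∀ N, ∃ n₀, ∀ n, n₀ ≤ n → FE η a n N q p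

lemma coeff_eq_of_dvd {f g : PS} {N m : ℕ} (h : XX ^ N ∣ f - g) (hm : m < N) :
    PowerSeries.coeff m f = PowerSeries.coeff m g := by
  rw [PowerSeries.X_pow_dvd_iff] at h
  have := h m hm
  rwa [map_sub, sub_eq_zero] at this

lemma dvd_i3 (k : ℕ) (p : Bool → PS) (hp : ∀ b, XX ∣ p b) : XX ^ 2 ∣ i3 p := by
  rw [i3, pow_two]; exact Dvd.dvd.mul_left (mul_dvd_mul (hp _) (hp _)) _

lemma dvd_i1 (q p : Bool → PS) (hq : ∀ b, XX ^ 2 ∣ q b) (hp : ∀ b, XX ∣ p b) :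
    XX ^ 3 ∣ i1 q p := by
  rw [i1, pow_succ]
  exact Dvd.dvd.mul_left (dvd_sub (mul_dvd_mul (hq _) (hp _)) (mul_dvd_mul (hq _) (hp _))) _

lemma dvd_i1' (q p : Bool → PS) (hq : ∀ b, XX ∣ q b) (hp : ∀ b, XX ∣ p b) :
    XX ^ 2 ∣ i1 q p := by
  rw [i1, pow_two]
  exact Dvd.dvd.mul_left (dvd_sub (mul_dvd_mul (hq _) (hp _)) (mul_dvd_mul (hq _) (hp _))) _

lemma mul_sub_dvd {k l m N : ℕ} {f f' g g' : PS} (hf : XX ^ k ∣ f - f') (hg : XX ^ l ∣ g)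
    (hf' : XX ^ m ∣ f') (hg' : XX ^ N ∣ g - g') (M : ℕ) (h1 : M ≤ k + l) (h2 : M ≤ m + N) :
    XX ^ M ∣ f * g - f' * g' := by
  have e : f * g - f' * g' = (f - f') * g + f' * (g - g') := by ring
  rw [e]
  refine dvd_add ((pow_dvd_pow _ h1).trans ?_) ((pow_dvd_pow _ h2).trans ?_)
  · rw [pow_add]; exact mul_dvd_mul hf hg
  · rw [pow_add]; exact mul_dvd_mul hf' hg'

lemma step (η : ℂ) (a : ℕ → ℕ → ℂ) (n k : ℕ) (hk : 1 ≤ k) (q p q' p' : Bool → PS)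
    (hq : ∀ b, XX ^ 2 ∣ q b) (hp : ∀ b, XX ∣ p b)
    (hq' : ∀ b, XX ^ 2 ∣ q' b) (hp' : ∀ b, XX ∣ p' b)
    (dq : ∀ b, XX ^ (k+1) ∣ q b - q' b) (dp : ∀ b, XX ^ k ∣ p b - p' b)
    (H : FE η a n (k+2) q p) (H' : FE η a n (k+2) q' p') (b : Bool) :
    PowerSeries.coeff (k+1) (q b - q' b) = k * PowerSeries.coeff k (p b - p' b) ∧
    -((k:ℂ)+1) * k * PowerSeries.coeff k (p b - p' b) =
      η * (PowerSeries.coeff k (p true - p' true) * PowerSeries.coeff 1 (p false)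
              * PowerSeries.coeff 1 (p b)
        + PowerSeries.coeff 1 (p' true) * PowerSeries.coeff k (p false - p' false)
              * PowerSeries.coeff 1 (p b)
        + PowerSeries.coeff 1 (p' true) * PowerSeries.coeff 1 (p' false)
              * PowerSeries.coeff k (p b - p' b)) := by
  have hp1 : ∀ b, XX ^ 1 ∣ p b := by simpa using hp
  have hp1' : ∀ b, XX ^ 1 ∣ p' b := by simpa using hp'
  have j1 : XX ^ (k+2) ∣ i1 q p - i1 q' p' := by
    rw [i1, i1, ← mul_sub]
    refine Dvd.dvd.mul_left ?_ _
    have e : q true * p false - q false * p true - (q' true * p' false - q' false * p' true)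
      = (q true * p false - q' true * p' false) - (q false * p true - q' false * p' true) := by ring
    rw [e]
    exact dvd_sub (mul_sub_dvd (dq _) (hp1 _) (hq' _) (dp _) _ (by omega) (by omega))
      (mul_sub_dvd (dq _) (hp1 _) (hq' _) (dp _) _ (by omega) (by omega))
  have j3 : XX ^ (k+1) ∣ i3 p - i3 p' := by
    rw [i3, i3, ← mul_sub]
    exact Dvd.dvd.mul_left
      (mul_sub_dvd (dp _) (hp1 _) (hp1' _) (dp _) _ (by omega) (by omega)) _
  have v1 : XX ^ 2 ∣ i1 q p := (pow_dvd_pow _ (by omega)).trans (dvd_i1 q p hq hp)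
  have v1' : XX ^ 2 ∣ i1 q' p' := (pow_dvd_pow _ (by omega)).trans (dvd_i1 q' p' hq' hp')
  have v3 := dvd_i3 0 p hp
  have v3' := dvd_i3 0 p' hp'
  have jA : XX ^ (k+1) ∣ cA a n (i1 q p) (i3 p) - cA a n (i1 q' p') (i3 p') :=
    cA_congr _ _ _ _ _ _ _ ((pow_dvd_pow _ (by omega)).trans j1) j3
  have vA : XX ^ 2 ∣ cA a n (i1 q p) (i3 p) := dvd_cA _ _ _ _ _ v1 v3
  have vA' : XX ^ 2 ∣ cA a n (i1 q' p') (i3 p') := dvd_cA _ _ _ _ _ v1' v3'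
  have jB : XX ^ (k+2) ∣ cB' a n (i1 q p) (i3 p) - cB' a n (i1 q' p') (i3 p') := by
    refine cB'_congr _ (XX ^ (k+1)) (XX ^ 2) ?_ _ _ _ _ _ _ j1 j3 v1' v3 v3'
    rw [← pow_add]; exact pow_dvd_pow _ (by omega)
  have vB' : XX ^ 3 ∣ cB' a n (i1 q' p') (i3 p') := by
    refine dvd_cB' _ _ _ _ _ (dvd_i1 q' p' hq' hp') ?_
    refine (pow_dvd_pow XX (show 3 ≤ 2 * 2 by omega)).trans ?_
    rw [pow_mul]; exact pow_dvd_pow_of_dvd v3' 2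
  have first : PowerSeries.coeff (k+1) (q b - q' b) = k * PowerSeries.coeff k (p b - p' b) := by
    have h := dvd_sub (H b).2 (H' b).2
    have t : XX ^ (k+2) ∣ cA a n (i1 q p) (i3 p) * p b - cA a n (i1 q' p') (i3 p') * p' b :=
      mul_sub_dvd jA (hp1 _) vA' (dp _) _ (by omega) (by omega)
    have h2 := dvd_sub ((pow_dvd_pow XX (show k + 2 ≤ k+2+1 by omega)).trans h)
      (Dvd.dvd.mul_left t (algebraMap ℂ PS (sg b * I)))
    have e : Dx (p b) - fp a n q p b - (Dx (p' b) - fp a n q' p' b) - algebraMap ℂ PS (sg b * I) *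
        (cA a n (i1 q p) (i3 p) * p b - cA a n (i1 q' p') (i3 p') * p' b)
        = (q b - q' b) - - Dx (p b - p' b) := by
      rw [fp, fp, Dx_sub]; ring
    rw [e] at h2
    have := coeff_eq_of_dvd h2 (show k + 1 < k + 2 by omega)
    rw [this, map_neg, coeff_Dx_succ]; ring
  refine ⟨first, ?_⟩
  have h := dvd_sub (H b).1 (H' b).1
  have t : XX ^ (k+3) ∣ cA a n (i1 q p) (i3 p) * q b - cA a n (i1 q' p') (i3 p') * q' b :=
    mul_sub_dvd jA (hq _) vA' (dq _) _ (by omega) (by omega)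
  have s : XX ^ (k+3) ∣ cB' a n (i1 q p) (i3 p) * p b - cB' a n (i1 q' p') (i3 p') * p' b :=
    mul_sub_dvd jB (hp1 _) vB' (dp _) _ (by omega) (by omega)
  have h2 := dvd_sub h (dvd_sub (Dvd.dvd.mul_left t (algebraMap ℂ PS (sg b * I))) s)
  have e : Dx (q b) - fq η a n q p b - (Dx (q' b) - fq η a n q' p' b)
      - (algebraMap ℂ PS (sg b * I) *
        (cA a n (i1 q p) (i3 p) * q b - cA a n (i1 q' p') (i3 p') * q' b)
        - (cB' a n (i1 q p) (i3 p) * p b - cB' a n (i1 q' p') (i3 p') * p' b))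
      = Dx (q b - q' b) - algebraMap ℂ PS η *
          (p true * p false * p b - p' true * p' false * p' b) := by
    have : algebraMap ℂ PS (2 * η) * algebraMap ℂ PS (1/2) = algebraMap ℂ PS η := by
      rw [← map_mul]; congr 1; ring
    rw [fq, fq, Dx_sub, cB, cB, ← this, i3, i3]; ring
  rw [e] at h2
  have h3 := coeff_eq_of_dvd h2 (show k + 1 + 1 < k + 3 by omega)
  rw [coeff_Dx_succ, first] at h3
  choose d hd using dp
  choose u hu using hp
  choose u' hu' using hp'
  have e2 : p true * p false * p b - p' true * p' false * p' b =
      XX ^ (k+2) * (d true * u false * u b + u' true * d false * u b + u' true * u' false * d b) := by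
    have e3 : p true * p false * p b - p' true * p' false * p' b =
      (p true - p' true) * p false * p b + p' true * (p false - p' false) * p b
        + p' true * p' false * (p b - p' b) := by ring
    rw [e3, hd, hd, hd, hu, hu b, hu' true, hu' false]; ring
  have c0 := PowerSeries.coeff_X_pow_mul
    (d true * u false * u b + u' true * d false * u b + u' true * u' false * d b) (k+2) 0
  rw [zero_add] at c0
  rw [e2, ← Algebra.smul_def, PowerSeries.coeff_smul, show k + 1 + 1 = k + 2 from rfl, c0] at h3
  simp only [PowerSeries.coeff_zero_eq_constantCoeff, map_add, map_mul] at h3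
  have c1 : ∀ b, PowerSeries.coeff k (p b - p' b) = PowerSeries.constantCoeff (d b) := by
    intro b
    have := PowerSeries.coeff_X_pow_mul (d b) k 0
    rw [hd b]; simpa using this
  have c2 : ∀ b, PowerSeries.coeff 1 (p b) = PowerSeries.constantCoeff (u b) := by
    intro b
    rw [hu b]; simpa using PowerSeries.coeff_succ_X_mul 0 (u b)
  have c3 : ∀ b, PowerSeries.coeff 1 (p' b) = PowerSeries.constantCoeff (u' b) := by
    intro b
    rw [hu' b]; simpa using PowerSeries.coeff_succ_X_mul 0 (u' b)
  rw [c1, c1, c1, c2, c2, c3, c3]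
  rw [c1] at h3
  rw [smul_eq_mul] at h3
  rw [← h3]; push_cast; ring

lemma FE_zero (η : ℂ) (a : ℕ → ℕ → ℂ) (n N : ℕ) :
    FE η a n N (fun _ => 0) (fun _ => 0) := by
  intro b; simp [fq, fp, Dx_zero]

lemma FE_mono {η : ℂ} {a : ℕ → ℕ → ℂ} {n N M : ℕ} {q p : Bool → PS} (h : FE η a n N q p)
    (hM : M ≤ N) : FE η a n M q p := fun b =>
  ⟨(pow_dvd_pow _ (by omega)).trans (h b).1, (pow_dvd_pow _ (by omega)).trans (h b).2⟩

lemma init_q (η : ℂ) (a : ℕ → ℕ → ℂ) (q p : Bool → PS)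
    (hq : ∀ b, XX ∣ q b) (hp : ∀ b, XX ∣ p b) (H : FEall η a q p) (b : Bool) : XX ^ 2 ∣ q b := by
  obtain ⟨n, hn⟩ := H 3
  have h := ((hn n le_rfl) b).2
  have h := (pow_dvd_pow XX (show 2 ≤ 3+1 by omega)).trans h
  have h1 : XX ^ 2 ∣ Dx (p b) := dvd_Dx _ 1 (by simpa using hp b)
  have h2 : XX ^ 2 ∣ cA a n (i1 q p) (i3 p) := dvd_cA _ _ _ _ _ (dvd_i1' q p hq hp) (dvd_i3 0 p hp)
  have h3 := Dvd.dvd.mul_left h2 (algebraMap ℂ PS (sg b * I) * p b)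
  have := dvd_sub (dvd_sub h h1) h3
  rw [fp] at this
  convert this using 1; ring

lemma init_p (η : ℂ) (a : ℕ → ℕ → ℂ) (q p : Bool → PS)
    (hq : ∀ b, XX ∣ q b) (hp : ∀ b, XX ∣ p b) (H : FEall η a q p) (b : Bool) :
    PowerSeries.coeff 2 (q b) = PowerSeries.coeff 1 (p b) ∧
    -2 * PowerSeries.coeff 1 (p b) = η * (PowerSeries.coeff 1 (p true) *
      PowerSeries.coeff 1 (p false) * PowerSeries.coeff 1 (p b)) := by
  obtain ⟨n, hn⟩ := H 3
  have hq2 := init_q η a q p hq hp H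
  have := step η a n 1 le_rfl q p (fun _ => 0) (fun _ => 0) hq2 hp (by simp) (by simp)
    (by simpa using hq2) (by simpa using hp) (hn n le_rfl) (FE_zero _ _ _ _) b
  simp only [sub_zero, map_zero, zero_mul, add_zero] at this
  constructor
  · simpa using this.1
  · rw [← this.2]; push_cast; ring

lemma eq_of_all_dvd {f g : PS} (h : ∀ k ≥ 2, XX ^ k ∣ f - g) : f = g := by
  ext m
  exact coeff_eq_of_dvd (h (m+2) (by omega)) (by omega)

/-- uniqueness -/
lemma unique_sol (η : ℂ) (a : ℕ → ℕ → ℂ) (q p q' p' : Bool → PS)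
    (hq : ∀ b, XX ∣ q b) (hp : ∀ b, XX ∣ p b)
    (hq' : ∀ b, XX ∣ q' b) (hp' : ∀ b, XX ∣ p' b)
    (H : FEall η a q p) (H' : FEall η a q' p')
    (h1 : ∀ b, PowerSeries.coeff 1 (p b) = PowerSeries.coeff 1 (p' b))
    (hne : (∀ b, PowerSeries.coeff 1 (p b) = 0) ∨
      (∀ b, PowerSeries.coeff 1 (p b) ≠ 0) ∧
      PowerSeries.coeff 2 (p true) * PowerSeries.coeff 1 (p false)
        + PowerSeries.coeff 2 (p false) * PowerSeries.coeff 1 (p true)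
      = PowerSeries.coeff 2 (p' true) * PowerSeries.coeff 1 (p false)
        + PowerSeries.coeff 2 (p' false) * PowerSeries.coeff 1 (p true)) :
    q = q' ∧ p = p' := by
  have hq2 := init_q η a q p hq hp H
  have hq2' := init_q η a q' p' hq' hp' H'
  have i := init_p η a q p hq hp H
  have i' := init_p η a q' p' hq' hp' H'
  have succ_dvd : ∀ (f : PS) (k : ℕ), XX ^ k ∣ f → PowerSeries.coeff k f = 0 → XX ^ (k+1) ∣ f := by
    intro f k h h0
    rw [PowerSeries.X_pow_dvd_iff] at *
    intro m hm
    rcases Nat.lt_succ_iff_lt_or_eq.mp hm with h' | h'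
    · exact h m h'
    · rw [h', h0]
  have key : ∀ k ≥ 2, (∀ b, XX ^ (k+1) ∣ q b - q' b) ∧ (∀ b, XX ^ k ∣ p b - p' b) := by
    intro k hk
    induction k, hk using Nat.le_induction with
    | base =>
      constructor
      · intro b
        refine succ_dvd _ 2 (dvd_sub (hq2 b) (hq2' b)) ?_
        rw [map_sub, (i b).1, (i' b).1, h1, sub_self]
      · intro b
        refine succ_dvd _ 1 (by simpa using (dvd_sub (hp b) (hp' b))) ?_
        rw [map_sub, h1, sub_self]
    | succ k hk ih =>
      obtain ⟨n1, hn1⟩ := H (k+2)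
      obtain ⟨n2, hn2⟩ := H' (k+2)
      have st := step η a (max n1 n2) k (by omega) q p q' p' hq2 hp hq2' hp' ih.1 ih.2
        (hn1 _ (le_max_left _ _)) (hn2 _ (le_max_right _ _))
      suffices hz : ∀ b, PowerSeries.coeff k (p b - p' b) = 0 by
        constructor
        · intro b
          refine succ_dvd _ _ (ih.1 b) ?_
          rw [(st b).1, hz, mul_zero]
        · intro b
          exact succ_dvd _ _ (ih.2 b) (hz b)
      have st' := fun b => (st b).2
      simp only [← h1] at st'
      have kc : (2:ℝ) ≤ k := by exact_mod_cast hk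
      rcases hne with h0 | ⟨h0, h2⟩
      · intro b
        have := st' b
        simp only [h0, mul_zero, zero_mul, add_zero] at this
        have c : -((k:ℂ)+1) * k ≠ 0 := by
          have : ((k:ℂ)+1) ≠ 0 := by exact_mod_cast Nat.succ_ne_zero k
          have h2 : (k:ℂ) ≠ 0 := by exact_mod_cast (by omega : k ≠ 0)
          exact mul_ne_zero (neg_ne_zero.mpr this) h2
        exact (mul_eq_zero.mp this).resolve_left c
      · have it := (i true).2
        have h0t := h0 true
        have h0f := h0 false
        have hπ : η * (PowerSeries.coeff 1 (p true) * PowerSeries.coeff 1 (p false)) = -2 := by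
          apply mul_right_cancel₀ h0t
          rw [it]; ring
        have hs : k = 2 → PowerSeries.coeff k (p true - p' true) * PowerSeries.coeff 1 (p false)
            + PowerSeries.coeff k (p false - p' false) * PowerSeries.coeff 1 (p true) = 0 := by
          rintro rfl
          rw [map_sub, map_sub]
          linear_combination h2
        have ht := st' true
        have hf := st' false
        suffices hz : PowerSeries.coeff k (p true - p' true) = 0 ∧
            PowerSeries.coeff k (p false - p' false) = 0 by
          intro b; cases b
          exacts [hz.2, hz.1]
        clear st st' i i' h1 ih h2 h0 it
        generalize PowerSeries.coeff 1 (p true) = Pt at *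
        generalize PowerSeries.coeff 1 (p false) = Pf at *
        generalize PowerSeries.coeff k (p true - p' true) = dt at *
        generalize PowerSeries.coeff k (p false - p' false) = df at *
        have hd : (2 - (k:ℂ) * (k+1)) * (dt * Pf - df * Pt) = 0 := by
          linear_combination Pf * ht - Pt * hf + (dt * Pf - df * Pt) * hπ
        have hsum : (6 - (k:ℂ) * (k+1)) * (dt * Pf + df * Pt) = 0 := by
          linear_combination Pf * ht + Pt * hf + 3 * (dt * Pf + df * Pt) * hπ
        have n1 : (2 - (k:ℂ) * (k+1)) ≠ 0 := by
          intro h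
          have : (k:ℂ) * (k+1) = 2 := by linear_combination -h
          have : k * (k+1) = 2 := by exact_mod_cast this
          nlinarith
        have hd := (mul_eq_zero.mp hd).resolve_left n1
        have hsum : dt * Pf + df * Pt = 0 := by
          rcases eq_or_ne k 2 with h | h
          · exact hs h
          · refine (mul_eq_zero.mp hsum).resolve_left ?_
            intro h'
            have : (k:ℂ) * (k+1) = 6 := by linear_combination -h'
            have : k * (k+1) = 6 := by exact_mod_cast this
            have : 3 ≤ k := by omega
            nlinarith
        have z1 : dt * Pf = 0 := by linear_combination (hd + hsum) / 2
        have z2 : df * Pt = 0 := by linear_combination (hsum - hd) / 2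
        exact ⟨(mul_eq_zero.mp z1).resolve_right h0f, (mul_eq_zero.mp z2).resolve_right h0t⟩
  constructor
  · funext b
    exact eq_of_all_dvd fun k hk => (pow_dvd_pow _ (by omega)).trans ((key k hk).1 b)
  · funext b
    exact eq_of_all_dvd fun k hk => (key k hk).2 b


def recf (F : ℕ → (ℕ → ℂ) → ℂ) : ℕ → ℂ
  | k => F k (fun j => if _h : j < k then recf F j else 0)

lemma exists_rec (F : ℕ → (ℕ → ℂ) → ℂ) :
    ∃ f : ℕ → ℂ, ∀ k, f k = F k (fun j => if j < k then f j else 0) := by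
  refine ⟨recf F, fun k => ?_⟩
  rw [recf]; simp

def hsq (r : PS) : PS := algebraMap ℂ PS (1/2) * r ^ 2

def Rr (η : ℂ) (a : ℕ → ℕ → ℂ) (n : ℕ) (r : PS) : PS :=
  Dx (Dx r) + cB η a n 0 (hsq r) * r

lemma dvd_hsq (r : PS) (h : XX ∣ r) : XX ^ 2 ∣ hsq r :=
  Dvd.dvd.mul_left (pow_dvd_pow_of_dvd h 2) _

lemma step_r (η : ℂ) (a : ℕ → ℕ → ℂ) (n k : ℕ) (r s : PS) (hr : XX ∣ r) (hs : XX ∣ s)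
    (h : XX ^ k ∣ r - s) :
    PowerSeries.coeff (k+2) (Rr η a n r) = PowerSeries.coeff (k+2) (Rr η a n s) +
      (k * (k+1) + η * (PowerSeries.coeff 1 r ^ 2 + PowerSeries.coeff 1 r * PowerSeries.coeff 1 s
        + PowerSeries.coeff 1 s ^ 2)) * PowerSeries.coeff k (r - s) := by
  have hr1 : XX ^ 1 ∣ r := by simpa using hr
  have hs1 : XX ^ 1 ∣ s := by simpa using hs
  have j3 : XX ^ (k+1) ∣ hsq r - hsq s := by
    rw [hsq, hsq, ← mul_sub, pow_two, pow_two]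
    exact Dvd.dvd.mul_left (mul_sub_dvd h hr1 hs1 h _ (by omega) (by omega)) _
  have jB : XX ^ (k+2) ∣ cB' a n 0 (hsq r) - cB' a n 0 (hsq s) := by
    refine cB'_congr _ (XX ^ (k+1)) (XX ^ 2) ?_ _ _ _ _ _ _ (by simp) j3 (by simp)
      (dvd_hsq r hr) (dvd_hsq s hs)
    rw [← pow_add]; exact pow_dvd_pow _ (by omega)
  have vB' : XX ^ 3 ∣ cB' a n 0 (hsq s) := by
    refine dvd_cB' _ _ _ _ _ (by simp) ?_
    refine (pow_dvd_pow XX (show 3 ≤ 2 * 2 by omega)).trans ?_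
    rw [pow_mul]; exact pow_dvd_pow_of_dvd (dvd_hsq s hs) 2
  have t : XX ^ (k+3) ∣ cB' a n 0 (hsq r) * r - cB' a n 0 (hsq s) * s :=
    mul_sub_dvd jB hr1 vB' h _ (by omega) (by omega)
  obtain ⟨d, hd⟩ := h
  obtain ⟨u, hu⟩ := hr
  obtain ⟨v, hv⟩ := hs
  have e : cB' a n 0 (hsq r) * r - cB' a n 0 (hsq s) * s
      = (Rr η a n r - Rr η a n s) - (Dx (Dx (r - s))
        + XX ^ (k+2) * (algebraMap ℂ PS η * ((u^2 + u * v + v^2) * d))) := by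
    have : algebraMap ℂ PS (2 * η) * algebraMap ℂ PS (1/2) = algebraMap ℂ PS η := by
      rw [← map_mul]; congr 1; ring
    have e2 : XX ^ (k+2) * (algebraMap ℂ PS η * ((u^2 + u * v + v^2) * d))
        = algebraMap ℂ PS η * (r ^ 3 - s ^ 3) := by
      have : r ^ 3 - s ^ 3 = (r - s) * (r^2 + r * s + s^2) := by ring
      rw [this, hd, hu, hv]; ring
    rw [e2, Rr, Rr, cB, cB, Dx_sub, Dx_sub, ← this, hsq, hsq]; ring
  rw [e] at t
  have h3 := coeff_eq_of_dvd t (show k + 1 + 1 < k + 3 by omega)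
  have c0 := PowerSeries.coeff_X_pow_mul (algebraMap ℂ PS η * ((u^2 + u * v + v^2) * d)) (k+2) 0
  rw [zero_add, ← Algebra.smul_def, PowerSeries.coeff_smul] at c0
  rw [map_sub, map_add, coeff_Dx_succ, coeff_Dx_succ, show k + 1 + 1 = k + 2 from rfl,
    ← Algebra.smul_def, c0] at h3
  simp only [PowerSeries.coeff_zero_eq_constantCoeff, map_add, map_mul, map_pow] at h3
  have c1 : PowerSeries.coeff k (r - s) = PowerSeries.constantCoeff d := by
    have := PowerSeries.coeff_X_pow_mul d k 0
    rw [hd]; simpa using this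
  have c2 : PowerSeries.coeff 1 r = PowerSeries.constantCoeff u := by
    rw [hu]; simp
  have c3 : PowerSeries.coeff 1 s = PowerSeries.constantCoeff v := by
    rw [hv]; simp
  rw [c1] at h3
  rw [c1, c2, c3]
  rw [smul_eq_mul] at h3
  rw [← sub_eq_iff_eq_add', h3]; push_cast; ring

def sN : PS →ₐ[ℂ] PS := PowerSeries.rescaleAlgHom (-1)

lemma coeff_sN (m : ℕ) (f : PS) :
    PowerSeries.coeff m (sN f) = (-1) ^ m * PowerSeries.coeff m f := by
  have : sN f = PowerSeries.rescale (-1) f := by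
    rw [sN, ← PowerSeries.coe_rescaleAlgHom]; rfl
  rw [this, PowerSeries.coeff_rescale]

lemma sN_Dx (f : PS) : sN (Dx f) = - Dx (sN f) := by
  ext m
  cases m with
  | zero => rw [coeff_sN, map_neg, coeff_Dx_zero, coeff_Dx_zero]; simp
  | succ m => rw [coeff_sN, map_neg, coeff_Dx_succ, coeff_Dx_succ, coeff_sN]; ring

lemma sN_odd (f : PS) (h : ∀ k, Even k → PowerSeries.coeff k f = 0) : sN f = - f := by
  ext m
  rw [coeff_sN, map_neg]
  rcases Nat.even_or_odd m with hm | hm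
  · rw [h m hm]; simp
  · rw [hm.neg_one_pow]; ring

lemma sN_hsq (r : PS) (h : sN r = - r) : sN (hsq r) = hsq r := by
  rw [hsq, map_mul, map_pow, h, AlgHom.commutes]; ring

lemma exists_r (η κ : ℂ) (hκ : η * κ ^ 2 = -2) (a : ℕ → ℕ → ℂ) :
    ∃ r : PS, (∀ k, Even k → PowerSeries.coeff k r = 0) ∧ PowerSeries.coeff 1 r = κ ∧
      ∀ N n, N ≤ n → XX ^ N ∣ Rr η a n r := by
  obtain ⟨f, hf⟩ := exists_rec (fun k g => if Even k then 0 else if k = 1 then κ else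
    - PowerSeries.coeff (k+2) (Rr η a (k+3) (PowerSeries.mk g)) / (k * (k+1) - 6))
  have hev : ∀ k, Even k → f k = 0 := fun k hk => by rw [hf]; simp [hk]
  have h1 : f 1 = κ := by rw [hf]; simp
  have hodd : sN (PowerSeries.mk f) = - PowerSeries.mk f := sN_odd _ (by simpa using hev)
  have hX : XX ∣ PowerSeries.mk f := by
    rw [PowerSeries.X_dvd_iff]; simpa using hev 0 (by simp)
  refine ⟨PowerSeries.mk f, by simpa using hev, by simpa using h1, ?_⟩
  have stab : ∀ N n m, N ≤ n → N ≤ m →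
      XX ^ N ∣ Rr η a n (PowerSeries.mk f) - Rr η a m (PowerSeries.mk f) := by
    intro N n m hn hm
    have : Rr η a n (PowerSeries.mk f) - Rr η a m (PowerSeries.mk f) =
      (cB η a n 0 (hsq (PowerSeries.mk f)) - cB η a m 0 (hsq (PowerSeries.mk f)))
        * PowerSeries.mk f := by
      rw [Rr, Rr]; ring
    rw [this]
    refine Dvd.dvd.mul_right (cB_stab _ _ _ _ _ _ hn hm _ _ (by simp) ?_) _
    exact (dvd_pow_self XX (by norm_num)).trans (dvd_hsq _ hX)
  have main : ∀ m, PowerSeries.coeff m (Rr η a (m+1) (PowerSeries.mk f)) = 0 := by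
    intro m
    rcases Nat.even_or_odd m with hm | hm
    · have : sN (Rr η a (m+1) (PowerSeries.mk f)) = - Rr η a (m+1) (PowerSeries.mk f) := by
        rw [Rr, map_add, map_mul, map_cB, sN_Dx, sN_Dx, sN_hsq _ hodd, hodd]
        simp only [Dx_neg, map_zero]; ring
      have h2 := congrArg (PowerSeries.coeff m) this
      rw [coeff_sN, hm.neg_one_pow, map_neg, one_mul] at h2
      linear_combination h2 / 2
    · rcases lt_or_ge m 3 with h3 | h3
      · have : XX ^ 3 ∣ Rr η a (m+1) (PowerSeries.mk f) := by
          rw [Rr]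
          refine dvd_add (dvd_Dx _ 2 (dvd_Dx _ 1 (by simpa using hX))) ?_
          rw [pow_succ]
          exact mul_dvd_mul (dvd_cB _ _ _ _ _ _ (by simp) (dvd_hsq _ hX)) hX
        rw [PowerSeries.X_pow_dvd_iff] at this
        exact this m h3
      · obtain ⟨k, rfl⟩ : ∃ k, m = k + 2 := ⟨m - 2, by omega⟩
        have hko : Odd k := by
          rcases hm with ⟨j, hj⟩; exact ⟨j - 1, by omega⟩
        rcases eq_or_ne k 1 with rfl | hk1
        · rw [step_r η a (1+2+1) 1 (PowerSeries.mk f) 0 hX (by simp) (by simpa using hX)]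
          have : Rr η a (1+2+1) 0 = 0 := by simp [Rr, Dx_zero]
          rw [this]
          simp only [map_zero, sub_zero, PowerSeries.coeff_mk, h1]
          push_cast
          linear_combination κ * hκ
        · have hk3 : 3 ≤ k := by
            rcases hko with ⟨j, hj⟩; omega
          set s : PS := PowerSeries.mk (fun j => if j < k then f j else 0) with hs
          have hXs : XX ∣ s := by
            rw [PowerSeries.X_dvd_iff]
            simp only [hs, PowerSeries.constantCoeff_mk]
            rw [hev 0 (by simp)]; simp
          have hdd : XX ^ k ∣ PowerSeries.mk f - s := by
            rw [PowerSeries.X_pow_dvd_iff]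
            intro j hj
            simp [hs, hj]
          rw [step_r η a (k+2+1) k (PowerSeries.mk f) s hX hXs hdd]
          have hc : PowerSeries.coeff k (PowerSeries.mk f - s) = f k := by
            simp [hs]
          have hc1 : PowerSeries.coeff 1 s = κ := by
            simp only [hs, PowerSeries.coeff_mk]
            rw [if_pos (by omega), h1]
          have hfk := hf k
          rw [if_neg (by simpa using hko), if_neg hk1, ← hs] at hfk
          have nz : ((k:ℂ) * (k+1) - 6) ≠ 0 := by
            intro h
            have : (k:ℂ) * (k+1) = 6 := by linear_combination h
            have : k * (k+1) = 6 := by exact_mod_cast this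
            nlinarith
          rw [eq_div_iff nz] at hfk
          rw [hc, hc1, PowerSeries.coeff_mk, h1]
          linear_combination hfk + 3 * f k * hκ
  intro N n hn
  rw [PowerSeries.X_pow_dvd_iff]
  intro m hm
  rw [coeff_eq_of_dvd (stab (m+1) n (m+1) (by omega) le_rfl) (by omega), main]

lemma exists_θ (η κ : ℂ) (hη : η ≠ 0) (hκ : η * κ ^ 2 = -2) (a : ℕ → ℕ → ℂ) (r : PS)
    (hr : ∀ k, Even k → PowerSeries.coeff k r = 0) (h1 : PowerSeries.coeff 1 r = κ) :
    ∃ θ : PS, (∀ k, Even k → PowerSeries.coeff k θ = 0) ∧ PowerSeries.coeff 1 θ = -(a 1 1) / η ∧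
      ∀ N n, N + 1 ≤ n → XX ^ N ∣ Dx θ + cA a n 0 (hsq r) := by
  have hX : XX ∣ r := by
    rw [PowerSeries.X_dvd_iff]; simpa using hr 0 (by simp)
  refine ⟨PowerSeries.mk (fun k => if k = 0 then 0 else
    PowerSeries.coeff (k+1) (cA a (k+2) 0 (hsq r)) / k), ?_, ?_, ?_⟩
  · intro k hk
    rw [PowerSeries.coeff_mk]
    split_ifs with h0
    · rfl
    · have : sN (cA a (k+2) 0 (hsq r)) = cA a (k+2) 0 (hsq r) := by
        rw [map_cA, sN_hsq _ (sN_odd _ hr), map_zero]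
      have h2 := congrArg (PowerSeries.coeff (k+1)) this
      rw [coeff_sN, (hk.add_one).neg_one_pow] at h2
      have : PowerSeries.coeff (k+1) (cA a (k+2) 0 (hsq r)) = 0 := by
        linear_combination -h2 / 2
      rw [this, zero_div]
  · rw [PowerSeries.coeff_mk, if_neg (by norm_num)]
    obtain ⟨u, hu⟩ := hX
    have e : cA a (1+2) 0 (hsq r) - XX ^ 2 * (algebraMap ℂ PS (a 1 1 * (1/2)) * u ^ 2) =
        XX ^ 3 * (algebraMap ℂ PS (a 1 2) * XX * (algebraMap ℂ PS (1/2) * u^2) ^ 2 +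
          algebraMap ℂ PS (a 1 3) * XX^3 * (algebraMap ℂ PS (1/2) * u^2) ^ 3) := by
      simp only [cA, hsq, hu, map_mul, Finset.sum_range_succ, Finset.sum_range_zero]
      norm_num
      ring
    have := coeff_eq_of_dvd (Dvd.intro _ e.symm) (show 2 < 3 by norm_num)
    have c0 := PowerSeries.coeff_X_pow_mul (algebraMap ℂ PS (a 1 1 * (1/2)) * u ^ 2) 2 0
    rw [zero_add, ← Algebra.smul_def, PowerSeries.coeff_smul] at c0
    rw [show 1 + 1 = 2 from rfl, this, ← Algebra.smul_def, c0]
    have c2 : PowerSeries.coeff 1 r = PowerSeries.constantCoeff u := by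
      rw [hu]; simp
    simp only [PowerSeries.coeff_zero_eq_constantCoeff, map_pow, ← c2, h1, smul_eq_mul]
    field_simp
    push_cast
    linear_combination a 1 1 * hκ
  · intro N n hn
    rw [PowerSeries.X_pow_dvd_iff]
    intro m hm
    have v2 : XX ^ 2 ∣ cA a n 0 (hsq r) := dvd_cA _ _ _ _ _ (by simp) (dvd_hsq r hX)
    rw [PowerSeries.X_pow_dvd_iff] at v2
    cases m with
    | zero => rw [map_add, coeff_Dx_zero, v2 0 (by norm_num), add_zero]
    | succ k =>
      rw [map_add, coeff_Dx_succ, PowerSeries.coeff_mk]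
      split_ifs with h0
      · subst h0; rw [v2 _ (by norm_num)]; simp
      · have st := cA_stab XX a (k+2) n (k+2) (by omega) le_rfl 0 (hsq r) (by simp)
          ((dvd_pow_self XX (by norm_num)).trans (dvd_hsq _ hX))
        rw [coeff_eq_of_dvd st (show k + 1 < k + 2 by omega)]
        have : (k:ℂ) ≠ 0 := by exact_mod_cast h0
        field_simp; ring


lemma hasSubst_of_dvd {g : PS} (hg : XX ∣ g) : PowerSeries.HasSubst g :=
  PowerSeries.HasSubst.of_constantCoeff_zero' (PowerSeries.X_dvd_iff.mp hg)

lemma coeff_subst_sum (f g : PS) (hg : XX ∣ g) (m M : ℕ) (h : m < M) :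
    PowerSeries.coeff m (f.subst g) =
      ∑ d ∈ Finset.range M, PowerSeries.coeff d f * PowerSeries.coeff m (g ^ d) := by
  rw [PowerSeries.coeff_subst' (hasSubst_of_dvd hg)]
  rw [finsum_eq_sum_of_support_subset]
  · rfl
  · intro d hd
    simp only [Finset.coe_range, Set.mem_Iio]
    by_contra hc
    apply hd
    have : XX ^ d ∣ g ^ d := pow_dvd_pow_of_dvd hg d
    rw [PowerSeries.X_pow_dvd_iff] at this
    simp [this m (by omega)]

def EE (θ : PS) (b : Bool) : PS := (PowerSeries.exp ℂ).subst (algebraMap ℂ PS (sg b * I) * θ)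

lemma Dx_EE (θ : PS) (h : XX ∣ θ) (b : Bool) :
    Dx (EE θ b) = algebraMap ℂ PS (sg b * I) * Dx θ * EE θ b := by
  have hs := hasSubst_of_dvd (Dvd.dvd.mul_left h (algebraMap ℂ PS (sg b * I)))
  rw [← Dx_smul]
  simp only [Dx, EE]
  rw [PowerSeries.derivative_subst hs, PowerSeries.derivative_exp]
  ring

lemma coeff_EE (θ : PS) (h : XX ∣ θ) (b : Bool) (m M : ℕ) (hm : m < M) :
    PowerSeries.coeff m (EE θ b) = PowerSeries.coeff m
      (∑ d ∈ Finset.range M, algebraMap ℂ PS ((d.factorial : ℂ)⁻¹) *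
        (algebraMap ℂ PS (sg b * I) * θ) ^ d) := by
  rw [EE, coeff_subst_sum _ _ (Dvd.dvd.mul_left h _) m M hm, map_sum]
  refine Finset.sum_congr rfl fun d _ => ?_
  rw [← Algebra.smul_def ((d.factorial : ℂ)⁻¹), PowerSeries.coeff_smul, PowerSeries.coeff_exp, smul_eq_mul]
  simp

lemma EE_dvd (θ : PS) (h : XX ∣ θ) (b : Bool) (M : ℕ) :
    XX ^ M ∣ EE θ b - (∑ d ∈ Finset.range M, algebraMap ℂ PS ((d.factorial : ℂ)⁻¹) *
        (algebraMap ℂ PS (sg b * I) * θ) ^ d) := by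
  rw [PowerSeries.X_pow_dvd_iff]
  intro m hm
  rw [map_sub, coeff_EE θ h b m M hm, sub_self]

lemma constCoeff_EE (θ : PS) (h : XX ∣ θ) (b : Bool) : PowerSeries.constantCoeff (EE θ b) = 1 := by
  rw [← PowerSeries.coeff_zero_eq_constantCoeff_apply, coeff_EE θ h b 0 1 (by norm_num)]
  simp

lemma coeff_one_EE (θ : PS) (h : XX ∣ θ) (b : Bool) :
    PowerSeries.coeff 1 (EE θ b) = sg b * I * PowerSeries.coeff 1 θ := by
  rw [coeff_EE θ h b 1 2 (by norm_num)]
  simp only [Finset.sum_range_succ, Finset.sum_range_zero]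
  simp [← Algebra.smul_def, -map_mul, PowerSeries.coeff_one]

lemma EE_mul (θ : PS) (h : XX ∣ θ) : EE θ true * EE θ false = 1 := by
  have h0 : Dx (EE θ true * EE θ false) = 0 := by
    rw [Dx_mul, Dx_EE θ h, Dx_EE θ h]
    have : algebraMap ℂ PS (sg false * I) = - algebraMap ℂ PS (sg true * I) := by
      rw [← map_neg]; congr 1; simp [sg]
    rw [this]; ring
  apply PowerSeries.derivative.ext (R := ℂ)
  · rw [PowerSeries.derivative_one]
    rw [Dx, neg_eq_zero] at h0
    exact (mul_eq_zero.mp h0).resolve_left (pow_ne_zero _ PowerSeries.X_ne_zero)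
  · simp [constCoeff_EE θ h]

lemma FE_polar (η : ℂ) (a : ℕ → ℕ → ℂ) (r θ : PS) (hθ : XX ∣ θ)
    (h1 : ∀ N n, N ≤ n → XX ^ N ∣ Rr η a n r)
    (h2 : ∀ N n, N + 1 ≤ n → XX ^ N ∣ Dx θ + cA a n 0 (hsq r)) :
    FEall η a (fun b => - (Dx r * EE θ b)) (fun b => r * EE θ b) := by
  intro N
  refine ⟨N + 2, fun n hn b => ?_⟩
  have e1 : i1 (fun b => - (Dx r * EE θ b)) (fun b => r * EE θ b) = 0 := by
    rw [i1]; ring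
  have e3 : i3 (fun b => r * EE θ b) = hsq r := by
    rw [i3, hsq]; linear_combination (algebraMap ℂ PS (1/2) * r ^ 2) * EE_mul θ hθ
  have d1 := h1 (N+1) n (by omega)
  have d2 := h2 (N+1) n (by omega)
  rw [fq, fp, e1, e3, Dx_neg, Dx_mul, Dx_mul, Dx_EE θ hθ]
  constructor
  · have := dvd_add (Dvd.dvd.mul_left d1 (- EE θ b))
      (Dvd.dvd.mul_left d2 (- algebraMap ℂ PS (sg b * I) * EE θ b * Dx r))
    convert this using 1
    rw [Rr]; ring
  · have := (Dvd.dvd.mul_left d2 (algebraMap ℂ PS (sg b * I) * EE θ b * r))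
    convert this using 1
    ring

/-! shift -/

def ysh (τ : ℂ) : PS := XX * (1 + algebraMap ℂ PS τ * XX)⁻¹

lemma ysh_mul (τ : ℂ) : ysh τ * (1 + algebraMap ℂ PS τ * XX) = XX := by
  rw [ysh, mul_assoc, PowerSeries.inv_mul_cancel, mul_one]
  simp

lemma ysh_dvd (τ : ℂ) : XX ∣ ysh τ := Dvd.intro _ rfl

lemma ysh_der (τ : ℂ) : XX ^ 2 * PowerSeries.derivative ℂ (ysh τ) = ysh τ ^ 2 := by
  have h := ysh_mul τ
  have h2 := congrArg (PowerSeries.derivative ℂ) h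
  have h3 : PowerSeries.derivative ℂ (algebraMap ℂ PS τ * XX) = algebraMap ℂ PS τ := by
    rw [← Algebra.smul_def τ, Derivation.map_smul, PowerSeries.derivative_X, Algebra.smul_def, mul_one]
  rw [Derivation.leibniz, map_add, h3, PowerSeries.derivative_one, PowerSeries.derivative_X,
    smul_eq_mul, smul_eq_mul] at h2
  generalize PowerSeries.derivative ℂ (ysh τ) = y' at *
  generalize ysh τ = y at *
  generalize algebraMap ℂ PS τ = t at *
  linear_combination (-XX * y' - y) * h + XX * y * h2

def shPS (τ : ℂ) (f : PS) : PS := f.subst (ysh τ)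

lemma shPS_eq (τ : ℂ) (f : PS) :
    shPS τ f = PowerSeries.substAlgHom (R := ℂ) (hasSubst_of_dvd (ysh_dvd τ)) f := by
  rw [shPS, PowerSeries.coe_substAlgHom]

lemma Dx_shPS (τ : ℂ) (f : PS) : Dx (shPS τ f) = shPS τ (Dx f) := by
  have hs := hasSubst_of_dvd (ysh_dvd τ)
  have : shPS τ (Dx f) = - (ysh τ ^ 2 * (PowerSeries.derivative ℂ f).subst (ysh τ)) := by
    rw [shPS_eq, Dx, map_neg, map_mul, map_pow, PowerSeries.substAlgHom_X,
      PowerSeries.coe_substAlgHom]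
  rw [this, shPS, Dx, PowerSeries.derivative_subst hs, ← ysh_der]; ring

lemma shPS_dvd (τ : ℂ) (f : PS) (N : ℕ) (h : XX ^ N ∣ f) : XX ^ N ∣ shPS τ f := by
  have hs := hasSubst_of_dvd (ysh_dvd τ)
  have : (PowerSeries.substAlgHom (R := ℂ) hs) (XX ^ N) ∣ (PowerSeries.substAlgHom (R := ℂ) hs) f :=
    map_dvd (PowerSeries.substAlgHom (R := ℂ) hs) h
  rw [map_pow, PowerSeries.substAlgHom_X] at this
  rw [shPS_eq]
  exact (pow_dvd_pow_of_dvd (ysh_dvd τ) N).trans this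

lemma FE_shift (η : ℂ) (a : ℕ → ℕ → ℂ) (τ : ℂ) (q p : Bool → PS) (h : FEall η a q p) :
    FEall η a (fun b => shPS τ (q b)) (fun b => shPS τ (p b)) := by
  intro N
  obtain ⟨n0, h0⟩ := h N
  refine ⟨n0, fun n hn b => ?_⟩
  have hs := hasSubst_of_dvd (ysh_dvd τ)
  have d1 := shPS_dvd τ _ _ (h0 n hn b).1
  have d2 := shPS_dvd τ _ _ (h0 n hn b).2
  rw [shPS_eq, map_sub, map_fq, ← shPS_eq, ← Dx_shPS] at d1
  rw [shPS_eq, map_sub, map_fp, ← shPS_eq, ← Dx_shPS] at d2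
  simp only [shPS_eq] at *
  exact ⟨d1, d2⟩

lemma FE_rot (η : ℂ) (a : ℕ → ℕ → ℂ) (e : Bool → ℂ) (he : e true * e false = 1)
    (q p : Bool → PS) (h : FEall η a q p) :
    FEall η a (fun b => algebraMap ℂ PS (e b) * q b) (fun b => algebraMap ℂ PS (e b) * p b) := by
  intro N
  obtain ⟨n0, h0⟩ := h N
  refine ⟨n0, fun n hn b => ?_⟩
  have he' : algebraMap ℂ PS (e true) * algebraMap ℂ PS (e false) = 1 := by
    rw [← map_mul, he, map_one]
  have e1 : i1 (fun b => algebraMap ℂ PS (e b) * q b) (fun b => algebraMap ℂ PS (e b) * p b)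
      = i1 q p := by
    rw [i1, i1]
    linear_combination (algebraMap ℂ PS (1/(2*I)) * (q true * p false - q false * p true)) * he'
  have e3 : i3 (fun b => algebraMap ℂ PS (e b) * p b) = i3 p := by
    rw [i3, i3]
    linear_combination (algebraMap ℂ PS (1/2) * (p true * p false)) * he'
  have d1 := Dvd.dvd.mul_left (h0 n hn b).1 (algebraMap ℂ PS (e b))
  have d2 := Dvd.dvd.mul_left (h0 n hn b).2 (algebraMap ℂ PS (e b))
  rw [fq] at d1
  rw [fp] at d2
  rw [fq, fp, e1, e3, Dx_smul, Dx_smul]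
  constructor
  · convert d1 using 1; ring
  · convert d2 using 1; ring

lemma coeff_ysh_rec (τ : ℂ) (j k : ℕ) :
    PowerSeries.coeff (k+1) (ysh τ ^ (j+1)) =
      PowerSeries.coeff k (ysh τ ^ j) - τ * PowerSeries.coeff k (ysh τ ^ (j+1)) := by
  have h : ysh τ ^ (j+1) = XX * (ysh τ ^ j - algebraMap ℂ PS τ * ysh τ ^ (j+1)) := by
    linear_combination (-ysh τ ^ j * XX * 0 + ysh τ ^ j * 1) * ysh_mul τ
  conv_lhs => rw [h]
  rw [PowerSeries.coeff_succ_X_mul, map_sub, ← Algebra.smul_def, PowerSeries.coeff_smul,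
    smul_eq_mul]

lemma coeff_ysh (τ : ℂ) (j k : ℕ) (h : j ≤ k) :
    PowerSeries.coeff k (ysh τ ^ j) =
      (-1 : ℂ) ^ (k - j) * ((k-1).choose (k - j) : ℂ) * τ ^ (k - j) := by
  induction j generalizing k with
  | zero =>
    cases k with
    | zero => simp
    | succ k => simp [PowerSeries.coeff_one]
  | succ j ihj =>
    induction k with
    | zero => omega
    | succ k ihk =>
      rw [coeff_ysh_rec]
      rcases Nat.eq_or_lt_of_le h with h' | h'
      · obtain rfl : j = k := by omega
        have : XX ^ (j+1) ∣ ysh τ ^ (j+1) := pow_dvd_pow_of_dvd (ysh_dvd τ) _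
        rw [PowerSeries.X_pow_dvd_iff] at this
        rw [this j (by omega), ihj j le_rfl]; simp
      · obtain ⟨d, rfl⟩ : ∃ d, k = j + 1 + d := ⟨k - (j+1), by omega⟩
        rw [ihj _ (by omega), ihk (by omega)]
        have e1 : j + 1 + d - j = d + 1 := by omega
        have e2 : j + 1 + d - (j + 1) = d := by omega
        have e3 : j + 1 + d + 1 - (j + 1) = d + 1 := by omega
        have e4 : j + 1 + d - 1 = j + d := by omega
        have e5 : j + 1 + d + 1 - 1 = j + d + 1 := by omega
        rw [e1, e2, e3, e4, e5, Nat.choose_succ_succ' (j+d) d]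
        push_cast; ring

lemma coeff_shPS (τ : ℂ) (f : PS) (k : ℕ) :
    PowerSeries.coeff k (shPS τ f) = ∑ j ∈ Finset.range (k+1),
      ((-1 : ℂ) ^ (k - j) * ((k-1).choose (k - j) : ℂ) * τ ^ (k - j)) * PowerSeries.coeff j f := by
  rw [shPS, coeff_subst_sum _ _ (ysh_dvd τ) k (k+1) (by omega)]
  refine Finset.sum_congr rfl fun j hj => ?_
  rw [coeff_ysh τ j k (by simp at hj; omega)]; ring


/-! polynomial bounds -/

lemma poly_bound (P : Polynomial ℂ) (K : ℕ) (h : Polynomial.X ^ K ∣ P) :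
    ∃ C > (0:ℝ), ∀ t : ℝ, 1 ≤ t → ‖P.eval ((t:ℂ)⁻¹)‖ ≤ C / t ^ K := by
  obtain ⟨Q, rfl⟩ := h
  obtain ⟨C, hC⟩ := (isCompact_closedBall (0:ℂ) 1).exists_bound_of_continuousOn
    (f := fun x => Q.eval x) Q.continuous.continuousOn
  refine ⟨|C| + 1, by positivity, fun t ht => ?_⟩
  have ht0 : 0 < t := by linarith
  have hn : ‖(t:ℂ)⁻¹‖ = t⁻¹ := by
    rw [norm_inv, Complex.norm_real, Real.norm_of_nonneg ht0.le]
  have h1 := hC ((t:ℂ)⁻¹) (by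
    rw [mem_closedBall_zero_iff, hn]; exact inv_le_one_of_one_le₀ ht)
  rw [Polynomial.eval_mul, Polynomial.eval_pow, Polynomial.eval_X, norm_mul, norm_pow, hn, inv_pow,
    div_eq_mul_inv, mul_comm]
  refine mul_le_mul_of_nonneg_right ?_ (by positivity)
  linarith [le_abs_self C]

lemma poly_dvd (P : Polynomial ℂ) (K : ℕ) (C T : ℝ)
    (h : ∀ t : ℝ, T ≤ t → ‖P.eval ((t:ℂ)⁻¹)‖ ≤ C / t ^ K) : Polynomial.X ^ K ∣ P := by
  induction K generalizing T with
  | zero => simp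
  | succ K ih =>
    have hC : 0 ≤ C := by
      have h1 := (norm_nonneg _).trans (h (max T 1) (le_max_left _ _))
      have h2 : (0:ℝ) < (max T 1) ^ (K+1) := by positivity
      by_contra hc
      exact absurd h1 (not_le.mpr (div_neg_of_neg_of_pos (not_le.mp hc) h2))
    obtain ⟨Q, rfl⟩ := ih (max T 1) (fun t ht => by
      have ht1 : 1 ≤ t := (le_max_right _ _).trans ht
      refine (h t ((le_max_left _ _).trans ht)).trans ?_
      refine div_le_div_of_nonneg_left hC (by positivity) ?_
      exact pow_le_pow_right₀ ht1 (by omega))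
    rw [pow_succ]
    refine mul_dvd_mul_left _ ?_
    rw [Polynomial.X_dvd_iff, Polynomial.coeff_zero_eq_eval_zero]
    have l1 : Tendsto (fun t : ℝ => Q.eval ((t:ℂ)⁻¹)) atTop (nhds (Q.eval 0)) := by
      refine (Q.continuous.tendsto 0).comp ?_
      have : Tendsto (fun t : ℝ => ((t⁻¹ : ℝ) : ℂ)) atTop (nhds ((0:ℝ):ℂ)) :=
        (Complex.continuous_ofReal.tendsto _).comp tendsto_inv_atTop_zero
      simpa using this
    have l2 : Tendsto (fun t : ℝ => Q.eval ((t:ℂ)⁻¹)) atTop (nhds 0) := by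
      refine squeeze_zero_norm' (a := fun t => C / t) ?_ (tendsto_const_nhds.div_atTop tendsto_id)
      filter_upwards [eventually_ge_atTop T, eventually_ge_atTop 1] with t ht ht1
      have ht0 : 0 < t := by linarith
      have := h t ht
      rw [Polynomial.eval_mul, Polynomial.eval_pow, Polynomial.eval_X, norm_mul, norm_pow, norm_inv,
        Complex.norm_real, Real.norm_of_nonneg ht0.le] at this
      have h3 := mul_le_mul_of_nonneg_left this (show 0 ≤ t ^ K by positivity)
      have e1 : t ^ K * (t⁻¹ ^ K * ‖Q.eval ((t:ℂ)⁻¹)‖) = ‖Q.eval ((t:ℂ)⁻¹)‖ := by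
        rw [← mul_assoc, ← mul_pow, mul_inv_cancel₀ ht0.ne', one_pow, one_mul]
      have e2 : t ^ K * (C / t ^ (K+1)) = C / t := by
        rw [pow_succ]; field_simp
      rwa [e1, e2] at h3
    exact tendsto_nhds_unique l1 l2

/-! gradient -/

lemma hasF_coord (x : C4) (i : Fin 4) :
    HasFDerivAt (fun y : C4 => y i) (ContinuousLinearMap.proj (R := ℂ) (φ := fun _ : Fin 4 => ℂ) i) x :=
  (ContinuousLinearMap.proj (R := ℂ) (φ := fun _ : Fin 4 => ℂ) i).hasFDerivAt

lemma hasF_I1 (x : C4) : ∃ L : C4 →L[ℂ] ℂ, HasFDerivAt I1f L x ∧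
    ∀ v, L v = v 1 * x 2 + x 1 * v 2 - v 0 * x 3 - x 0 * v 3 := by
  refine ⟨_, ((hasF_coord x 1).mul (hasF_coord x 2)).sub ((hasF_coord x 0).mul (hasF_coord x 3)), ?_⟩
  intro v; simp; ring

lemma hasF_I2 (x : C4) : ∃ L : C4 →L[ℂ] ℂ, HasFDerivAt I2f L x ∧
    ∀ v, L v = x 0 * v 0 + x 1 * v 1 := by
  have h : I2f = fun x => (x 0 * x 0 + x 1 * x 1) * (1/2) := by
    funext x; rw [I2f]; ring
  rw [h]
  refine ⟨_, (((hasF_coord x 0).mul (hasF_coord x 0)).add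
    ((hasF_coord x 1).mul (hasF_coord x 1))).mul_const (1/2), ?_⟩
  intro v; simp; ring

lemma hasF_I3 (x : C4) : ∃ L : C4 →L[ℂ] ℂ, HasFDerivAt I3f L x ∧
    ∀ v, L v = x 2 * v 2 + x 3 * v 3 := by
  have h : I3f = fun x => (x 2 * x 2 + x 3 * x 3) * (1/2) := by
    funext x; rw [I3f]; ring
  rw [h]
  refine ⟨_, (((hasF_coord x 2).mul (hasF_coord x 2)).add
    ((hasF_coord x 3).mul (hasF_coord x 3))).mul_const (1/2), ?_⟩
  intro v; simp; ring

lemma hasF_sum (a : ℕ → ℕ → ℂ) (n : ℕ) (x : C4) (L1 L3 : C4 →L[ℂ] ℂ) (h1 : HasFDerivAt I1f L1 x)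
    (h3 : HasFDerivAt I3f L3 x) : HasFDerivAt (fun x => ∑ l ∈ Finset.range (n+1), ∑ k ∈ Finset.range (n+1),
      (if 5 ≤ 3*l + 2*k then a l k * (I1f x) ^ l * (I3f x) ^ k else 0))
    (cA a n (I1f x) (I3f x) • L1 + cB' a n (I1f x) (I3f x) • L3) x := by
  have e : cA a n (I1f x) (I3f x) • L1 + cB' a n (I1f x) (I3f x) • L3 =
    ∑ l ∈ Finset.range (n+1), ∑ k ∈ Finset.range (n+1),
      (if 5 ≤ 3*l + 2*k then (a l k * ((l : ℂ) * I1f x ^ (l-1)) * I3f x ^ k) • L1 +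
        (a l k * I1f x ^ l * ((k : ℂ) * I3f x ^ (k-1))) • L3 else 0) := by
    ext v
    have key : ∀ (f : ℕ → ℕ → C4 →L[ℂ] ℂ), (∑ l ∈ Finset.range (n+1), ∑ k ∈ Finset.range (n+1), f l k) v
        = ∑ l ∈ Finset.range (n+1), ∑ k ∈ Finset.range (n+1), f l k v := by
      intro f
      rw [ContinuousLinearMap.sum_apply]
      refine Finset.sum_congr rfl fun l _ => ?_
      rw [ContinuousLinearMap.sum_apply]
    rw [key, ContinuousLinearMap.add_apply, ContinuousLinearMap.smul_apply,
      ContinuousLinearMap.smul_apply, smul_eq_mul, smul_eq_mul, cA, cB', Finset.sum_mul, Finset.sum_mul,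
      ← Finset.sum_add_distrib]
    refine Finset.sum_congr rfl fun l _ => ?_
    rw [Finset.sum_mul, Finset.sum_mul, ← Finset.sum_add_distrib]
    refine Finset.sum_congr rfl fun k _ => ?_
    split_ifs <;> simp
  rw [e]
  refine HasFDerivAt.fun_sum fun l _ => HasFDerivAt.fun_sum fun k _ => ?_
  split_ifs with h
  · have := ((h1.pow l).const_mul (a l k)).mul (h3.pow k)
    have e2 : (a l k * ((l : ℂ) * I1f x ^ (l-1)) * I3f x ^ k) • L1 +
        (a l k * I1f x ^ l * ((k : ℂ) * I3f x ^ (k-1))) • L3 =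
        ((a l k * I1f x ^ l) • (k • I3f x ^ (k - 1)) • L3 + I3f x ^ k • a l k • (l • I1f x ^ (l - 1)) • L1) := by
      ext v
      simp
      ring
    rw [e2]
    exact this
  · exact hasFDerivAt_const _ _

lemma XH_eq (η : ℂ) (a : ℕ → ℕ → ℂ) (n : ℕ) (x : C4) :
    XH (HNFtr η a n) x =
      ![cB η a n (I1f x) (I3f x) * x 2 + (cA a n (I1f x) (I3f x) - 1) * x 1,
        cB η a n (I1f x) (I3f x) * x 3 - (cA a n (I1f x) (I3f x) - 1) * x 0,
        -x 0 + (cA a n (I1f x) (I3f x) - 1) * x 3,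
        -x 1 - (cA a n (I1f x) (I3f x) - 1) * x 2] := by
  obtain ⟨L1, h1, e1⟩ := hasF_I1 x
  obtain ⟨L2, h2, e2⟩ := hasF_I2 x
  obtain ⟨L3, h3, e3⟩ := hasF_I3 x
  have h := ((h1.neg.add h2).add ((h3.pow 2).const_mul η)).add (hasF_sum a n x L1 L3 h1 h3)
  have hf := h.fderiv
  have hg : ∀ i, gradC (HNFtr η a n) x i = (cA a n (I1f x) (I3f x) - 1) * L1 (Pi.single i 1)
      + L2 (Pi.single i 1) + cB η a n (I1f x) (I3f x) * L3 (Pi.single i 1) := by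
    intro i
    rw [gradC]
    have : fderiv ℂ (HNFtr η a n) x = _ := hf
    rw [this]
    simp [cB]
    ring
  funext i
  rw [XH]
  fin_cases i <;> simp [Jmat, Matrix.mulVec, dotProduct, Fin.sum_univ_four, hg, e1, e2, e3, Pi.single_apply] <;> ring

/-! rotating coordinates -/

lemma sgI_sq (b : Bool) : (sg b * I) * (sg b * I) = -1 := by
  cases b <;> simp [sg]

def zq (e : Bool → ℂ) (z : C4) (b : Bool) : ℂ := e b * (z 0 + sg b * I * z 1)
def zp (e : Bool → ℂ) (z : C4) (b : Bool) : ℂ := e b * (z 2 + sg b * I * z 3)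

lemma i1_z (e : Bool → ℂ) (he : e true * e false = 1) (z : C4) : i1 (zq e z) (zp e z) = I1f z := by
  have hI : (I:ℂ) ≠ 0 := I_ne_zero
  simp only [i1, zq, zp, sg, I1f, Algebra.algebraMap_self, RingHom.id_apply]
  simp only [if_true, Bool.false_eq_true, if_false]
  field_simp
  linear_combination (z 1 * z 2 - z 0 * z 3) * 2 * I * he

lemma i3_z (e : Bool → ℂ) (he : e true * e false = 1) (z : C4) : i3 (zp e z) = I3f z := by
  simp only [i3, zp, sg, I3f, Algebra.algebraMap_self, RingHom.id_apply]
  simp only [if_true, Bool.false_eq_true, if_false]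
  linear_combination (z 2 ^ 2 - I ^ 2 * z 3 ^ 2) / 2 * he - (1/2) * z 3 ^ 2 * I_sq

lemma alg_q (η : ℂ) (a : ℕ → ℕ → ℂ) (n : ℕ) (e : Bool → ℂ) (he : e true * e false = 1) (z : C4) (b : Bool) :
    e b * (XH (HNFtr η a n) z 0 + sg b * I * XH (HNFtr η a n) z 1) =
      fq η a n (zq e z) (zp e z) b + sg b * I * zq e z b := by
  rw [XH_eq, fq, i1_z e he, i3_z e he]
  simp only [zq, zp, Algebra.algebraMap_self, RingHom.id_apply]
  simp
  linear_combination e b * (cA a n (I1f z) (I3f z) - 1) * z 1 * sgI_sq b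

lemma alg_p (η : ℂ) (a : ℕ → ℕ → ℂ) (n : ℕ) (e : Bool → ℂ) (he : e true * e false = 1) (z : C4) (b : Bool) :
    e b * (XH (HNFtr η a n) z 2 + sg b * I * XH (HNFtr η a n) z 3) =
      fp a n (zq e z) (zp e z) b + sg b * I * zp e z b := by
  rw [XH_eq, fp, i1_z e he, i3_z e he]
  simp only [zq, zp, Algebra.algebraMap_self, RingHom.id_apply]
  simp
  linear_combination e b * (cA a n (I1f z) (I3f z) - 1) * z 3 * sgI_sq b


def tP (c : ℕ → ℂ) (N : ℕ) : Polynomial ℂ :=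
  ∑ k ∈ Finset.range (N+1), Polynomial.C (c k) * Polynomial.X ^ k

def tD (c : ℕ → ℂ) (N : ℕ) : Polynomial ℂ :=
  ∑ k ∈ Finset.range (N+1), Polynomial.C (-(k:ℂ) * c k) * Polynomial.X ^ (k+1)

lemma eval_tP (c : ℕ → ℂ) (N : ℕ) (x : ℂ) :
    (tP c N).eval x = ∑ k ∈ Finset.range (N+1), c k * x ^ k := by
  simp [tP, Polynomial.eval_finset_sum]

lemma eval_tD (c : ℕ → ℂ) (N : ℕ) (x : ℂ) :
    (tD c N).eval x = ∑ k ∈ Finset.range (N+1), -(k:ℂ) * c k * x ^ (k+1) := by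
  simp [tD, Polynomial.eval_finset_sum]

lemma coeff_tP (c : ℕ → ℂ) (N m : ℕ) (h : m < N + 1) : (tP c N).coeff m = c m := by
  simp only [tP, Polynomial.finset_sum_coeff, Polynomial.coeff_C_mul_X_pow]
  rw [Finset.sum_ite_eq]
  simp [h]

lemma coeff_tD_zero (c : ℕ → ℂ) (N : ℕ) : (tD c N).coeff 0 = 0 := by
  simp only [tD, Polynomial.finset_sum_coeff, Polynomial.coeff_C_mul_X_pow]
  exact Finset.sum_eq_zero fun k _ => by simp

lemma coeff_tD_succ (c : ℕ → ℂ) (N m : ℕ) (h : m < N + 1) :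
    (tD c N).coeff (m+1) = -(m:ℂ) * c m := by
  simp only [tD, Polynomial.finset_sum_coeff, Polynomial.coeff_C_mul_X_pow, Nat.add_right_cancel_iff]
  rw [Finset.sum_ite_eq]
  simp [h]

def toPS : Polynomial ℂ →ₐ[ℂ] PS := Polynomial.coeToPowerSeries.algHom ℂ

lemma coeff_toPS (P : Polynomial ℂ) (m : ℕ) : PowerSeries.coeff m (toPS P) = P.coeff m := by
  simp [toPS, Polynomial.coeToPowerSeries.algHom_apply]

lemma toPS_dvd (P : Polynomial ℂ) (K : ℕ) : XX ^ K ∣ toPS P ↔ Polynomial.X ^ K ∣ P := by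
  rw [PowerSeries.X_pow_dvd_iff, Polynomial.X_pow_dvd_iff]
  simp only [coeff_toPS]

lemma tP_congr (f : PS) (N : ℕ) :
    XX ^ (N+1) ∣ toPS (tP (fun k => PowerSeries.coeff k f) N) - f := by
  rw [PowerSeries.X_pow_dvd_iff]
  intro m hm
  rw [map_sub, coeff_toPS, coeff_tP _ _ _ hm, sub_self]

lemma tD_congr (f : PS) (N : ℕ) :
    XX ^ (N+1) ∣ toPS (tD (fun k => PowerSeries.coeff k f) N) - Dx f := by
  rw [PowerSeries.X_pow_dvd_iff]
  intro m hm
  rw [map_sub, coeff_toPS]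
  cases m with
  | zero => rw [coeff_tD_zero, coeff_Dx_zero, sub_self]
  | succ m => rw [coeff_tD_succ _ _ _ (by omega), coeff_Dx_succ, sub_self]

/-- residual polynomials -/
def resQ (η : ℂ) (a : ℕ → ℕ → ℂ) (n N : ℕ) (q' q p : Bool → PS) (b : Bool) : Polynomial ℂ :=
  tP (fun k => PowerSeries.coeff k (q' b)) N + tD (fun k => PowerSeries.coeff k (q b)) N -
    fq η a n (fun b => tP (fun k => PowerSeries.coeff k (q b)) N)
      (fun b => tP (fun k => PowerSeries.coeff k (p b)) N) b

def resP (a : ℕ → ℕ → ℂ) (n N : ℕ) (p' q p : Bool → PS) (b : Bool) : Polynomial ℂ :=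
  tP (fun k => PowerSeries.coeff k (p' b)) N + tD (fun k => PowerSeries.coeff k (p b)) N -
    fp a n (fun b => tP (fun k => PowerSeries.coeff k (q b)) N)
      (fun b => tP (fun k => PowerSeries.coeff k (p b)) N) b

lemma resQ_dvd (η : ℂ) (a : ℕ → ℕ → ℂ) (n N : ℕ) (q' q p : Bool → PS) (b : Bool) :
    Polynomial.X ^ (N+1) ∣ resQ η a n N q' q p b ↔
      XX ^ (N+1) ∣ q' b + Dx (q b) - fq η a n q p b := by
  rw [← toPS_dvd, resQ, map_sub, map_add, map_fq]
  have h1 := tP_congr (q' b) N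
  have h2 := tD_congr (q b) N
  have h3 := fq_congr (XX ^ (N+1)) η a n _ _ q p (fun b => tP_congr (q b) N) (fun b => tP_congr (p b) N) b
  refine dvd_iff_dvd_of_dvd_sub ?_
  convert dvd_sub (dvd_add h1 h2) h3 using 1
  ring

lemma resP_dvd (a : ℕ → ℕ → ℂ) (n N : ℕ) (p' q p : Bool → PS) (b : Bool) :
    Polynomial.X ^ (N+1) ∣ resP a n N p' q p b ↔
      XX ^ (N+1) ∣ p' b + Dx (p b) - fp a n q p b := by
  rw [← toPS_dvd, resP, map_sub, map_add, map_fp]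
  have h1 := tP_congr (p' b) N
  have h2 := tD_congr (p b) N
  have h3 := fp_congr (XX ^ (N+1)) a n _ _ q p (fun b => tP_congr (q b) N) (fun b => tP_congr (p b) N) b
  refine dvd_iff_dvd_of_dvd_sub ?_
  convert dvd_sub (dvd_add h1 h2) h3 using 1
  ring

/-! the rotating-frame coefficients of a series `Y` -/

def ee (φ : ℂ) (b : Bool) : ℂ := Complex.exp (-(sg b * I * φ))

lemma ee_mul (φ : ℂ) : ee φ true * ee φ false = 1 := by
  rw [ee, ee, ← Complex.exp_add]; simp [sg]

def uQ (Y : ℕ → ℂ → C4) (φ : ℂ) (b : Bool) : PS := PowerSeries.mk fun k => zq (ee φ) (Y k φ) b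
def uP (Y : ℕ → ℂ → C4) (φ : ℂ) (b : Bool) : PS := PowerSeries.mk fun k => zp (ee φ) (Y k φ) b
def duQ (Y : ℕ → ℂ → C4) (φ : ℂ) (b : Bool) : PS :=
  PowerSeries.mk fun k => deriv (fun x => zq (ee x) (Y k x) b) φ
def duP (Y : ℕ → ℂ → C4) (φ : ℂ) (b : Bool) : PS :=
  PowerSeries.mk fun k => deriv (fun x => zp (ee x) (Y k x) b) φ

lemma deriv_comb (f g : ℂ → ℂ) (hf : Differentiable ℂ f) (hg : Differentiable ℂ g) (b : Bool) (φ : ℂ) :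
    HasDerivAt (fun x => ee x b * (f x + sg b * I * g x))
      (ee φ b * (deriv f φ + sg b * I * deriv g φ) - sg b * I * (ee φ b * (f φ + sg b * I * g φ))) φ := by
  have h1 : HasDerivAt (fun x => ee x b) (ee φ b * (-(sg b * I))) φ := by
    have := (((hasDerivAt_id φ).const_mul (sg b * I)).neg).cexp
    simpa [ee] using this
  have h2 := h1.mul (((hf φ).hasDerivAt).add (((hg φ).hasDerivAt).const_mul (sg b * I)))
  refine h2.congr_deriv ?_
  simp only [Pi.add_apply]
  ring

lemma DopV_pSumA (Y : ℕ → ℂ → C4) (hd : ∀ k i, Differentiable ℂ (fun φ => Y k φ i)) (N : ℕ)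
    (φ t : ℂ) (ht : t ≠ 0) (i : Fin 4) :
    DopV (pSumA Y N) φ t i = ∑ k ∈ Finset.range (N+1), (deriv (fun x => Y k x i) φ * t⁻¹ ^ k
      + -(k:ℂ) * Y k φ i * t⁻¹ ^ (k+1)) := by
  rw [DopV, Finset.sum_add_distrib]
  congr 1
  · refine HasDerivAt.deriv ?_
    simp only [pSumA]
    refine HasDerivAt.fun_sum fun k _ => ?_
    have := ((hd k i φ).hasDerivAt).mul_const (t ^ (-(k:ℤ)))
    refine this.congr_deriv ?_
    rw [_root_.zpow_neg, zpow_natCast, inv_pow]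
  · refine HasDerivAt.deriv ?_
    simp only [pSumA]
    refine HasDerivAt.fun_sum fun k _ => ?_
    have := (hasDerivAt_zpow (-(k:ℤ)) t (Or.inl ht)).const_mul (Y k φ i)
    refine this.congr_deriv ?_
    have : t ^ (-(k:ℤ) - 1) = t⁻¹ ^ (k+1) := by
      rw [inv_pow, ← zpow_natCast, ← _root_.zpow_neg]; congr 1; push_cast; ring
    rw [this]; push_cast; ring

lemma pSumA_eq (Y : ℕ → ℂ → C4) (N : ℕ) (φ t : ℂ) (i : Fin 4) :
    pSumA Y N φ t i = ∑ k ∈ Finset.range (N+1), Y k φ i * t⁻¹ ^ k := by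
  rw [pSumA]
  refine Finset.sum_congr rfl fun k _ => ?_
  rw [_root_.zpow_neg, zpow_natCast, inv_pow]

lemma zq_pSumA (Y : ℕ → ℂ → C4) (N : ℕ) (φ t : ℂ) (b : Bool) :
    zq (ee φ) (pSumA Y N φ t) b = (tP (fun k => PowerSeries.coeff k (uQ Y φ b)) N).eval t⁻¹ := by
  rw [eval_tP, zq, pSumA_eq, pSumA_eq, Finset.mul_sum, ← Finset.sum_add_distrib, Finset.mul_sum]
  refine Finset.sum_congr rfl fun k _ => ?_
  simp only [uQ, PowerSeries.coeff_mk, zq]; ring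

lemma zp_pSumA (Y : ℕ → ℂ → C4) (N : ℕ) (φ t : ℂ) (b : Bool) :
    zp (ee φ) (pSumA Y N φ t) b = (tP (fun k => PowerSeries.coeff k (uP Y φ b)) N).eval t⁻¹ := by
  rw [eval_tP, zp, pSumA_eq, pSumA_eq, Finset.mul_sum, ← Finset.sum_add_distrib, Finset.mul_sum]
  refine Finset.sum_congr rfl fun k _ => ?_
  simp only [uP, PowerSeries.coeff_mk, zp]; ring

lemma eval_fq (η : ℂ) (a : ℕ → ℕ → ℂ) (n : ℕ) (q p : Bool → Polynomial ℂ) (b : Bool) (x : ℂ) :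
    (fq η a n q p b).eval x = fq η a n (fun b => (q b).eval x) (fun b => (p b).eval x) b := by
  have := map_fq (Polynomial.aeval x) η a n q p b
  simpa only [Polynomial.coe_aeval_eq_eval] using this

lemma eval_fp (a : ℕ → ℕ → ℂ) (n : ℕ) (q p : Bool → Polynomial ℂ) (b : Bool) (x : ℂ) :
    (fp a n q p b).eval x = fp a n (fun b => (q b).eval x) (fun b => (p b).eval x) b := by
  have := map_fp (Polynomial.aeval x) a n q p b
  simpa only [Polynomial.coe_aeval_eq_eval] using this

lemma res_q (η : ℂ) (a : ℕ → ℕ → ℂ) (n N : ℕ) (Y : ℕ → ℂ → C4)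
    (hd : ∀ k i, Differentiable ℂ (fun φ => Y k φ i)) (φ t : ℂ) (ht : t ≠ 0) (b : Bool) :
    ee φ b * ((DopV (pSumA Y N) φ t 0 - XH (HNFtr η a n) (pSumA Y N φ t) 0) + sg b * I *
      (DopV (pSumA Y N) φ t 1 - XH (HNFtr η a n) (pSumA Y N φ t) 1)) =
    (resQ η a n N (duQ Y φ) (uQ Y φ) (uP Y φ) b).eval t⁻¹ := by
  have h1 := alg_q η a n (ee φ) (ee_mul φ) (pSumA Y N φ t) b
  have h2 : zq (ee φ) (pSumA Y N φ t) = fun b => (tP (fun k => PowerSeries.coeff k (uQ Y φ b)) N).eval t⁻¹ :=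
    funext (zq_pSumA Y N φ t)
  have h3 : zp (ee φ) (pSumA Y N φ t) = fun b => (tP (fun k => PowerSeries.coeff k (uP Y φ b)) N).eval t⁻¹ :=
    funext (zp_pSumA Y N φ t)
  rw [resQ, Polynomial.eval_sub, Polynomial.eval_add, eval_fq, ← h2, ← h3]
  have h4 : (tP (fun k => PowerSeries.coeff k (duQ Y φ b)) N).eval t⁻¹ +
      (tD (fun k => PowerSeries.coeff k (uQ Y φ b)) N).eval t⁻¹ =
      ee φ b * (DopV (pSumA Y N) φ t 0 + sg b * I * DopV (pSumA Y N) φ t 1) -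
        sg b * I * zq (ee φ) (pSumA Y N φ t) b := by
    rw [zq_pSumA, eval_tP, eval_tP, eval_tD, DopV_pSumA Y hd N φ t ht, DopV_pSumA Y hd N φ t ht,
      ← Finset.sum_add_distrib, Finset.mul_sum, ← Finset.sum_add_distrib, Finset.mul_sum, Finset.mul_sum,
      ← Finset.sum_sub_distrib]
    refine Finset.sum_congr rfl fun k _ => ?_
    simp only [uQ, duQ, PowerSeries.coeff_mk, zq]
    rw [(deriv_comb _ _ (hd k 0) (hd k 1) b φ).deriv]
    ring
  rw [h4]
  linear_combination -h1

lemma res_p (η : ℂ) (a : ℕ → ℕ → ℂ) (n N : ℕ) (Y : ℕ → ℂ → C4)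
    (hd : ∀ k i, Differentiable ℂ (fun φ => Y k φ i)) (φ t : ℂ) (ht : t ≠ 0) (b : Bool) :
    ee φ b * ((DopV (pSumA Y N) φ t 2 - XH (HNFtr η a n) (pSumA Y N φ t) 2) + sg b * I *
      (DopV (pSumA Y N) φ t 3 - XH (HNFtr η a n) (pSumA Y N φ t) 3)) =
    (resP a n N (duP Y φ) (uQ Y φ) (uP Y φ) b).eval t⁻¹ := by
  have h1 := alg_p η a n (ee φ) (ee_mul φ) (pSumA Y N φ t) b
  have h2 : zq (ee φ) (pSumA Y N φ t) = fun b => (tP (fun k => PowerSeries.coeff k (uQ Y φ b)) N).eval t⁻¹ :=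
    funext (zq_pSumA Y N φ t)
  have h3 : zp (ee φ) (pSumA Y N φ t) = fun b => (tP (fun k => PowerSeries.coeff k (uP Y φ b)) N).eval t⁻¹ :=
    funext (zp_pSumA Y N φ t)
  rw [resP, Polynomial.eval_sub, Polynomial.eval_add, eval_fp, ← h2, ← h3]
  have h4 : (tP (fun k => PowerSeries.coeff k (duP Y φ b)) N).eval t⁻¹ +
      (tD (fun k => PowerSeries.coeff k (uP Y φ b)) N).eval t⁻¹ =
      ee φ b * (DopV (pSumA Y N) φ t 2 + sg b * I * DopV (pSumA Y N) φ t 3) -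
        sg b * I * zp (ee φ) (pSumA Y N φ t) b := by
    rw [zp_pSumA, eval_tP, eval_tP, eval_tD, DopV_pSumA Y hd N φ t ht, DopV_pSumA Y hd N φ t ht,
      ← Finset.sum_add_distrib, Finset.mul_sum, ← Finset.sum_add_distrib, Finset.mul_sum, Finset.mul_sum,
      ← Finset.sum_sub_distrib]
    refine Finset.sum_congr rfl fun k _ => ?_
    simp only [uP, duP, PowerSeries.coeff_mk, zp]
    rw [(deriv_comb _ _ (hd k 2) (hd k 3) b φ).deriv]
    ring
  rw [h4]
  linear_combination -h1


def rec4 (φ : ℂ) (Q P : Bool → ℂ) : C4 :=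
  ![(ee φ false * Q true + ee φ true * Q false) / 2,
    (ee φ false * Q true - ee φ true * Q false) / (2 * I),
    (ee φ false * P true + ee φ true * P false) / 2,
    (ee φ false * P true - ee φ true * P false) / (2 * I)]

lemma rec4_z (φ : ℂ) (z : C4) : rec4 φ (zq (ee φ) z) (zp (ee φ) z) = z := by
  have h := ee_mul φ
  have hI : (I:ℂ) ≠ 0 := I_ne_zero
  funext i
  fin_cases i
  · simp [rec4, zq, sg]; linear_combination z 0 * h
  · simp [rec4, zq, sg]; field_simp; linear_combination 2 * I * z 1 * h
  · simp [rec4, zp, sg]; linear_combination z 2 * h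
  · simp [rec4, zp, sg]; field_simp; linear_combination 2 * I * z 3 * h

lemma zq_rec4 (φ : ℂ) (Q P : Bool → ℂ) (b : Bool) : zq (ee φ) (rec4 φ Q P) b = Q b := by
  have h := ee_mul φ
  have hI : (I:ℂ) ≠ 0 := I_ne_zero
  cases b
  · simp [rec4, zq, sg]; field_simp; linear_combination 2 * Q false * h
  · simp [rec4, zq, sg]; field_simp; linear_combination 2 * Q true * h

lemma zp_rec4 (φ : ℂ) (Q P : Bool → ℂ) (b : Bool) : zp (ee φ) (rec4 φ Q P) b = P b := by
  have h := ee_mul φ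
  have hI : (I:ℂ) ≠ 0 := I_ne_zero
  cases b
  · simp [rec4, zp, sg]; field_simp; linear_combination 2 * P false * h
  · simp [rec4, zp, sg]; field_simp; linear_combination 2 * P true * h

lemma norm_ee (φ : ℝ) (b : Bool) : ‖ee φ b‖ = 1 := by
  have : ee φ b = Complex.exp (((if b then -φ else φ : ℝ) : ℂ) * I) := by
    rw [ee]; congr 1; cases b <;> simp [sg]; 
    all_goals ring
  rw [this, Complex.norm_exp_ofReal_mul_I]

lemma norm_sg (b : Bool) : ‖sg b‖ = 1 := by cases b <;> simp [sg]

lemma norm_rec4 (φ : ℝ) (Q P : Bool → ℂ) (B : ℝ) (hQ : ∀ b, ‖Q b‖ ≤ B) (hP : ∀ b, ‖P b‖ ≤ B) (i : Fin 4) :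
    ‖rec4 φ Q P i‖ ≤ B := by
  have key1 : ∀ u v : ℂ, ‖u‖ ≤ B → ‖v‖ ≤ B → ‖(ee φ false * u + ee φ true * v) / 2‖ ≤ B := by
    intro u v hu hv
    rw [norm_div, Complex.norm_ofNat]
    have := norm_add_le (ee φ false * u) (ee φ true * v)
    rw [norm_mul, norm_mul, norm_ee, norm_ee] at this
    linarith
  have key2 : ∀ u v : ℂ, ‖u‖ ≤ B → ‖v‖ ≤ B → ‖(ee φ false * u - ee φ true * v) / (2 * I)‖ ≤ B := by
    intro u v hu hv
    rw [norm_div, norm_mul, Complex.norm_I, Complex.norm_ofNat]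
    have := norm_sub_le (ee φ false * u) (ee φ true * v)
    rw [norm_mul, norm_mul, norm_ee, norm_ee] at this
    linarith
  fin_cases i
  · exact key1 _ _ (hQ _) (hQ _)
  · exact key2 _ _ (hQ _) (hQ _)
  · exact key1 _ _ (hP _) (hP _)
  · exact key2 _ _ (hP _) (hP _)

lemma norm_comb (φ : ℝ) (b : Bool) (u v : ℂ) (B : ℝ) (hu : ‖u‖ ≤ B) (hv : ‖v‖ ≤ B) :
    ‖ee φ b * (u + sg b * I * v)‖ ≤ 2 * B := by
  rw [norm_mul, norm_ee, one_mul]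
  have := norm_add_le u (sg b * I * v)
  rw [norm_mul, norm_mul, norm_sg, Complex.norm_I] at this
  linarith

def Gof (q p : Bool → PS) (k : ℕ) (φ : ℂ) : C4 :=
  rec4 φ (fun b => PowerSeries.coeff k (q b)) (fun b => PowerSeries.coeff k (p b))

/-! trigonometric polynomials -/

lemma trig_diff (f : ℂ → ℂ) (h : IsTrigPoly f) : Differentiable ℂ f := by
  obtain ⟨n, a, b, h⟩ := h
  have : f = fun φ => a 0 + ∑ k ∈ Finset.Icc 1 n, (a k * Complex.cos (k * φ) + b k * Complex.sin (k * φ)) :=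
    funext h
  rw [this]
  fun_prop

lemma trig_bdd (f : ℂ → ℂ) (h : IsTrigPoly f) : ∃ M, ∀ φ : ℝ, ‖f φ‖ ≤ M := by
  obtain ⟨n, a, b, h⟩ := h
  refine ⟨‖a 0‖ + ∑ k ∈ Finset.Icc 1 n, (‖a k‖ + ‖b k‖), fun φ => ?_⟩
  rw [h]
  refine (norm_add_le _ _).trans (add_le_add le_rfl ((norm_sum_le _ _).trans ?_))
  refine Finset.sum_le_sum fun k _ => (norm_add_le _ _).trans ?_
  have e1 : ‖Complex.cos (k * φ)‖ ≤ 1 := by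
    have : Complex.cos (k * φ) = ((Real.cos (k * φ) : ℝ) : ℂ) := by push_cast; rfl
    rw [this, Complex.norm_real]; exact Real.abs_cos_le_one _
  have e2 : ‖Complex.sin (k * φ)‖ ≤ 1 := by
    have : Complex.sin (k * φ) = ((Real.sin (k * φ) : ℝ) : ℂ) := by push_cast; rfl
    rw [this, Complex.norm_real]; exact Real.abs_sin_le_one _
  rw [norm_mul, norm_mul]
  exact add_le_add (mul_le_of_le_one_right (norm_nonneg _) e1) (mul_le_of_le_one_right (norm_nonneg _) e2)

lemma trig_mk (A B : ℂ) (f : ℂ → ℂ) (h : ∀ φ, f φ = A * Complex.cos φ + B * Complex.sin φ) : IsTrigPoly f := by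
  refine ⟨1, fun k => if k = 1 then A else 0, fun k => if k = 1 then B else 0, fun φ => ?_⟩
  simp [h]

lemma ee_false (φ : ℂ) : ee φ false = Complex.cos φ + Complex.sin φ * I := by
  rw [ee, ← Complex.exp_mul_I]; congr 1; simp [sg]; ring
lemma ee_true (φ : ℂ) : ee φ true = Complex.cos φ - Complex.sin φ * I := by
  have : -(sg true * I * φ) = (-φ) * I := by simp [sg]; ring
  rw [ee, this, Complex.exp_mul_I, Complex.cos_neg, Complex.sin_neg]; ring

lemma trig_Gof (q p : Bool → PS) (k : ℕ) (i : Fin 4) : IsTrigPoly (fun φ => Gof q p k φ i) := by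
  have hI : (I:ℂ) ≠ 0 := I_ne_zero
  have key1 : ∀ (u v : ℂ), IsTrigPoly (fun φ => (ee φ false * u + ee φ true * v) / 2) := by
    intro u v
    refine trig_mk ((u + v)/2) (I * (u - v) / 2) _ fun φ => ?_
    rw [ee_false, ee_true]; ring
  have key2 : ∀ (u v : ℂ), IsTrigPoly (fun φ => (ee φ false * u - ee φ true * v) / (2 * I)) := by
    intro u v
    refine trig_mk ((u - v)/(2 * I)) ((u + v) / 2) _ fun φ => ?_
    rw [ee_false, ee_true]; field_simp; ring
  fin_cases i
  · exact key1 _ _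
  · exact key2 _ _
  · exact key1 _ _
  · exact key2 _ _

lemma uQ_Gof (q p : Bool → PS) (φ : ℂ) : uQ (Gof q p) φ = q := by
  funext b; ext k; simp only [uQ, Gof, PowerSeries.coeff_mk, zq_rec4]
lemma uP_Gof (q p : Bool → PS) (φ : ℂ) : uP (Gof q p) φ = p := by
  funext b; ext k; simp only [uP, Gof, PowerSeries.coeff_mk, zp_rec4]
lemma duQ_Gof (q p : Bool → PS) (φ : ℂ) : duQ (Gof q p) φ = 0 := by
  funext b; ext k; simp only [duQ, Gof, PowerSeries.coeff_mk, zq_rec4, deriv_const]; simp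
lemma duP_Gof (q p : Bool → PS) (φ : ℂ) : duP (Gof q p) φ = 0 := by
  funext b; ext k; simp only [duP, Gof, PowerSeries.coeff_mk, zp_rec4, deriv_const]; simp

lemma sol_of_FE (η : ℂ) (a : ℕ → ℕ → ℂ) (q p : Bool → PS) (hq : ∀ b, XX ∣ q b) (hp : ∀ b, XX ∣ p b)
    (H : FEall η a q p) : IsFormalSolNF η a (Gof q p) := by
  refine ⟨fun k i => trig_Gof q p k i, fun φ => ?_, fun N => ?_⟩
  · have h1 : ∀ b, PowerSeries.coeff 0 (q b) = 0 := fun b => by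
      rw [PowerSeries.coeff_zero_eq_constantCoeff_apply]; exact PowerSeries.X_dvd_iff.mp (hq b)
    have h2 : ∀ b, PowerSeries.coeff 0 (p b) = 0 := fun b => by
      rw [PowerSeries.coeff_zero_eq_constantCoeff_apply]; exact PowerSeries.X_dvd_iff.mp (hp b)
    rw [Gof]; simp only [h1, h2]
    funext i; fin_cases i <;> simp [rec4]
  · obtain ⟨n0, h0⟩ := H N
    refine ⟨n0, fun n hn => ?_⟩
    have hd : ∀ k i, Differentiable ℂ (fun φ => Gof q p k φ i) := fun k i => trig_diff _ (trig_Gof q p k i)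
    have b1 : ∀ b, ∃ C > (0:ℝ), ∀ t : ℝ, 1 ≤ t → ‖(resQ η a n N 0 q p b).eval ((t:ℂ)⁻¹)‖ ≤ C / t ^ (N+1) := by
      intro b
      apply poly_bound
      rw [resQ_dvd, Pi.zero_apply, zero_add]
      exact (h0 n hn b).1
    have b2 : ∀ b, ∃ C > (0:ℝ), ∀ t : ℝ, 1 ≤ t → ‖(resP a n N 0 q p b).eval ((t:ℂ)⁻¹)‖ ≤ C / t ^ (N+1) := by
      intro b
      apply poly_bound
      rw [resP_dvd, Pi.zero_apply, zero_add]
      exact (h0 n hn b).2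
    choose C1 hC1 h1 using b1
    choose C2 hC2 h2 using b2
    have m1 : ∀ b, C1 b ≤ C1 true + C1 false + C2 true + C2 false := by
      intro b
      have := hC1 true; have := hC1 false; have := hC2 true; have := hC2 false
      cases b <;> linarith
    have m2 : ∀ b, C2 b ≤ C1 true + C1 false + C2 true + C2 false := by
      intro b
      have := hC1 true; have := hC1 false; have := hC2 true; have := hC2 false
      cases b <;> linarith
    refine ⟨C1 true + C1 false + C2 true + C2 false, (hC1 true).trans_le (m1 true), 1, one_pos,
      fun φ t ht i => ?_⟩
    have ht0 : (t:ℂ) ≠ 0 := by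
      have : t ≠ 0 := by linarith
      exact_mod_cast this
    set R : C4 := fun i => DopV (pSumA (Gof q p) N) (φ:ℂ) (t:ℂ) i -
      XH (HNFtr η a n) (pSumA (Gof q p) N (φ:ℂ) (t:ℂ)) i with hR
    have r1 : ∀ b, zq (ee φ) R b = (resQ η a n N 0 q p b).eval ((t:ℂ)⁻¹) := by
      intro b
      have := res_q η a n N (Gof q p) hd φ t ht0 b
      rw [duQ_Gof, uQ_Gof, uP_Gof] at this
      rw [← this, zq]
    have r2 : ∀ b, zp (ee φ) R b = (resP a n N 0 q p b).eval ((t:ℂ)⁻¹) := by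
      intro b
      have := res_p η a n N (Gof q p) hd φ t ht0 b
      rw [duP_Gof, uQ_Gof, uP_Gof] at this
      rw [← this, zp]
    change ‖R i‖ ≤ _
    rw [← rec4_z φ R]
    refine norm_rec4 φ _ _ _ (fun b => ?_) (fun b => ?_) i
    · rw [r1]
      refine (h1 b t ht).trans ?_
      have := m1 b
      gcongr
    · rw [r2]
      refine (h2 b t ht).trans ?_
      have := m2 b
      gcongr

/-! forward direction -/

lemma const_of_bdd (f : ℝ → ℂ) (c : ℂ) (h : ∀ s, HasDerivAt f c s) (M : ℝ) (hb : ∀ s, ‖f s‖ ≤ M) (s : ℝ) :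
    f s = f 0 := by
  have h1 : ∀ s, f s - (s:ℂ) * c = f 0 := by
    intro s
    have hd : ∀ x, HasDerivAt (fun x : ℝ => f x - (x:ℂ) * c) 0 x := by
      intro x
      have := (h x).sub (((hasDerivAt_id (x:ℂ)).comp_ofReal).mul_const c)
      refine this.congr_deriv ?_
      simp
    have := is_const_of_deriv_eq_zero (𝕜 := ℝ) (f := fun x : ℝ => f x - (x:ℂ) * c)
      (fun x => (hd x).differentiableAt) (fun x => (hd x).deriv) s 0
    simpa using this
  have hc : c = 0 := by
    by_contra hc
    have hn : 0 < ‖c‖ := norm_pos_iff.mpr hc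
    have hM : 0 ≤ M := (norm_nonneg _).trans (hb 0)
    have e : (((2 * M + 1) / ‖c‖ : ℝ) : ℂ) * c = f ((2 * M + 1) / ‖c‖) - f 0 := by
      rw [← h1 ((2 * M + 1) / ‖c‖)]; ring
    have e2 := congrArg norm e
    rw [norm_mul, Complex.norm_real, Real.norm_of_nonneg (by positivity), div_mul_cancel₀ _ hn.ne'] at e2
    have := norm_sub_le (f ((2 * M + 1) / ‖c‖)) (f 0)
    have := hb ((2 * M + 1) / ‖c‖)
    have := hb 0
    linarith
  have := h1 s
  rw [hc, mul_zero, sub_zero] at this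
  exact this

lemma X_dvd_i1 (q p : Bool → PS) (hq : ∀ b, XX ∣ q b) : XX ∣ i1 q p := by
  rw [i1]
  exact Dvd.dvd.mul_left (dvd_sub (Dvd.dvd.mul_right (hq _) _) (Dvd.dvd.mul_right (hq _) _)) _

lemma X_dvd_i3 (p : Bool → PS) (hp : ∀ b, XX ∣ p b) : XX ∣ i3 p := by
  rw [i3]
  exact Dvd.dvd.mul_left (Dvd.dvd.mul_right (hp _) _) _

lemma fq_step (η : ℂ) (a : ℕ → ℕ → ℂ) (n m : ℕ) (q p q' p' : Bool → PS)
    (hq : ∀ b, XX ∣ q b) (hp : ∀ b, XX ∣ p b) (hq' : ∀ b, XX ∣ q' b) (hp' : ∀ b, XX ∣ p' b)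
    (dq : ∀ b, XX ^ m ∣ q b - q' b) (dp : ∀ b, XX ^ m ∣ p b - p' b) (b : Bool) :
    XX ^ (m+1) ∣ fq η a n q p b - fq η a n q' p' b := by
  have d1 := i1_congr _ q p q' p' dq dp
  have d3 := i3_congr _ p p' dp
  have c1 := cA_congr _ a n _ _ _ _ d1 d3
  have c2 := cB_congr _ η a n _ _ _ _ d1 d3
  have x1 := X_dvd_i1 q' p' hq'
  have x3 := X_dvd_i3 p' hp'
  have y1 := dvd_cA _ a n _ _ x1 x3
  have y2 := dvd_cB _ η a n _ _ x1 x3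
  rw [← pow_one XX] at y1 y2 hq hp
  have z1 := mul_sub_dvd c1 (hq b) y1 (dq b) (m+1) le_rfl (by omega)
  have z2 := mul_sub_dvd c2 (hp b) y2 (dp b) (m+1) le_rfl (by omega)
  rw [fq, fq]
  convert dvd_sub z2 (Dvd.dvd.mul_left z1 (algebraMap ℂ PS (sg b * I))) using 1
  ring

lemma fp_step (a : ℕ → ℕ → ℂ) (n m : ℕ) (q p q' p' : Bool → PS)
    (hq' : ∀ b, XX ∣ q' b) (hp : ∀ b, XX ∣ p b) (hp' : ∀ b, XX ∣ p' b)
    (dq : ∀ b, XX ^ (m+1) ∣ q b - q' b) (dp : ∀ b, XX ^ m ∣ p b - p' b) (b : Bool) :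
    XX ^ (m+1) ∣ fp a n q p b - fp a n q' p' b := by
  have d1 := i1_congr _ q p q' p' (fun b => (pow_dvd_pow _ (Nat.le_succ m)).trans (dq b)) dp
  have d3 := i3_congr _ p p' dp
  have c1 := cA_congr _ a n _ _ _ _ d1 d3
  have x1 := X_dvd_i1 q' p' hq'
  have x3 := X_dvd_i3 p' hp'
  have y1 := dvd_cA _ a n _ _ x1 x3
  rw [← pow_one XX] at y1 hp
  have z1 := mul_sub_dvd c1 (hp b) y1 (dp b) (m+1) le_rfl (by omega)
  rw [fp, fp]
  convert dvd_sub (dvd_neg.mpr (dq b)) (Dvd.dvd.mul_left z1 (algebraMap ℂ PS (sg b * I))) using 1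
  ring

lemma extend_real (f : ℂ → ℂ) (hf : Differentiable ℂ f) (c : ℂ) (h : ∀ s : ℝ, f s = c) (z : ℂ) : f z = c := by
  have h1 : AnalyticOnNhd ℂ f Set.univ := fun x _ => hf.analyticAt x
  have h2 : AnalyticOnNhd ℂ (fun _ : ℂ => c) Set.univ := fun x _ => analyticAt_const
  have ht : Tendsto (fun s : ℝ => (s:ℂ)) (nhdsWithin 0 {0}ᶜ) (nhdsWithin (0:ℂ) {0}ᶜ) := by
    refine tendsto_nhdsWithin_iff.mpr ⟨?_, ?_⟩
    · have := (Complex.continuous_ofReal.tendsto 0).mono_left (nhdsWithin_le_nhds (s := {0}ᶜ))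
      simpa using this
    · filter_upwards [self_mem_nhdsWithin] with s hs
      simpa using hs
  have hfr : ∃ᶠ z in nhdsWithin (0:ℂ) {0}ᶜ, f z = (fun _ : ℂ => c) z :=
    ht.frequently (Frequently.of_forall h)
  exact h1.eqOn_of_preconnected_of_frequently_eq h2 isPreconnected_univ (mem_univ 0) hfr (mem_univ z)

lemma FE_of_sol (η : ℂ) (a : ℕ → ℕ → ℂ) (Y : ℕ → ℂ → C4) (H : IsFormalSolNF η a Y) :
    ∃ q p : Bool → PS, Y = Gof q p ∧ (∀ b, XX ∣ q b) ∧ (∀ b, XX ∣ p b) ∧ FEall η a q p := by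
  obtain ⟨htr, h0, hN⟩ := H
  have hd : ∀ k i, Differentiable ℂ (fun φ => Y k φ i) := fun k i => trig_diff _ (htr k i)
  have hX1 : ∀ φ b, XX ∣ uQ Y φ b := by
    intro φ b
    rw [PowerSeries.X_dvd_iff, ← PowerSeries.coeff_zero_eq_constantCoeff_apply, uQ, PowerSeries.coeff_mk, h0]
    simp [zq]
  have hX2 : ∀ φ b, XX ∣ uP Y φ b := by
    intro φ b
    rw [PowerSeries.X_dvd_iff, ← PowerSeries.coeff_zero_eq_constantCoeff_apply, uP, PowerSeries.coeff_mk, h0]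
    simp [zp]
  have hE : ∀ N, ∃ n₀, ∀ n, n₀ ≤ n → ∀ (φ : ℝ) b,
      XX ^ (N+1) ∣ duQ Y φ b + Dx (uQ Y φ b) - fq η a n (uQ Y φ) (uP Y φ) b ∧
      XX ^ (N+1) ∣ duP Y φ b + Dx (uP Y φ b) - fp a n (uQ Y φ) (uP Y φ) b := by
    intro N
    obtain ⟨n0, h⟩ := hN N
    refine ⟨n0, fun n hn φ b => ?_⟩
    obtain ⟨C, hC, T, hT, hb⟩ := h n hn
    constructor
    · rw [← resQ_dvd]
      apply poly_dvd _ _ (2 * C) T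
      intro t ht
      have ht0 : (t:ℂ) ≠ 0 := by
        have : t ≠ 0 := by linarith
        exact_mod_cast this
      rw [← res_q η a n N Y hd φ t ht0 b, mul_div_assoc]
      exact norm_comb φ b _ _ _ (hb φ t ht 0) (hb φ t ht 1)
    · rw [← resP_dvd]
      apply poly_dvd _ _ (2 * C) T
      intro t ht
      have ht0 : (t:ℂ) ≠ 0 := by
        have : t ≠ 0 := by linarith
        exact_mod_cast this
      rw [← res_p η a n N Y hd φ t ht0 b, mul_div_assoc]
      exact norm_comb φ b _ _ _ (hb φ t ht 2) (hb φ t ht 3)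
  have dQ : ∀ b m, Differentiable ℂ (fun x => zq (ee x) (Y m x) b) := fun b m x =>
    (deriv_comb _ _ (hd m 0) (hd m 1) b x).differentiableAt
  have dP : ∀ b m, Differentiable ℂ (fun x => zp (ee x) (Y m x) b) := fun b m x =>
    (deriv_comb _ _ (hd m 2) (hd m 3) b x).differentiableAt
  have bQ : ∀ b m, ∃ M, ∀ s : ℝ, ‖zq (ee s) (Y m s) b‖ ≤ M := by
    intro b m
    obtain ⟨M1, h1⟩ := trig_bdd _ (htr m 0)
    obtain ⟨M2, h2⟩ := trig_bdd _ (htr m 1)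
    exact ⟨2 * max M1 M2, fun s => norm_comb s b _ _ _ ((h1 s).trans (le_max_left _ _))
      ((h2 s).trans (le_max_right _ _))⟩
  have bP : ∀ b m, ∃ M, ∀ s : ℝ, ‖zp (ee s) (Y m s) b‖ ≤ M := by
    intro b m
    obtain ⟨M1, h1⟩ := trig_bdd _ (htr m 2)
    obtain ⟨M2, h2⟩ := trig_bdd _ (htr m 3)
    exact ⟨2 * max M1 M2, fun s => norm_comb s b _ _ _ ((h1 s).trans (le_max_left _ _))
      ((h2 s).trans (le_max_right _ _))⟩
  have S : ∀ m, (∀ (φ : ℝ) b, PowerSeries.coeff m (uQ Y φ b) = PowerSeries.coeff m (uQ Y (0:ℝ) b)) ∧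
      (∀ (φ : ℝ) b, PowerSeries.coeff m (uP Y φ b) = PowerSeries.coeff m (uP Y (0:ℝ) b)) := by
    intro m
    induction m using Nat.strong_induction_on with
    | _ m ih =>
    have dq : ∀ (φ : ℝ) b, XX ^ m ∣ uQ Y φ b - uQ Y (0:ℝ) b := by
      intro φ b
      rw [PowerSeries.X_pow_dvd_iff]; intro j hj
      rw [map_sub, (ih j hj).1 φ b, sub_self]
    have dp : ∀ (φ : ℝ) b, XX ^ m ∣ uP Y φ b - uP Y (0:ℝ) b := by
      intro φ b
      rw [PowerSeries.X_pow_dvd_iff]; intro j hj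
      rw [map_sub, (ih j hj).2 φ b, sub_self]
    obtain ⟨n, hn⟩ := hE m
    have hn := hn n le_rfl
    have cq : ∀ (φ : ℝ) b, PowerSeries.coeff m (duQ Y φ b) = PowerSeries.coeff m (duQ Y (0:ℝ) b) := by
      intro φ b
      apply coeff_eq_of_dvd (N := m+1) _ (Nat.lt_succ_self m)
      have s1 := fq_step η a n m _ _ _ _ (hX1 φ) (hX2 φ) (hX1 (0:ℝ)) (hX2 (0:ℝ)) (dq φ) (dp φ) b
      have s2 := dvd_Dx _ _ (dq φ b)
      rw [Dx_sub] at s2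
      convert dvd_sub (dvd_add (dvd_sub (hn φ b).1 (hn 0 b).1) s1) s2 using 1
      ring
    have kq : ∀ (φ : ℝ) b, PowerSeries.coeff m (uQ Y φ b) = PowerSeries.coeff m (uQ Y (0:ℝ) b) := by
      intro φ b
      obtain ⟨M, hM⟩ := bQ b m
      have hder : ∀ s : ℝ, HasDerivAt (fun s : ℝ => zq (ee s) (Y m s) b)
          (PowerSeries.coeff m (duQ Y (0:ℝ) b)) s := by
        intro s
        rw [← cq s b, duQ, PowerSeries.coeff_mk]
        exact (dQ b m s).hasDerivAt.comp_ofReal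
      have := const_of_bdd _ _ hder M hM φ
      simpa only [uQ, PowerSeries.coeff_mk] using this
    have dq' : ∀ (φ : ℝ) b, XX ^ (m+1) ∣ uQ Y φ b - uQ Y (0:ℝ) b := by
      intro φ b
      rw [PowerSeries.X_pow_dvd_iff]; intro j hj
      rcases Nat.lt_succ_iff_lt_or_eq.mp hj with hj | rfl
      · rw [map_sub, (ih j hj).1 φ b, sub_self]
      · rw [map_sub, kq φ b, sub_self]
    have cp : ∀ (φ : ℝ) b, PowerSeries.coeff m (duP Y φ b) = PowerSeries.coeff m (duP Y (0:ℝ) b) := by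
      intro φ b
      apply coeff_eq_of_dvd (N := m+1) _ (Nat.lt_succ_self m)
      have s1 := fp_step a n m _ _ _ _ (hX1 (0:ℝ)) (hX2 φ) (hX2 (0:ℝ)) (dq' φ) (dp φ) b
      have s2 := dvd_Dx _ _ (dp φ b)
      rw [Dx_sub] at s2
      convert dvd_sub (dvd_add (dvd_sub (hn φ b).2 (hn 0 b).2) s1) s2 using 1
      ring
    refine ⟨kq, fun φ b => ?_⟩
    obtain ⟨M, hM⟩ := bP b m
    have hder : ∀ s : ℝ, HasDerivAt (fun s : ℝ => zp (ee s) (Y m s) b)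
        (PowerSeries.coeff m (duP Y (0:ℝ) b)) s := by
      intro s
      rw [← cp s b, duP, PowerSeries.coeff_mk]
      exact (dP b m s).hasDerivAt.comp_ofReal
    have := const_of_bdd _ _ hder M hM φ
    simpa only [uP, PowerSeries.coeff_mk] using this
  have EQ : ∀ m b z, zq (ee z) (Y m z) b = PowerSeries.coeff m (uQ Y (0:ℝ) b) := by
    intro m b z
    refine extend_real _ (dQ b m) _ (fun s => ?_) z
    rw [← (S m).1 s b, uQ, PowerSeries.coeff_mk]
  have EP : ∀ m b z, zp (ee z) (Y m z) b = PowerSeries.coeff m (uP Y (0:ℝ) b) := by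
    intro m b z
    refine extend_real _ (dP b m) _ (fun s => ?_) z
    rw [← (S m).2 s b, uP, PowerSeries.coeff_mk]
  refine ⟨uQ Y (0:ℝ), uP Y (0:ℝ), ?_, hX1 _, hX2 _, fun N => ?_⟩
  · funext k φ
    rw [← rec4_z φ (Y k φ), Gof]
    congr 1
    · funext b; exact EQ k b φ
    · funext b; exact EP k b φ
  · obtain ⟨n0, h⟩ := hE N
    refine ⟨n0, fun n hn b => ?_⟩
    have z1 : duQ Y (0:ℝ) b = 0 := by
      ext k
      rw [duQ, PowerSeries.coeff_mk]
      simp only [EQ, deriv_const, map_zero]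
    have z2 : duP Y (0:ℝ) b = 0 := by
      ext k
      rw [duP, PowerSeries.coeff_mk]
      simp only [EP, deriv_const, map_zero]
    have := h n hn 0 b
    rw [z1, z2, zero_add, zero_add] at this
    exact this


lemma z_ext (φ : ℂ) (z w : C4) (h1 : ∀ b, zq (ee φ) z b = zq (ee φ) w b)
    (h2 : ∀ b, zp (ee φ) z b = zp (ee φ) w b) : z = w := by
  rw [← rec4_z φ z, ← rec4_z φ w, funext h1, funext h2]

lemma ee_add (φ ψ : ℂ) (b : Bool) : ee φ b = ee (φ + ψ) b * ee ψ (!b) := by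
  rw [ee, ee, ee, ← Complex.exp_add]; congr 1; cases b <;> simp [sg] <;> ring

lemma zq_rec4' (φ ψ : ℂ) (Q P : Bool → ℂ) (b : Bool) :
    zq (ee φ) (rec4 (φ + ψ) Q P) b = ee ψ (!b) * Q b := by
  conv_rhs => rw [← zq_rec4 (φ + ψ) Q P b]
  rw [zq, zq, ee_add φ ψ b]; ring

lemma zp_rec4' (φ ψ : ℂ) (Q P : Bool → ℂ) (b : Bool) :
    zp (ee φ) (rec4 (φ + ψ) Q P) b = ee ψ (!b) * P b := by
  conv_rhs => rw [← zp_rec4 (φ + ψ) Q P b]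
  rw [zp, zp, ee_add φ ψ b]; ring

lemma coeff_alg_mul (c : ℂ) (f : PS) (k : ℕ) :
    PowerSeries.coeff k (algebraMap ℂ PS c * f) = c * PowerSeries.coeff k f := by
  rw [← Algebra.smul_def, PowerSeries.coeff_smul, smul_eq_mul]

lemma shiftC_Gof (q p : Bool → PS) (φ₀ τ₀ : ℂ) (k : ℕ) (φ : ℂ) :
    shiftC (Gof q p) φ₀ τ₀ k φ =
      Gof (fun b => algebraMap ℂ PS (ee φ₀ (!b)) * shPS τ₀ (q b))
        (fun b => algebraMap ℂ PS (ee φ₀ (!b)) * shPS τ₀ (p b)) k φ := by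
  apply z_ext φ
  · intro b
    have lin : ∀ (s : Finset ℕ) (c : ℕ → ℂ) (v : ℕ → C4), zq (ee φ) (∑ j ∈ s, c j • v j) b =
        ∑ j ∈ s, c j * zq (ee φ) (v j) b := by
      intro s c v
      simp only [zq, Finset.sum_apply, Pi.smul_apply, smul_eq_mul]
      rw [Finset.mul_sum, ← Finset.sum_add_distrib, Finset.mul_sum]
      exact Finset.sum_congr rfl fun j _ => by ring
    rw [shiftC, lin, Gof, zq_rec4, coeff_alg_mul, coeff_shPS, Finset.mul_sum]
    refine Finset.sum_congr rfl fun j _ => ?_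
    rw [Gof, zq_rec4']; ring
  · intro b
    have lin : ∀ (s : Finset ℕ) (c : ℕ → ℂ) (v : ℕ → C4), zp (ee φ) (∑ j ∈ s, c j • v j) b =
        ∑ j ∈ s, c j * zp (ee φ) (v j) b := by
      intro s c v
      simp only [zp, Finset.sum_apply, Pi.smul_apply, smul_eq_mul]
      rw [Finset.mul_sum, ← Finset.sum_add_distrib, Finset.mul_sum]
      exact Finset.sum_congr rfl fun j _ => by ring
    rw [shiftC, lin, Gof, zp_rec4, coeff_alg_mul, coeff_shPS, Finset.mul_sum]
    refine Finset.sum_congr rfl fun j _ => ?_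
    rw [Gof, zp_rec4']; ring

/-! polar form -/

def Epoly (θ : PS) (N : ℕ) (b : Bool) : Polynomial ℂ :=
  ∑ d ∈ Finset.range (N+1), algebraMap ℂ (Polynomial ℂ) ((d.factorial : ℂ)⁻¹) *
    (algebraMap ℂ (Polynomial ℂ) (sg b * I) * tP (fun k => PowerSeries.coeff k θ) N) ^ d

lemma Epoly_congr (θ : PS) (hθ : XX ∣ θ) (N : ℕ) (b : Bool) :
    XX ^ (N+1) ∣ toPS (Epoly θ N b) - EE θ b := by
  have h1 := EE_dvd θ hθ b (N+1)
  have h2 : XX ^ (N+1) ∣ toPS (Epoly θ N b) -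
      (∑ d ∈ Finset.range (N+1), algebraMap ℂ PS ((d.factorial : ℂ)⁻¹) *
        (algebraMap ℂ PS (sg b * I) * θ) ^ d) := by
    rw [Epoly, map_sum, ← Finset.sum_sub_distrib]
    refine Finset.dvd_sum fun d _ => ?_
    rw [map_mul, map_pow, map_mul, AlgHom.commutes, AlgHom.commutes, ← mul_sub]
    refine Dvd.dvd.mul_left ((dvd_trans ?_) (sub_dvd_pow_sub_pow _ _ d)) _
    rw [← mul_sub]
    exact Dvd.dvd.mul_left (tP_congr θ N) _
  convert dvd_sub h2 h1 using 1
  ring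

lemma norm_inv_t (t : ℝ) (ht : 0 < t) : ‖(t:ℂ)⁻¹‖ = t⁻¹ := by
  rw [norm_inv, Complex.norm_real, Real.norm_of_nonneg ht.le]

lemma exp_approx (θ : PS) (hθ : XX ∣ θ) (N : ℕ) (b : Bool) :
    ∃ C > (0:ℝ), ∃ T ≥ (1:ℝ), ∀ t : ℝ, T ≤ t →
      ‖Complex.exp (sg b * I * (tP (fun k => PowerSeries.coeff k θ) N).eval ((t:ℂ)⁻¹)) -
        (Epoly θ N b).eval ((t:ℂ)⁻¹)‖ ≤ C / t ^ (N+1) := by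
  have hd : Polynomial.X ^ 1 ∣ tP (fun k => PowerSeries.coeff k θ) N := by
    rw [pow_one, Polynomial.X_dvd_iff, coeff_tP _ _ _ (Nat.succ_pos N),
      PowerSeries.coeff_zero_eq_constantCoeff_apply]
    exact PowerSeries.X_dvd_iff.mp hθ
  obtain ⟨C, hC, h⟩ := poly_bound _ 1 hd
  refine ⟨C ^ (N+1) * ((N+1).succ * ((N+1).factorial * (N+1:ℕ) : ℝ)⁻¹), by positivity,
    max 1 C, le_max_left _ _, fun t ht => ?_⟩
  have ht1 : 1 ≤ t := (le_max_left _ _).trans ht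
  have ht2 : C ≤ t := (le_max_right _ _).trans ht
  have ht0 : 0 < t := by linarith
  set w := sg b * I * (tP (fun k => PowerSeries.coeff k θ) N).eval ((t:ℂ)⁻¹) with hw
  have hwn : ‖w‖ ≤ C / t := by
    rw [hw, norm_mul, norm_mul, norm_sg, Complex.norm_I, one_mul, one_mul]
    simpa using h t ht1
  have hw1 : ‖w‖ ≤ 1 := hwn.trans ((div_le_one ht0).mpr ht2)
  have hE : (Epoly θ N b).eval ((t:ℂ)⁻¹) = ∑ m ∈ Finset.range (N+1), w ^ m / (m.factorial : ℂ) := by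
    rw [Epoly, Polynomial.eval_finset_sum]
    refine Finset.sum_congr rfl fun m _ => ?_
    rw [Polynomial.eval_mul, Polynomial.eval_pow, Polynomial.eval_mul]
    simp only [Polynomial.algebraMap_eq, Polynomial.eval_C, ← hw]
    rw [div_eq_mul_inv, mul_comm]
  rw [hE]
  refine (Complex.exp_bound hw1 (Nat.succ_pos N)).trans ?_
  rw [mul_div_right_comm, ← div_pow]
  refine mul_le_mul_of_nonneg_right ?_ (by positivity)
  exact pow_le_pow_left₀ (norm_nonneg _) hwn _

lemma polar_bound (θ : PS) (hθ : XX ∣ θ) (N : ℕ) (b : Bool) (A B : Polynomial ℂ)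
    (h : Polynomial.X ^ (N+1) ∣ A - B * Epoly θ N b) :
    ∃ C > (0:ℝ), ∃ T ≥ (1:ℝ), ∀ t : ℝ, T ≤ t →
      ‖A.eval ((t:ℂ)⁻¹) - B.eval ((t:ℂ)⁻¹) *
        Complex.exp (sg b * I * (tP (fun k => PowerSeries.coeff k θ) N).eval ((t:ℂ)⁻¹))‖
        ≤ C / t ^ (N+1) := by
  obtain ⟨C1, hC1, h1⟩ := poly_bound _ _ h
  obtain ⟨C2, hC2, h2⟩ := poly_bound B 0 (by simp)
  obtain ⟨C3, hC3, T, hT, h3⟩ := exp_approx θ hθ N b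
  refine ⟨C1 + C2 * C3, by positivity, T, hT, fun t ht => ?_⟩
  have ht1 : 1 ≤ t := hT.trans ht
  have k1 := h1 t ht1
  have k2 := h2 t ht1
  have k3 := h3 t ht
  rw [pow_zero, div_one] at k2
  rw [Polynomial.eval_sub, Polynomial.eval_mul] at k1
  generalize Complex.exp (sg b * I * (tP (fun k => PowerSeries.coeff k θ) N).eval ((t:ℂ)⁻¹)) = E at *
  generalize A.eval ((t:ℂ)⁻¹) = A' at *
  generalize B.eval ((t:ℂ)⁻¹) = B' at *
  generalize (Epoly θ N b).eval ((t:ℂ)⁻¹) = E' at *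
  have e : A' - B' * E = (A' - B' * E') - B' * (E - E') := by ring
  rw [e, add_div, mul_div_assoc]
  refine (norm_sub_le _ _).trans (add_le_add k1 ?_)
  rw [norm_mul]
  exact mul_le_mul k2 k3 (norm_nonneg _) hC2.le

lemma zq_Rmat (φ : ℂ) (v : C4) (b : Bool) :
    zq (ee φ) ((Rmat φ).mulVec v) b = v 0 + sg b * I * v 1 := by
  have h := Complex.cos_sq_add_sin_sq φ
  have hI := Complex.I_sq
  cases b
  · rw [zq, ee_false]
    simp [Rmat, Matrix.mulVec, dotProduct, Fin.sum_univ_four, sg]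
    linear_combination (v 0 - I * v 1) * h - (Complex.sin φ ^ 2 * v 0 + Complex.cos φ * Complex.sin φ * v 1) * hI
  · rw [zq, ee_true]
    simp [Rmat, Matrix.mulVec, dotProduct, Fin.sum_univ_four, sg]
    linear_combination (v 0 + I * v 1) * h - (Complex.sin φ ^ 2 * v 0 + Complex.cos φ * Complex.sin φ * v 1) * hI

lemma zp_Rmat (φ : ℂ) (v : C4) (b : Bool) :
    zp (ee φ) ((Rmat φ).mulVec v) b = v 2 + sg b * I * v 3 := by
  have h := Complex.cos_sq_add_sin_sq φ
  have hI := Complex.I_sq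
  cases b
  · rw [zp, ee_false]
    simp [Rmat, Matrix.mulVec, dotProduct, Fin.sum_univ_four, sg]
    linear_combination (v 2 - I * v 3) * h - (Complex.sin φ ^ 2 * v 2 + Complex.cos φ * Complex.sin φ * v 3) * hI
  · rw [zp, ee_true]
    simp [Rmat, Matrix.mulVec, dotProduct, Fin.sum_univ_four, sg]
    linear_combination (v 2 + I * v 3) * h - (Complex.sin φ ^ 2 * v 2 + Complex.cos φ * Complex.sin φ * v 3) * hI

lemma sSum_eq (r : PS) (N : ℕ) (t : ℂ) : sSum (fun k => PowerSeries.coeff k r) N t =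
    (tP (fun k => PowerSeries.coeff k r) N).eval t⁻¹ := by
  rw [sSum, eval_tP]
  refine Finset.sum_congr rfl fun k _ => ?_
  rw [_root_.zpow_neg, zpow_natCast, inv_pow]

lemma dsSum_eq (r : PS) (N : ℕ) (t : ℂ) : dsSum (fun k => PowerSeries.coeff k r) N t =
    (tD (fun k => PowerSeries.coeff k r) N).eval t⁻¹ := by
  rw [dsSum, eval_tD]
  refine Finset.sum_congr rfl fun k _ => ?_
  have : t ^ (-(k:ℤ) - 1) = t⁻¹ ^ (k+1) := by
    rw [inv_pow, ← zpow_natCast, ← _root_.zpow_neg]; congr 1; push_cast; ring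
  rw [this]

lemma exp_sg (b : Bool) (w : ℂ) : Complex.exp (sg b * I * w) = Complex.cos w + sg b * I * Complex.sin w := by
  cases b
  · have : sg false * I * w = (-w) * I := by simp [sg]; ring
    rw [this, Complex.exp_mul_I, Complex.cos_neg, Complex.sin_neg]; simp [sg]; ring
  · have : sg true * I * w = w * I := by simp [sg]; ring
    rw [this, Complex.exp_mul_I]; simp [sg]; ring

lemma zq_sub (e : Bool → ℂ) (z w : C4) (b : Bool) : zq e (fun i => z i - w i) b = zq e z b - zq e w b := by
  simp only [zq]; ring
lemma zp_sub (e : Bool → ℂ) (z w : C4) (b : Bool) : zp e (fun i => z i - w i) b = zp e z b - zp e w b := by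
  simp only [zp]; ring

lemma zq_diff (q p : Bool → PS) (r θ : PS) (N : ℕ) (φ t : ℂ) (b : Bool) :
    zq (ee φ) (fun i => pSumA (Gof q p) N φ t i - (Rmat φ).mulVec
      (xiApprox (fun k => PowerSeries.coeff k r) (fun k => PowerSeries.coeff k θ) N t) i) b =
    (tP (fun k => PowerSeries.coeff k (q b)) N).eval t⁻¹ -
      (-tD (fun k => PowerSeries.coeff k r) N).eval t⁻¹ *
        Complex.exp (sg b * I * (tP (fun k => PowerSeries.coeff k θ) N).eval t⁻¹) := by
  rw [zq_sub, zq_pSumA, uQ_Gof, zq_Rmat, exp_sg, xiApprox, sSum_eq, dsSum_eq, sSum_eq, Polynomial.eval_neg]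
  simp
  ring

lemma zp_diff (q p : Bool → PS) (r θ : PS) (N : ℕ) (φ t : ℂ) (b : Bool) :
    zp (ee φ) (fun i => pSumA (Gof q p) N φ t i - (Rmat φ).mulVec
      (xiApprox (fun k => PowerSeries.coeff k r) (fun k => PowerSeries.coeff k θ) N t) i) b =
    (tP (fun k => PowerSeries.coeff k (p b)) N).eval t⁻¹ -
      (tP (fun k => PowerSeries.coeff k r) N).eval t⁻¹ *
        Complex.exp (sg b * I * (tP (fun k => PowerSeries.coeff k θ) N).eval t⁻¹) := by
  rw [zp_sub, zp_pSumA, uP_Gof, zp_Rmat, exp_sg, xiApprox, sSum_eq, dsSum_eq, sSum_eq]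
  simp
  ring

lemma tp_dvd (f r θ : PS) (hθ : XX ∣ θ) (N : ℕ) (b : Bool) :
    Polynomial.X ^ (N+1) ∣ tP (fun k => PowerSeries.coeff k f) N -
      tP (fun k => PowerSeries.coeff k r) N * Epoly θ N b ↔ XX ^ (N+1) ∣ f - r * EE θ b := by
  rw [← toPS_dvd, map_sub, map_mul]
  have h1 := tP_congr f N
  have h2 := tP_congr r N
  have h3 := Epoly_congr θ hθ N b
  refine dvd_iff_dvd_of_dvd_sub ?_
  convert dvd_sub (dvd_sub h1 (Dvd.dvd.mul_right h2 (EE θ b)))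
    (Dvd.dvd.mul_left h3 (toPS (tP (fun k => PowerSeries.coeff k r) N))) using 1
  ring

lemma tq_dvd (f r θ : PS) (hθ : XX ∣ θ) (N : ℕ) (b : Bool) (h : XX ^ (N+1) ∣ f + Dx r * EE θ b) :
    Polynomial.X ^ (N+1) ∣ tP (fun k => PowerSeries.coeff k f) N -
      (-tD (fun k => PowerSeries.coeff k r) N) * Epoly θ N b := by
  rw [← toPS_dvd, map_sub, map_mul, map_neg]
  have h1 := tP_congr f N
  have h2 := tD_congr r N
  have h3 := Epoly_congr θ hθ N b
  convert dvd_add (dvd_add (dvd_add h1 (Dvd.dvd.mul_right h2 (EE θ b)))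
    (Dvd.dvd.mul_left h3 (toPS (tD (fun k => PowerSeries.coeff k r) N)))) h using 1
  ring

lemma polar_W (r θ : PS) (hθ : XX ∣ θ) :
    PolarForm (Gof (fun b => - (Dx r * EE θ b)) (fun b => r * EE θ b))
      (fun k => PowerSeries.coeff k r) (fun k => PowerSeries.coeff k θ) := by
  intro N
  have b1 := fun b => polar_bound θ hθ N b _ _ (tq_dvd (-(Dx r * EE θ b)) r θ hθ N b (by simp))
  have b2 := fun b => polar_bound θ hθ N b _ _ ((tp_dvd (r * EE θ b) r θ hθ N b).mpr (by simp))
  choose C1 hC1 T1 hT1 h1 using b1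
  choose C2 hC2 T2 hT2 h2 using b2
  have m1 : ∀ b, C1 b ≤ C1 true + C1 false + C2 true + C2 false := by
    intro b
    have := hC1 true; have := hC1 false; have := hC2 true; have := hC2 false
    cases b <;> linarith
  have m2 : ∀ b, C2 b ≤ C1 true + C1 false + C2 true + C2 false := by
    intro b
    have := hC1 true; have := hC1 false; have := hC2 true; have := hC2 false
    cases b <;> linarith
  have n1 : ∀ b, T1 b ≤ T1 true + T1 false + T2 true + T2 false := by
    intro b
    have := hT1 true; have := hT1 false; have := hT2 true; have := hT2 false
    cases b <;> linarith
  have n2 : ∀ b, T2 b ≤ T1 true + T1 false + T2 true + T2 false := by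
    intro b
    have := hT1 true; have := hT1 false; have := hT2 true; have := hT2 false
    cases b <;> linarith
  refine ⟨C1 true + C1 false + C2 true + C2 false, (hC1 true).trans_le (m1 true),
    T1 true + T1 false + T2 true + T2 false, ?_, fun φ t ht i => ?_⟩
  · have := n1 true; have := hT1 true; linarith
  have ht0 : 0 < t := by have := n1 true; have := hT1 true; linarith
  set R : C4 := fun i => pSumA (Gof (fun b => - (Dx r * EE θ b)) (fun b => r * EE θ b)) N φ t i -
    (Rmat φ).mulVec
      (xiApprox (fun k => PowerSeries.coeff k r) (fun k => PowerSeries.coeff k θ) N t) i with hR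
  change ‖R i‖ ≤ _
  rw [← rec4_z φ R]
  refine norm_rec4 φ _ _ _ (fun b => ?_) (fun b => ?_) i
  · rw [hR, zq_diff]
    refine (h1 b t ((n1 b).trans ht)).trans ?_
    have := m1 b
    gcongr
  · rw [hR, zp_diff]
    refine (h2 b t ((n2 b).trans ht)).trans ?_
    have := m2 b
    gcongr

lemma polar_inv (q p : Bool → PS) (r θ : PS) (hθ : XX ∣ θ)
    (H : PolarForm (Gof q p) (fun k => PowerSeries.coeff k r) (fun k => PowerSeries.coeff k θ)) (N : ℕ)
    (b : Bool) : XX ^ (N+1) ∣ p b - r * EE θ b := by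
  obtain ⟨C, hC, T, hT, h⟩ := H N
  obtain ⟨C', hC', T', hT', h'⟩ := polar_bound θ hθ N b
    (tP (fun k => PowerSeries.coeff k r) N * Epoly θ N b) (tP (fun k => PowerSeries.coeff k r) N) (by simp)
  rw [← tp_dvd (p b) r θ hθ N b]
  refine poly_dvd _ _ (2 * C + C') (max T T') fun t ht => ?_
  have k1 := norm_comb 0 b _ _ _ (h 0 t ((le_max_left _ _).trans ht) 2) (h 0 t ((le_max_left _ _).trans ht) 3)
  have k2 := h' t ((le_max_right _ _).trans ht)
  have e := zp_diff q p r θ N ((0:ℝ):ℂ) t b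
  rw [zp] at e
  rw [e] at k1
  rw [Polynomial.eval_mul] at k2
  rw [Polynomial.eval_sub, Polynomial.eval_mul, add_div, mul_div_assoc]
  have := norm_sub_le ((tP (fun k => PowerSeries.coeff k (p b)) N).eval (t:ℂ)⁻¹ -
      (tP (fun k => PowerSeries.coeff k r) N).eval (t:ℂ)⁻¹ *
        Complex.exp (sg b * I * (tP (fun k => PowerSeries.coeff k θ) N).eval (t:ℂ)⁻¹))
    ((tP (fun k => PowerSeries.coeff k r) N).eval (t:ℂ)⁻¹ * (Epoly θ N b).eval (t:ℂ)⁻¹ -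
      (tP (fun k => PowerSeries.coeff k r) N).eval (t:ℂ)⁻¹ *
        Complex.exp (sg b * I * (tP (fun k => PowerSeries.coeff k θ) N).eval (t:ℂ)⁻¹))
  rw [sub_sub_sub_cancel_right] at this
  linarith


lemma X_dvd_of_odd (f : PS) (h : ∀ k, Even k → PowerSeries.coeff k f = 0) : XX ∣ f := by
  rw [PowerSeries.X_dvd_iff, ← PowerSeries.coeff_zero_eq_constantCoeff_apply]
  exact h 0 (by simp)

lemma coeff_one_rE (r θ : PS) (hr : ∀ k, Even k → PowerSeries.coeff k r = 0) (hθ : XX ∣ θ) (b : Bool) :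
    PowerSeries.coeff 1 (r * EE θ b) = PowerSeries.coeff 1 r := by
  rw [PowerSeries.coeff_mul, Finset.Nat.sum_antidiagonal_eq_sum_range_succ_mk]
  simp [Finset.sum_range_succ, constCoeff_EE θ hθ, PowerSeries.X_dvd_iff.mp (X_dvd_of_odd r hr)]

lemma coeff_two_rE (r θ : PS) (hr : ∀ k, Even k → PowerSeries.coeff k r = 0) (hθ : XX ∣ θ) (b : Bool) :
    PowerSeries.coeff 2 (r * EE θ b) = PowerSeries.coeff 1 r * (sg b * I * PowerSeries.coeff 1 θ) := by
  rw [PowerSeries.coeff_mul, Finset.Nat.sum_antidiagonal_eq_sum_range_succ_mk]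
  simp [Finset.sum_range_succ, coeff_one_EE θ hθ, hr 2 (by decide),
    PowerSeries.X_dvd_iff.mp (X_dvd_of_odd r hr)]

lemma Gof_neg (q p : Bool → PS) (k : ℕ) (φ : ℂ) :
    Gof (fun b => algebraMap ℂ PS (-1) * q b) (fun b => algebraMap ℂ PS (-1) * p b) k φ =
      (Rmat ((Real.pi : ℝ) : ℂ)).mulVec (Gof q p k φ) := by
  have h : ∀ v : C4, (Rmat ((Real.pi : ℝ) : ℂ)).mulVec v = fun i => - v i := by
    intro v; funext i
    fin_cases i <;> simp [Rmat, Matrix.mulVec, dotProduct, Fin.sum_univ_four]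
  rw [h]
  apply z_ext φ
  · intro b
    rw [Gof, zq_rec4, coeff_alg_mul]
    conv_lhs => rw [← uQ_Gof q p φ]
    simp only [uQ, PowerSeries.coeff_mk, zq]; ring
  · intro b
    rw [Gof, zp_rec4, coeff_alg_mul]
    conv_lhs => rw [← uP_Gof q p φ]
    simp only [uP, PowerSeries.coeff_mk, zp]; ring

lemma Gof_zero (k : ℕ) (φ : ℂ) : Gof (fun _ => 0) (fun _ => 0) k φ = 0 := by
  apply z_ext φ
  · intro b; rw [Gof, zq_rec4]; simp [zq]
  · intro b; rw [Gof, zp_rec4]; simp [zp]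

lemma coeff_one_sh (τ : ℂ) (f : PS) (hf : XX ∣ f) :
    PowerSeries.coeff 1 (shPS τ f) = PowerSeries.coeff 1 f := by
  rw [coeff_shPS]; simp [Finset.sum_range_succ, PowerSeries.X_dvd_iff.mp hf]

lemma coeff_two_sh (τ : ℂ) (f : PS) (hf : XX ∣ f) :
    PowerSeries.coeff 2 (shPS τ f) = PowerSeries.coeff 2 f - τ * PowerSeries.coeff 1 f := by
  rw [coeff_shPS]; simp [Finset.sum_range_succ, PowerSeries.X_dvd_iff.mp hf]; ring

theorem statement11 (η : ℂ) (hη : η ≠ 0) (a : ℕ → ℕ → ℂ) :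
    ∃ (κ : ℂ) (rs θs : ℕ → ℂ) (G : ℕ → ℂ → C4),
      κ ^ 2 = -2 / η ∧
      (∀ k, Even k → rs k = 0 ∧ θs k = 0) ∧ rs 1 = κ ∧ θs 1 = -(a 1 1) / η ∧
      IsFormalSolNF η a G ∧ (∃ k φ, G k φ ≠ 0) ∧ PolarForm G rs θs ∧
      (∀ G' : ℕ → ℂ → C4, NFSolBundle η a G' →
        (∀ k φ, G' k φ = G k φ) ∨
        (∀ k φ, G' k φ = (Rmat ((Real.pi : ℝ) : ℂ)).mulVec (G k φ))) ∧
      (∀ Y : ℕ → ℂ → C4, IsFormalSolNF η a Y → (∃ k φ, Y k φ ≠ 0) →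
        ∃ φ₀ τ₀ : ℂ, ∀ k φ, Y k φ = shiftC G φ₀ τ₀ k φ) := by
  obtain ⟨κ, hκ⟩ := IsAlgClosed.exists_pow_nat_eq (-2 / η) (n := 2) (by norm_num)
  have hκ' : η * κ ^ 2 = -2 := by rw [hκ]; field_simp
  have hκ0 : κ ≠ 0 := by rintro rfl; norm_num at hκ'
  obtain ⟨r, hr, hr1, hrE⟩ := exists_r η κ hκ' a
  obtain ⟨θ, hθo, hθ1, hθE⟩ := exists_θ η κ hη hκ' a r hr hr1
  have hθ := X_dvd_of_odd θ hθo
  have hrX := X_dvd_of_odd r hr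
  have HW := FE_polar η a r θ hθ hrE hθE
  set q : Bool → PS := fun b => - (Dx r * EE θ b) with hq
  set p : Bool → PS := fun b => r * EE θ b with hp
  have hqX : ∀ b, XX ∣ q b := fun b => by
    have : XX ∣ Dx r := by simpa using dvd_Dx r 0 (by simp)
    exact dvd_neg.mpr (Dvd.dvd.mul_right this _)
  have hpX : ∀ b, XX ∣ p b := fun b => Dvd.dvd.mul_right hrX _
  have p1 : ∀ b, PowerSeries.coeff 1 (p b) = κ := fun b => by
    rw [hp]; exact (coeff_one_rE r θ hr hθ b).trans hr1
  have p2 : ∀ b, PowerSeries.coeff 2 (p b) = κ * (sg b * I * (-(a 1 1) / η)) := fun b => by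
    rw [hp]; exact (coeff_two_rE r θ hr hθ b).trans (by rw [hr1, hθ1])
  have hne : Gof q p 1 0 ≠ 0 := by
    intro h
    have h2 := zp_rec4 0 (fun b => PowerSeries.coeff 1 (q b)) (fun b => PowerSeries.coeff 1 (p b)) true
    have h3 : rec4 0 (fun b => PowerSeries.coeff 1 (q b)) (fun b => PowerSeries.coeff 1 (p b)) = 0 := h
    rw [h3, p1] at h2
    apply hκ0
    rw [← h2]; simp [zp]
  refine ⟨κ, fun k => PowerSeries.coeff k r, fun k => PowerSeries.coeff k θ, Gof q p, hκ,
    fun k hk => ⟨hr k hk, hθo k hk⟩, hr1, hθ1, sol_of_FE η a q p hqX hpX HW, ⟨1, 0, hne⟩,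
    polar_W r θ hθ, ?_, ?_⟩
  · rintro G' ⟨κ', rs, θs, hk', hev, hrs1, hθs1, hsol, -, hpol⟩
    obtain ⟨q', p', rfl, hq', hp', H'⟩ := FE_of_sol η a G' hsol
    have hr'o : ∀ k, Even k → PowerSeries.coeff k (PowerSeries.mk rs) = 0 := fun k hk => by
      rw [PowerSeries.coeff_mk]; exact (hev k hk).1
    have hθ'o : ∀ k, Even k → PowerSeries.coeff k (PowerSeries.mk θs) = 0 := fun k hk => by
      rw [PowerSeries.coeff_mk]; exact (hev k hk).2
    have hθ' := X_dvd_of_odd _ hθ'o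
    have hpol' : PolarForm (Gof q' p') (fun k => PowerSeries.coeff k (PowerSeries.mk rs))
        (fun k => PowerSeries.coeff k (PowerSeries.mk θs)) := by
      simpa only [PowerSeries.coeff_mk] using hpol
    have hinv := polar_inv q' p' _ _ hθ' hpol' 2
    have p1' : ∀ b, PowerSeries.coeff 1 (p' b) = κ' := fun b => by
      rw [coeff_eq_of_dvd (hinv b) (by norm_num), coeff_one_rE _ _ hr'o hθ' b, PowerSeries.coeff_mk, hrs1]
    have p2' : ∀ b, PowerSeries.coeff 2 (p' b) = κ' * (sg b * I * (-(a 1 1) / η)) := fun b => by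
      rw [coeff_eq_of_dvd (hinv b) (by norm_num), coeff_two_rE _ _ hr'o hθ' b, PowerSeries.coeff_mk,
        PowerSeries.coeff_mk, hrs1, hθs1]
    have hkk : κ' ^ 2 = κ ^ 2 := by rw [hk', hκ]
    rcases sq_eq_sq_iff_eq_or_eq_neg.mp hkk with rfl | rfl
    · left
      have := unique_sol η a q' p' q p hq' hp' hqX hpX H' HW (fun b => by rw [p1', p1])
        (Or.inr ⟨fun b => by rw [p1']; exact hκ0, by simp only [p2', p2]⟩)
      rw [this.1, this.2]; intros; rfl
    · right
      have HN := FE_rot η a (fun _ => -1) (by norm_num) q p HW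
      have := unique_sol η a q' p' _ _ hq' hp' (fun b => Dvd.dvd.mul_left (hqX b) _)
        (fun b => Dvd.dvd.mul_left (hpX b) _) H' HN
        (fun b => by rw [p1', coeff_alg_mul, p1]; ring)
        (Or.inr ⟨fun b => by rw [p1']; exact neg_ne_zero.mpr hκ0, by
          simp only [p2', coeff_alg_mul, p2]; ring⟩)
      intro k φ
      rw [this.1, this.2, Gof_neg]
  · rintro Y hY ⟨k₀, φ', hY0⟩
    obtain ⟨q', p', rfl, hq', hp', H'⟩ := FE_of_sol η a Y hY
    have hi := fun b => (init_p η a q' p' hq' hp' H' b).2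
    have hnz : ∀ b, PowerSeries.coeff 1 (p' b) ≠ 0 := by
      by_contra hc
      push Not at hc
      obtain ⟨b₀, hb₀⟩ := hc
      have hz : PowerSeries.coeff 1 (p' true) * PowerSeries.coeff 1 (p' false) = 0 := by
        cases b₀ <;> simp [hb₀]
      have hall : ∀ b, PowerSeries.coeff 1 (p' b) = 0 := by
        intro b
        have := hi b
        rw [hz] at this
        simpa using this
      have := unique_sol η a q' p' (fun _ => 0) (fun _ => 0) hq' hp' (by simp) (by simp) H'
        (fun N => ⟨0, fun n _ => FE_zero η a n N⟩) (fun b => by rw [hall b]; simp) (Or.inl hall)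
      apply hY0
      rw [this.1, this.2, Gof_zero]
    set P := PowerSeries.coeff 1 (p' true) with hP
    set F := PowerSeries.coeff 1 (p' false) with hF
    have hPn : P ≠ 0 := hnz true
    have hFn : F ≠ 0 := hnz false
    have hPF : P * F = κ ^ 2 := by
      have := hi true
      rw [← hP] at this
      have h2 : η * (P * F) = -2 := by
        apply mul_right_cancel₀ hPn
        linear_combination -this
      rw [hκ]; field_simp; linear_combination h2
    set φ₀ : ℂ := Complex.log (P / κ) / I with hφ₀
    set τ₀ : ℂ := -(PowerSeries.coeff 2 (p' true) / P + PowerSeries.coeff 2 (p' false) / F) / 2 with hτ₀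
    have eF : ee φ₀ false = P / κ := by
      have : -(sg false * I * φ₀) = Complex.log (P / κ) := by
        have hs : sg false = -1 := by simp [sg]
        have hII : I * I⁻¹ = 1 := mul_inv_cancel₀ I_ne_zero
        rw [hφ₀, hs, div_eq_mul_inv]
        linear_combination Complex.log (P / κ) * hII
      rw [ee, this, Complex.exp_log (div_ne_zero hPn hκ0)]
    have eT : ee φ₀ true = F / κ := by
      have h := ee_mul φ₀
      rw [eF] at h
      have h2 : ee φ₀ true = κ / P := by
        field_simp at h ⊢
        linear_combination h
      rw [h2]; field_simp; linear_combination -hPF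
    have HS := FE_rot η a (fun b => ee φ₀ (!b)) (by
      simp only [Bool.not_true, Bool.not_false]; rw [mul_comm]; exact ee_mul φ₀) _ _ (FE_shift η a τ₀ q p HW)
    have sX : ∀ f : PS, XX ∣ f → XX ∣ shPS τ₀ f := fun f hf => by
      simpa using shPS_dvd τ₀ f 1 (by simpa using hf)
    have := unique_sol η a q' p' _ _ hq' hp' (fun b => Dvd.dvd.mul_left (sX _ (hqX b)) _)
        (fun b => Dvd.dvd.mul_left (sX _ (hpX b)) _) H' HS
        (fun b => by
          rw [coeff_alg_mul, coeff_one_sh _ _ (hpX b), p1]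
          cases b
          · simp only [Bool.not_false, eT]; rw [div_mul_cancel₀ _ hκ0]
          · simp only [Bool.not_true, eF]; rw [div_mul_cancel₀ _ hκ0])
        (Or.inr ⟨hnz, by
          simp only [coeff_alg_mul, coeff_two_sh _ _ (hpX _), p1, p2, Bool.not_false, Bool.not_true, eT, eF]
          rw [← hP, ← hF, hτ₀]
          simp only [sg, if_true, Bool.false_eq_true, if_false]
          field_simp
          ring⟩)
    refine ⟨φ₀, τ₀, fun k φ => ?_⟩
    rw [shiftC_Gof]
    rw [← this.1, ← this.2]
end
end

section
/- Let η ∈ ℂ, η ≠ 0, and a_{0,j} ∈ ℂ for j ≥ 3 be given. The formal differential equation ∂²_τ r = −η r³ − Σ_{j≥2} (2(j+1) a_{0,j+1}/2^{j+1}) r^{2j+1} has a nonzero formal solution r ∈ τ⁻¹ℂ[[τ⁻¹]] containing only odd powers of τ⁻¹, with r(τ) = κτ⁻¹ − (1/8) a_{0,3} κ⁵ τ⁻³ + O(τ⁻⁵), where κ² = −2/η; this solution is unique once one of the two values of κ is fixed. Moreover, any other nonzero formal solution r̃ ∈ τ⁻¹ℂ[[τ⁻¹]] satisfies r̃(τ)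 = ± r(τ+τ₀) for some τ₀ ∈ ℂ. -/
noncomputable section

/-! Formal power series in `τ⁻¹` represented by their coefficient sequences:
`c : ℕ → ℂ` stands for `Σ_k c k · τ^{-k}`. -/

/-- Cauchy product of formal series in `τ⁻¹`. -/
def fpsMul (a b : ℕ → ℂ) : ℕ → ℂ := fun k => ∑ j ∈ Finset.range (k+1), a j * b (k-j)

/-- powers of a formal series in `τ⁻¹`. -/
def fpsPow (a : ℕ → ℂ) : ℕ → ℕ → ℂ
  | 0 => fun k => if k = 0 then 1 else 0
  | n+1 => fpsMul a (fpsPow a n)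

/-- formal `τ`-derivative: `τ^{-m} ↦ -m τ^{-m-1}`. -/
def fpsD (a : ℕ → ℂ) : ℕ → ℂ := fun k => if k = 0 then 0 else (-(k:ℂ) + 1) * a (k-1)

/-- `r` formally solves `∂²_τ r = -η r³ - Σ_{j≥2} (2(j+1) a_{j+1}/2^{j+1}) r^{2j+1}`;
since `r` has no constant term, the coefficient of `τ^{-k}` of `r^{2j+1}` vanishes
for `j > k`, so the truncated sum below computes the full formal right-hand side. -/
def SolODE (η : ℂ) (a : ℕ → ℂ) (r : ℕ → ℂ) : Prop :=
  ∀ k : ℕ, fpsD (fpsD r) k =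
    -η * fpsPow r 3 k -
      ∑ j ∈ Finset.Icc 2 k, (2 * ((j:ℂ)+1) * a (j+1) / 2 ^ (j+1)) * fpsPow r (2*j+1) k

/-- coefficients of the translated series `r(τ + τ₀)`, re-expanded by the
binomial series. -/
def shiftS (c : ℕ → ℂ) (τ₀ : ℂ) : ℕ → ℂ :=
  fun k => ∑ j ∈ Finset.range (k+1),
    ((-1:ℂ) ^ (k-j) * ((k-1).choose (k-j) : ℂ) * τ₀ ^ (k-j)) * c j

open PowerSeries in
/-- the derivation `∂_τ` on power series in `X = τ⁻¹`. -/
def psD (f : PowerSeries ℂ) : PowerSeries ℂ := -(X ^ 2 * derivative ℂ f)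

/-- truncated ODE residual. -/
def psP (η : ℂ) (a : ℕ → ℂ) (N : ℕ) (f : PowerSeries ℂ) : PowerSeries ℂ :=
  psD (psD f) + η • f ^ 3 +
    ∑ j ∈ Finset.Icc 2 N, (2 * ((j:ℂ)+1) * a (j+1) / 2 ^ (j+1)) • f ^ (2*j+1)

namespace S12
open PowerSeries

lemma coeff_psD (f : PowerSeries ℂ) (k : ℕ) :
    coeff k (psD f) = if k = 0 then 0 else (-(k:ℂ) + 1) * coeff (k-1) f := by
  unfold psD
  rw [map_neg, coeff_X_pow_mul']
  rcases k with _ | _ | k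
  · simp
  · simp
  · simp [coeff_derivative]
    ring

lemma fpsD_mk (r : ℕ → ℂ) : PowerSeries.mk (fpsD r) = psD (PowerSeries.mk r) := by
  ext k
  rw [coeff_psD]
  simp [fpsD]

lemma fpsMul_mk (r s : ℕ → ℂ) :
    PowerSeries.mk (fpsMul r s) = PowerSeries.mk r * PowerSeries.mk s := by
  ext k
  rw [coeff_mul, Finset.Nat.sum_antidiagonal_eq_sum_range_succ_mk]
  simp [fpsMul]

lemma fpsPow_mk (r : ℕ → ℂ) (n : ℕ) :
    PowerSeries.mk (fpsPow r n) = PowerSeries.mk r ^ n := by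
  induction n with
  | zero => ext k; simp [fpsPow, coeff_one]
  | succ n ih => rw [fpsPow, fpsMul_mk, ih, pow_succ']

lemma fpsPow_coeff (r : ℕ → ℂ) (n k : ℕ) :
    fpsPow r n k = coeff k (PowerSeries.mk r ^ n) := by
  rw [← fpsPow_mk]; simp

lemma coeff_psDD (f : PowerSeries ℂ) (m : ℕ) :
    coeff (m+2) (psD (psD f)) = ((m:ℂ)+1) * m * coeff m f := by
  rw [coeff_psD, coeff_psD]
  simp
  ring_nf

lemma coeff_psP (η : ℂ) (a : ℕ → ℂ) (N k : ℕ) (f : PowerSeries ℂ) :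
    coeff k (psP η a N f) = coeff k (psD (psD f)) + η * coeff k (f ^ 3) +
    ∑ j ∈ Finset.Icc 2 N, (2 * ((j:ℂ)+1) * a (j+1) / 2 ^ (j+1)) * coeff k (f ^ (2*j+1)) := by
  simp [psP]

lemma sol_iff (η : ℂ) (a : ℕ → ℂ) (r : ℕ → ℂ) :
    SolODE η a r ↔ ∀ k, coeff k (psP η a k (PowerSeries.mk r)) = 0 := by
  unfold SolODE
  refine forall_congr' fun k => ?_
  rw [coeff_psP, ← fpsD_mk, ← fpsD_mk, coeff_mk]
  simp only [fpsPow_coeff]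
  constructor <;> intro h <;> linear_combination h

lemma coeff_pow_lt {f : PowerSeries ℂ} {m : ℕ} (h : X ^ m ∣ f) {n k : ℕ} (hk : k < m * n) :
    coeff k (f ^ n) = 0 := by
  have : (X : PowerSeries ℂ) ^ (m * n) ∣ f ^ n := by
    rw [pow_mul]; exact pow_dvd_pow_of_dvd h n
  exact X_pow_dvd_iff.1 this k hk

lemma coeff_pow_self {f : PowerSeries ℂ} (h : coeff 0 f = 0) (n : ℕ) :
    coeff n (f ^ n) = coeff 1 f ^ n := by
  obtain ⟨g, rfl⟩ := (X_dvd_iff (φ := f)).2 (by simpa using h)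
  have h1 := coeff_X_pow_mul (g ^ n) n 0
  rw [zero_add] at h1
  rw [mul_pow, h1]
  have h2 := coeff_X_pow_mul g 1 0
  rw [zero_add, pow_one] at h2
  rw [h2]
  simp

lemma X_dvd' {f : PowerSeries ℂ} (h : coeff 0 f = 0) : (X : PowerSeries ℂ) ^ 1 ∣ f := by
  rw [pow_one, X_dvd_iff]; simpa using h

lemma coeff_psP_trunc {η : ℂ} {a : ℕ → ℂ} {N k : ℕ} {f : PowerSeries ℂ} (h0 : coeff 0 f = 0)
    (hk : k ≤ N) : coeff k (psP η a N f) = coeff k (psP η a k f) := by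
  rw [coeff_psP, coeff_psP]
  congr 1
  symm
  apply Finset.sum_subset
  · intro j; simp only [Finset.mem_Icc]; omega
  · intro j hj hj'
    rw [coeff_pow_lt (X_dvd' h0), mul_zero]
    simp only [Finset.mem_Icc] at hj hj'
    omega

lemma coeff_psP_low {η : ℂ} {a : ℕ → ℂ} {N k : ℕ} {f : PowerSeries ℂ} (h0 : coeff 0 f = 0)
    (hk : k < 3) : coeff k (psP η a N f) = 0 := by
  rw [coeff_psP, coeff_pow_lt (X_dvd' h0) (by omega), Finset.sum_eq_zero]
  · interval_cases k
    · simp [coeff_psD]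
    · simp [coeff_psD]
    · have := coeff_psDD f 0
      simp at this
      simp [this]
  · intro j hj
    simp only [Finset.mem_Icc] at hj
    rw [coeff_pow_lt (X_dvd' h0) (by omega), mul_zero]

/-- coefficient three of the residual -/
lemma coeff_psP_three {η : ℂ} {a : ℕ → ℂ} {N : ℕ} {f : PowerSeries ℂ} (h0 : coeff 0 f = 0) :
    coeff 3 (psP η a N f) = 2 * coeff 1 f + η * coeff 1 f ^ 3 := by
  rw [coeff_psP, coeff_pow_self h0, Finset.sum_eq_zero]
  · rw [coeff_psDD f 1]; push_cast; ring
  · intro j hj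
    simp only [Finset.mem_Icc] at hj
    rw [coeff_pow_lt (X_dvd' h0) (by omega), mul_zero]

/-- perturbation of powers -/
lemma coeff_pow_diff {f g : PowerSeries ℂ} (hf : coeff 0 f = 0) (hg : coeff 0 g = 0)
    {m n k : ℕ} (h : X ^ m ∣ f - g) (hk : k < m + n) :
    coeff k (f ^ (n+1)) = coeff k (g ^ (n+1)) := by
  have h1 : (X : PowerSeries ℂ) ^ (m + n) ∣ f ^ (n+1) - g ^ (n+1) := by
    rw [← Commute.mul_geom_sum₂ (Commute.all f g), pow_add]
    apply mul_dvd_mul h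
    apply Finset.dvd_sum
    intro i hi
    have hi : i ≤ n := by simpa [Nat.lt_succ_iff] using hi
    have h2 : (X : PowerSeries ℂ) ^ n = X ^ i * X ^ (n + 1 - 1 - i) := by
      rw [← pow_add]; congr 1; omega
    rw [h2]
    apply mul_dvd_mul
    · apply pow_dvd_pow_of_dvd; simpa using X_dvd' hf
    · apply pow_dvd_pow_of_dvd; simpa using X_dvd' hg
  have := X_pow_dvd_iff.1 h1 k hk
  rw [map_sub] at this
  exact sub_eq_zero.1 this

lemma coeff_cube_diff {f g : PowerSeries ℂ} (hf : coeff 0 f = 0) (hg : coeff 0 g = 0)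
    {κ : ℂ} (hf1 : coeff 1 f = κ) (hg1 : coeff 1 g = κ)
    {m : ℕ} (h : X ^ m ∣ f - g) :
    coeff (m+2) (f ^ 3) - coeff (m+2) (g ^ 3) = 3 * κ ^ 2 * (coeff m f - coeff m g) := by
  obtain ⟨u, hu⟩ := h
  obtain ⟨p, rfl⟩ := X_dvd' hf
  obtain ⟨q, rfl⟩ := X_dvd' hg
  have e1 := coeff_X_pow_mul p 1 0
  have e2 := coeff_X_pow_mul q 1 0
  rw [zero_add] at e1 e2
  rw [e1] at hf1
  rw [e2] at hg1
  rw [← map_sub, ← map_sub, hu]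
  have : (X ^ 1 * p) ^ 3 - (X ^ 1 * q) ^ 3 = X ^ (m+2) * (u * (p ^ 2 + p * q + q ^ 2)) := by
    rw [pow_add]; linear_combination (X^2 * (p ^ 2 + p * q + q ^ 2)) * hu
  rw [this]
  have e3 := coeff_X_pow_mul u m 0
  have e4 := coeff_X_pow_mul (u * (p ^ 2 + p * q + q ^ 2)) (m+2) 0
  rw [zero_add] at e3 e4
  rw [e3, e4]
  simp at hf1 hg1
  simp [hf1, hg1]
  ring

lemma psP_diff {η : ℂ} {a : ℕ → ℂ} {N : ℕ} {f g : PowerSeries ℂ}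
    (hf : coeff 0 f = 0) (hg : coeff 0 g = 0)
    {κ : ℂ} (hf1 : coeff 1 f = κ) (hg1 : coeff 1 g = κ)
    {m : ℕ} (h : X ^ m ∣ f - g) :
    coeff (m+2) (psP η a N f) - coeff (m+2) (psP η a N g) =
      (((m:ℂ)+1) * m + 3 * η * κ ^ 2) * (coeff m f - coeff m g) := by
  have hs : ∑ j ∈ Finset.Icc 2 N, (2 * ((j:ℂ)+1) * a (j+1) / 2 ^ (j+1)) *
        coeff (m+2) (f ^ (2*j+1)) =
      ∑ j ∈ Finset.Icc 2 N, (2 * ((j:ℂ)+1) * a (j+1) / 2 ^ (j+1)) *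
        coeff (m+2) (g ^ (2*j+1)) := by
    apply Finset.sum_congr rfl
    intro j hj
    simp only [Finset.mem_Icc] at hj
    rw [coeff_pow_diff hf hg h (by omega)]
  rw [coeff_psP, coeff_psP, hs, coeff_psDD, coeff_psDD]
  linear_combination η * coeff_cube_diff hf hg hf1 hg1 h

lemma res_ne {η κ : ℂ} (hη : η ≠ 0) (hκ : κ ^ 2 = -2 / η) {m : ℕ} (hm : 3 ≤ m) :
    ((m:ℂ)+1) * m + 3 * η * κ ^ 2 ≠ 0 := by
  have : ((m:ℂ)+1) * m + 3 * η * κ ^ 2 = ((m:ℂ) + 3) * ((m:ℂ) - 2) := by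
    rw [hκ]; field_simp; ring
  rw [this]
  obtain ⟨l, rfl⟩ := Nat.exists_eq_add_of_le hm
  push_cast
  have h1 : ((3:ℂ) + l + 3) ≠ 0 := by norm_cast
  have h2 : ((3:ℂ) + l - 2) ≠ 0 := by
    have : ((3:ℂ) + l - 2) = ((1 + l : ℕ) : ℂ) := by push_cast; ring
    rw [this]; norm_cast; omega
  exact mul_ne_zero h1 h2

lemma sol_unique {η κ : ℂ} (hη : η ≠ 0) (hκ : κ ^ 2 = -2 / η) {a : ℕ → ℂ} {r s : ℕ → ℂ}
    (hr : SolODE η a r) (hs : SolODE η a s) (hr0 : r 0 = 0) (hs0 : s 0 = 0)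
    (hr1 : r 1 = κ) (hs1 : s 1 = κ) (h2 : r 2 = s 2) : r = s := by
  rw [sol_iff] at hr hs
  funext m
  induction m using Nat.strong_induction_on with
  | _ m ih =>
    rcases Nat.lt_or_ge m 3 with h | h
    · interval_cases m
      · rw [hr0, hs0]
      · rw [hr1, hs1]
      · exact h2
    · have hd : (X : PowerSeries ℂ) ^ m ∣ PowerSeries.mk r - PowerSeries.mk s := by
        rw [X_pow_dvd_iff]
        intro i hi
        simp [ih i hi]
      have := psP_diff (η := η) (a := a) (N := m+2) (κ := κ) (by simpa using hr0)
        (by simpa using hs0) (by simpa using hr1) (by simpa using hs1) hd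
      rw [hr, hs, sub_zero, zero_eq_mul] at this
      have := this.resolve_left (res_ne hη hκ h)
      simp at this
      exact sub_eq_zero.1 this

/-- recursive construction of the odd solution -/
def rec0 (η : ℂ) (a : ℕ → ℂ) (κ : ℂ) (k : ℕ) : ℂ :=
  if k = 0 then 0 else if k = 1 then κ else
    -(coeff (k+2) (psP η a (k+2)
      (PowerSeries.mk (fun i => if _h : i < k then rec0 η a κ i else 0)))) /
      (((k:ℂ)+1) * k + 3 * η * κ ^ 2)
termination_by k

lemma rec0_zero (η : ℂ) (a : ℕ → ℂ) (κ : ℂ) : rec0 η a κ 0 = 0 := by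
  rw [rec0]; simp

lemma rec0_one (η : ℂ) (a : ℕ → ℂ) (κ : ℂ) : rec0 η a κ 1 = κ := by
  rw [rec0]; simp

lemma rec0_two {η : ℂ} (hη : η ≠ 0) (a : ℕ → ℂ) {κ : ℂ} (hκ : κ ^ 2 = -2 / η) :
    rec0 η a κ 2 = 0 := by
  rw [rec0]
  have : (((2:ℕ):ℂ)+1) * (2:ℕ) + 3 * η * κ ^ 2 = 0 := by
    rw [hκ]; field_simp; norm_num
  rw [this]; simp

lemma rec0_sol {η : ℂ} (hη : η ≠ 0) (a : ℕ → ℂ) {κ : ℂ} (hκ : κ ^ 2 = -2 / η) :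
    SolODE η a (rec0 η a κ) := by
  rw [sol_iff]
  intro k
  have h0 : coeff 0 (PowerSeries.mk (rec0 η a κ)) = 0 := by simpa using rec0_zero η a κ
  have h1 : coeff 1 (PowerSeries.mk (rec0 η a κ)) = κ := by simpa using rec0_one η a κ
  rcases Nat.lt_or_ge k 3 with h | h
  · exact coeff_psP_low h0 h
  obtain rfl | h := eq_or_lt_of_le h
  · rw [coeff_psP_three h0, h1]
    have : κ ^ 3 = κ * κ ^ 2 := by ring
    rw [this, hκ]; field_simp; ring
  obtain ⟨m, rfl⟩ : ∃ m, k = m + 2 := ⟨k - 2, by omega⟩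
  have hm : 2 ≤ m := by omega
  set g : PowerSeries ℂ :=
    PowerSeries.mk (fun i => if _h : i < m then rec0 η a κ i else 0) with hgdef
  have hg0 : coeff 0 g = 0 := by simp [hgdef, rec0_zero]
  have hg1 : coeff 1 g = κ := by
    simp only [hgdef, coeff_mk, rec0_one]; rw [dif_pos (by omega)]
  have hd : (X : PowerSeries ℂ) ^ m ∣ PowerSeries.mk (rec0 η a κ) - g := by
    rw [X_pow_dvd_iff]
    intro i hi
    simp [hgdef, hi]
  have key := psP_diff (η := η) (a := a) (N := m+2) h0 hg0 h1 hg1 hd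
  have hgm : coeff m g = 0 := by simp [hgdef]
  rw [hgm, sub_zero, coeff_mk] at key
  obtain rfl | hm := eq_or_lt_of_le hm
  · rw [rec0_two hη a hκ, mul_zero] at key
    have hgX : g = κ • X := by
      ext i
      simp only [hgdef, coeff_mk, map_smul, coeff_X]
      rcases Nat.lt_or_ge i 2 with h | h
      · interval_cases i
        · simp [rec0_zero]
        · simp [rec0_one]
      · rw [dif_neg (by omega), if_neg (by omega)]; simp
    have : coeff (2+2) (psP η a (2+2) g) = 0 := by
      rw [coeff_psP, coeff_psDD, hgm, hgX, Finset.sum_eq_zero]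
      · simp [smul_pow, coeff_X_pow]
      · intro j hj
        simp only [Finset.mem_Icc] at hj
        rw [smul_pow, map_smul, coeff_X_pow, if_neg (by omega)]; simp
    rw [this, sub_zero] at key
    exact key
  · have h2 : rec0 η a κ m = -(coeff (m+2) (psP η a (m+2) g)) /
      (((m:ℂ)+1) * m + 3 * η * κ ^ 2) := by
      rw [rec0, if_neg (by omega), if_neg (by omega)]
    rw [h2, mul_div_cancel₀ _ (res_ne hη hκ hm)] at key
    linear_combination key

/-- residuals of solutions vanish to high order -/
lemma sol_dvd {η : ℂ} {a r : ℕ → ℂ} (h0 : r 0 = 0) :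
    SolODE η a r ↔ ∀ N, X ^ (N+1) ∣ psP η a N (PowerSeries.mk r) := by
  rw [sol_iff]
  constructor
  · intro h N
    rw [X_pow_dvd_iff]
    intro k hk
    rw [coeff_psP_trunc (by simpa using h0) (by omega)]
    exact h k
  · intro h k
    exact X_pow_dvd_iff.1 (h k) k (by omega)

lemma sol_map {η : ℂ} {a r s : ℕ → ℂ} (h0 : r 0 = 0) (hs0 : s 0 = 0)
    (S : PowerSeries ℂ →ₐ[ℂ] PowerSeries ℂ)
    (hX : X ∣ S X) (hD : ∀ f, S (psD (psD f)) = psD (psD (S f)))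
    (hs : PowerSeries.mk s = S (PowerSeries.mk r)) (h : SolODE η a r) : SolODE η a s := by
  rw [sol_dvd h0] at h
  rw [sol_dvd hs0]
  intro N
  have : psP η a N (PowerSeries.mk s) = S (psP η a N (PowerSeries.mk r)) := by
    simp only [psP, hs, map_add, map_smul, map_pow, map_sum, hD]
  rw [this]
  refine dvd_trans ?_ (map_dvd S (h N))
  rw [map_pow]
  exact pow_dvd_pow_of_dvd hX _

lemma sol_neg {η : ℂ} {a r : ℕ → ℂ} (h : SolODE η a r) : SolODE η a (fun k => - r k) := by
  rw [sol_iff] at *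
  intro k
  have e : PowerSeries.mk (fun k => - r k) = - PowerSeries.mk r := by ext; simp
  have : psP η a k (-PowerSeries.mk r) = - psP η a k (PowerSeries.mk r) := by
    have hd : ∀ f, psD (-f) = - psD f := by intro f; simp [psD]
    have h3 : ∀ j : ℕ, (-PowerSeries.mk r) ^ (2*j+1) = - (PowerSeries.mk r) ^ (2*j+1) :=
      fun j => Odd.neg_pow ⟨j, rfl⟩ _
    simp only [psP, hd, h3, smul_neg, Finset.sum_neg_distrib]
    rw [show (3:ℕ) = 2 * 1 + 1 from rfl, h3, smul_neg]
    ring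
  rw [e, this, map_neg, h k, neg_zero]

lemma rescale_app (c : ℂ) (f : PowerSeries ℂ) : rescaleAlgHom c f = rescale c f := by
  rw [← coe_rescaleAlgHom]; rfl

/-- reflection `τ ↦ -τ` -/
lemma sol_refl {η : ℂ} {a r : ℕ → ℂ} (h0 : r 0 = 0) (h : SolODE η a r) :
    SolODE η a (fun k => (-1) ^ k * r k) := by
  refine sol_map h0 (by simp [h0]) (rescaleAlgHom (-1 : ℂ)) ?_ ?_ ?_ h
  · rw [X_dvd_iff]
    simp [rescale_app, rescale_X]
  · intro f
    ext k
    simp only [rescale_app, coeff_rescale, coeff_psD]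
    rcases k with _ | _ | k
    · simp
    · simp
    · simp; ring
  · ext k; simp [rescale_app, coeff_rescale]

/-- the substituted series `X / (1 + t X)`. -/
def gsub (t : ℂ) : PowerSeries ℂ := X * PowerSeries.mk (fun n => (-t) ^ n)

lemma gsub_mul (t : ℂ) : gsub t * (1 + C t * X) = X := by
  have : PowerSeries.mk (fun n => (-t) ^ n) * (1 + C t * X) = 1 := by
    ext n
    rw [mul_add, mul_one, ← mul_assoc, mul_comm _ (C t), map_add, coeff_one]
    rcases n with _ | n
    · simp
    · rw [coeff_succ_mul_X, coeff_C_mul]; simp; ring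
  rw [gsub, mul_assoc, this, mul_one]

lemma gsub_hasSubst (t : ℂ) : HasSubst (gsub t) :=
  HasSubst.of_constantCoeff_zero' (by simp [gsub])

lemma gsub_deriv (t : ℂ) : X ^ 2 * derivative ℂ (gsub t) = gsub t ^ 2 := by
  have h := gsub_mul t
  have h2 := congrArg (derivative ℂ) h
  have hC : derivative ℂ (C t : PowerSeries ℂ) = 0 := derivative_C ..
  simp only [Derivation.leibniz, map_add, hC, derivative_X, smul_eq_mul,
    Derivation.map_one_eq_zero] at h2
  generalize derivative ℂ (gsub t) = g' at *
  generalize gsub t = g at *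
  have h3 : g' * (1 + C t * X) ^ 2 = 1 := by
    linear_combination (1 + C t * X) * h2 - C t * h
  linear_combination (-(X + g * (1 + C t * X)) * g') * h + g ^ 2 * h3

lemma gsub_pow_coeff (t : ℂ) (j k : ℕ) : coeff k (gsub t ^ j) =
    if j ≤ k then (-1:ℂ) ^ (k-j) * ((k-1).choose (k-j) : ℂ) * t ^ (k-j) else 0 := by
  rw [gsub, mul_pow, coeff_X_pow_mul']
  split_ifs with h
  · have e : PowerSeries.mk (fun n => (-t) ^ n) = rescale (-t) (PowerSeries.mk 1) := by
      ext; simp [coeff_rescale]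
    rw [e, ← map_pow, coeff_rescale]
    rcases j with _ | d
    · rcases k with _ | k
      · simp
      · simp [coeff_one]
    · rw [mk_one_pow_eq_mk_choose_add, coeff_mk, neg_pow]
      have : (d + (k - (d+1))).choose d = (k-1).choose (k - (d+1)) := by
        rw [Nat.choose_symm_add]
        congr 1; omega
      rw [this]; ring
  · rfl

lemma shift_eq (r : ℕ → ℂ) (t : ℂ) :
    PowerSeries.mk (shiftS r t) = (PowerSeries.mk r).subst (gsub t) := by
  ext k
  rw [coeff_subst' (gsub_hasSubst t), coeff_mk, shiftS]
  rw [finsum_eq_sum_of_support_subset (s := Finset.range (k+1))]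
  · apply Finset.sum_congr rfl
    intro j hj
    have hj : j ≤ k := by simpa [Nat.lt_succ_iff] using hj
    rw [gsub_pow_coeff, if_pos hj]
    simp; ring
  · intro j hj
    simp only [Function.mem_support, gsub_pow_coeff] at hj
    by_contra hc
    apply hj
    rw [if_neg]
    · simp
    · simpa [Nat.lt_succ_iff] using hc

lemma shift_zero (r : ℕ → ℂ) (t : ℂ) : shiftS r t 0 = r 0 := by simp [shiftS]
lemma shift_one (r : ℕ → ℂ) (t : ℂ) : shiftS r t 1 = r 1 := by
  simp [shiftS, Finset.sum_range_succ]
lemma shift_two (r : ℕ → ℂ) (t : ℂ) : shiftS r t 2 = r 2 - t * r 1 := by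
  simp [shiftS, Finset.sum_range_succ]; ring

lemma sol_shift {η : ℂ} {a r : ℕ → ℂ} (t : ℂ) (h0 : r 0 = 0) (h : SolODE η a r) :
    SolODE η a (shiftS r t) := by
  have hg := gsub_hasSubst t
  have hD : ∀ f : PowerSeries ℂ, (psD f).subst (gsub t) = psD (f.subst (gsub t)) := by
    intro f
    unfold psD
    rw [derivative_subst hg, mul_left_comm, gsub_deriv, ← coe_substAlgHom hg, map_neg, map_mul,
      map_pow, substAlgHom_X]
    ring
  refine sol_map h0 (by rw [shift_zero, h0]) (substAlgHom hg) ?_ ?_ ?_ h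
  · rw [substAlgHom_X]; exact ⟨_, rfl⟩
  · intro f
    rw [coe_substAlgHom, hD, hD]
  · rw [coe_substAlgHom, shift_eq]

/-- leading coefficient -/
lemma sol_lead {η κ : ℂ} (hη : η ≠ 0) (hκ : κ ^ 2 = -2 / η) {a r : ℕ → ℂ} (h0 : r 0 = 0)
    (hne : ∃ k, r k ≠ 0) (h : SolODE η a r) : r 1 = κ ∨ r 1 = -κ := by
  classical
  rw [sol_iff] at h
  have hc0 : coeff 0 (PowerSeries.mk r) = 0 := by simpa using h0
  have h1 : r 1 ≠ 0 := by
    intro h1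
    have hm := Nat.find_spec hne
    have hlt : ∀ i, i < Nat.find hne → r i = 0 := fun i hi => by
      simpa using Nat.find_min hne hi
    generalize Nat.find hne = m at *
    have hm2 : 2 ≤ m := by
      by_contra hc
      have : m < 2 := by omega
      interval_cases m
      · exact hm h0
      · exact hm h1
    have hd : (X : PowerSeries ℂ) ^ m ∣ PowerSeries.mk r := by
      rw [X_pow_dvd_iff]; intro i hi; simpa using hlt i hi
    have hk := h (m+2)
    rw [coeff_psP, coeff_psDD, coeff_pow_lt hd (by omega), Finset.sum_eq_zero] at hk
    · simp at hk
      rcases hk with (hk | hk) | hk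
      · norm_cast at hk
      · omega
      · exact hm hk
    · intro j hj
      simp only [Finset.mem_Icc] at hj
      rw [coeff_pow_lt hd (by nlinarith), mul_zero]
  have h3 := h 3
  rw [coeff_psP_three hc0, coeff_mk] at h3
  have h4 : r 1 ^ 2 = κ ^ 2 := by
    rw [hκ, eq_div_iff hη]
    apply mul_left_cancel₀ h1
    linear_combination h3
  exact sq_eq_sq_iff_eq_or_eq_neg.1 h4

lemma sol_pos {η κ : ℂ} (hη : η ≠ 0) (hκ : κ ^ 2 = -2 / η) {a r s : ℕ → ℂ}
    (hr0 : r 0 = 0) (hr1 : r 1 = κ) (hr : SolODE η a r)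
    (hs0 : s 0 = 0) (hs1 : s 1 = κ) (hs : SolODE η a s) :
    ∃ t, s = shiftS r t := by
  have hk : κ ≠ 0 := by
    rintro rfl
    have : (-2 / η) ≠ 0 := div_ne_zero (by norm_num) hη
    exact this (by rw [← hκ]; norm_num)
  refine ⟨(r 2 - s 2) / κ, ?_⟩
  refine sol_unique hη hκ hs (sol_shift _ hr0 hr) hs0 (by rw [shift_zero, hr0]) hs1
    (by rw [shift_one, hr1]) ?_
  rw [shift_two, hr1]
  field_simp
  ring

lemma sol_three {η κ : ℂ} (hη : η ≠ 0) (hκ : κ ^ 2 = -2 / η) {a r : ℕ → ℂ}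
    (h0 : r 0 = 0) (h1 : r 1 = κ) (h2 : r 2 = 0) (h : SolODE η a r) :
    r 3 = -(1/8) * a 3 * κ ^ 5 := by
  have hk := (sol_iff _ _ _).1 h 5
  have hc0 : coeff 0 (PowerSeries.mk r) = 0 := by simpa using h0
  rw [← coeff_psP_trunc hc0 le_rfl, coeff_psP, coeff_psDD _ 3, ← fpsPow_coeff] at hk
  have hI : Finset.Icc 2 5 = {2, 3, 4, 5} := by decide
  rw [hI] at hk
  simp only [Finset.mem_insert, Finset.mem_singleton, Finset.sum_insert, Finset.sum_singleton,
    Nat.reduceEqDiff, or_self, not_false_eq_true] at hk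
  have e5 := coeff_pow_self hc0 5
  rw [show 2 * 2 + 1 = 5 from rfl, e5, coeff_pow_lt (n := 2*3+1) (X_dvd' hc0) (by omega),
    coeff_pow_lt (n := 2*4+1) (X_dvd' hc0) (by omega),
    coeff_pow_lt (n := 2*5+1) (X_dvd' hc0) (by omega)] at hk
  simp [fpsPow, fpsMul, Finset.sum_range_succ, h0, h1, h2] at hk
  have hη2 : η * κ ^ 2 = -2 := by rw [hκ]; field_simp
  linear_combination (1/6) * hk - (1/2) * r 3 * hη2

end S12

theorem statement12 (η : ℂ) (hη : η ≠ 0) (a : ℕ → ℂ) (κ : ℂ) (hκ : κ ^ 2 = -2 / η) :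
    ∃ r : ℕ → ℂ,
      (r 0 = 0 ∧ (∀ k, Even k → r k = 0) ∧ r 1 = κ ∧ SolODE η a r) ∧
      r 3 = -(1/8) * a 3 * κ ^ 5 ∧
      (∀ r' : ℕ → ℂ,
        (r' 0 = 0 ∧ (∀ k, Even k → r' k = 0) ∧ r' 1 = κ ∧ SolODE η a r') → r' = r) ∧
      (∀ rt : ℕ → ℂ, rt 0 = 0 → (∃ k, rt k ≠ 0) → SolODE η a rt →
        ∃ τ₀ : ℂ, (∀ k, rt k = shiftS r τ₀ k) ∨ (∀ k, rt k = -(shiftS r τ₀ k))) := by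
  have hsol := S12.rec0_sol hη a hκ
  have h0 := S12.rec0_zero η a κ
  have h1 := S12.rec0_one η a κ
  have h2 := S12.rec0_two hη a hκ
  generalize S12.rec0 η a κ = r at *
  refine ⟨r, ⟨h0, ?_, h1, hsol⟩, S12.sol_three hη hκ h0 h1 h2 hsol, ?_, ?_⟩
  · have e := S12.sol_unique hη hκ hsol (S12.sol_neg (S12.sol_refl h0 hsol)) h0 (by simp [h0]) h1
      (by simp [h1]) (by simp [h2])
    intro k hk
    have := congrFun e k
    rw [hk.neg_one_pow, one_mul] at this
    exact self_eq_neg.1 this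
  · rintro r' ⟨h0', he', h1', hs'⟩
    exact S12.sol_unique hη hκ hs' hsol h0' h0 h1' h1 (by rw [h2, he' 2 even_two])
  · intro rt ht0 hne hs
    rcases S12.sol_lead hη hκ ht0 hne hs with h | h
    · obtain ⟨t, ht⟩ := S12.sol_pos hη hκ h0 h1 hsol ht0 h hs
      exact ⟨t, Or.inl (congrFun ht)⟩
    · obtain ⟨t, ht⟩ := S12.sol_pos hη hκ h0 h1 hsol (s := fun k => - rt k) (by simp [ht0])
        (by simp [h]) (S12.sol_neg hs)
      refine ⟨t, Or.inr fun k => ?_⟩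
      rw [← congrFun ht k, neg_neg]
end
end
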